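/- The fifth group cohomology H^5(Γ_0(11), ℂ) has dimension 2 as a ℂ-vector space. -/

import Mathlib

/-- The congruence subgroup `Γ₀(N) ⊆ SL(4, ℤ)` consisting of matrices whose last row is
congruent to `(0,0,0,*)` modulo `N`, i.e. whose first three entries of the last row are
divisible by `N`. -/
def Gamma0 (N : ℕ) : Subgroup (Matrix.SpecialLinearGroup (Fin 4) ℤ) where
  carrier := {A | ∀ j : Fin 4, j ≠ 3 → (N : ℤ) ∣ A.1 3 j}
  one_mem' := by
    intro j hj
    simp [Matrix.one_apply_ne' hj]
  mul_mem' := by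
    intro A B hA hB j hj
    show (N : ℤ) ∣ (A.1 * B.1) 3 j
    rw [Matrix.mul_apply]
    refine Finset.dvd_sum fun k _ => ?_
    by_cases hk : k = 3
    · subst hk
      exact (hB j hj).mul_left _
    · exact (hA k hk).mul_right _
  inv_mem' := by
    intro A hA j hj
    have hAB : (A.1 : Matrix (Fin 4) (Fin 4) ℤ) * (A⁻¹).1 = 1 := by
      rw [← Matrix.SpecialLinearGroup.coe_mul, mul_inv_cancel,
        Matrix.SpecialLinearGroup.coe_one]
    set f : ℤ →+* ZMod N := Int.castRingHom (ZMod N) with hf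
    have hab : (A.1.map f) * ((A⁻¹).1.map f) = 1 := by
      rw [← Matrix.map_mul, hAB, Matrix.map_one f f.map_zero f.map_one]
    have ha0 : ∀ k : Fin 4, k ≠ 3 → (A.1.map f) 3 k = 0 := by
      intro k hk
      have := hA k hk
      simpa [Matrix.map_apply, hf, ZMod.intCast_zmod_eq_zero_iff_dvd] using this
    have hsum : ∀ i, ∑ k, (A.1.map f) 3 k * ((A⁻¹).1.map f) k i
        = (1 : Matrix (Fin 4) (Fin 4) (ZMod N)) 3 i := by
      intro i
      rw [← Matrix.mul_apply, hab]
    have hsum' : ∀ i, (A.1.map f) 3 3 * ((A⁻¹).1.map f) 3 i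
        = (1 : Matrix (Fin 4) (Fin 4) (ZMod N)) 3 i := by
      intro i
      have h := hsum i
      rw [Fin.sum_univ_four, ha0 0 (by decide), ha0 1 (by decide),
        ha0 2 (by decide), zero_mul, zero_mul, zero_mul, zero_add, zero_add,
        zero_add] at h
      exact h
    have hunit : (A.1.map f) 3 3 * ((A⁻¹).1.map f) 3 3 = 1 := by
      simpa [Matrix.one_apply] using hsum' 3
    have hzero : (A.1.map f) 3 3 * ((A⁻¹).1.map f) 3 j = 0 := by
      simpa [Matrix.one_apply_ne' hj] using hsum' j
    have hb : ((A⁻¹).1.map f) 3 j = 0 := by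
      calc ((A⁻¹).1.map f) 3 j
          = ((A.1.map f) 3 3 * ((A⁻¹).1.map f) 3 3) * ((A⁻¹).1.map f) 3 j := by
            rw [hunit, one_mul]
        _ = ((A⁻¹).1.map f) 3 3 * ((A.1.map f) 3 3 * ((A⁻¹).1.map f) 3 j) := by ring
        _ = 0 := by rw [hzero, mul_zero]
    show (N : ℤ) ∣ (A⁻¹).1 3 j
    rw [← ZMod.intCast_zmod_eq_zero_iff_dvd]
    simpa [Matrix.map_apply, hf] using hb

/-! ### Cochains on lists -/

namespace ListCochain

variable {X Y : Type*}

/-- The simplicial coboundary of a function on ordered tuples. -/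
def cob : (List X → ℂ) → List X → ℂ
  | _, [] => 0
  | φ, a :: l => φ l - cob (fun m => φ (a :: m)) l

/-- Functions on ordered tuples which change sign under adjacent transpositions. -/
def Alt (φ : List X → ℂ) : Prop :=
  ∀ p a b s, φ (p ++ a :: b :: s) = -φ (p ++ b :: a :: s)

@[simp] lemma cob_nil (φ : List X → ℂ) : cob φ [] = 0 := by simp [cob]

lemma cob_cons (φ : List X → ℂ) (a : X) (l : List X) :
    cob φ (a :: l) = φ l - cob (fun m => φ (a :: m)) l := by simp [cob]

lemma cob_add (φ ψ : List X → ℂ) (l : List X) :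
    cob (fun m => φ m + ψ m) l = cob φ l + cob ψ l := by
  induction l generalizing φ ψ with
  | nil => simp
  | cons a l ih => rw [cob_cons, cob_cons, cob_cons, ih]; ring

lemma cob_smul (c : ℂ) (φ : List X → ℂ) (l : List X) :
    cob (fun m => c * φ m) l = c * cob φ l := by
  induction l generalizing φ with
  | nil => simp
  | cons a l ih => rw [cob_cons, cob_cons, ih]; ring

lemma cob_neg (φ : List X → ℂ) (l : List X) :
    cob (fun m => -φ m) l = -cob φ l := by
  simpa using cob_smul (-1) φ l

lemma cob_sub (φ ψ : List X → ℂ) (l : List X) :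
    cob (fun m => φ m - ψ m) l = cob φ l - cob ψ l := by
  simp only [sub_eq_add_neg]
  rw [cob_add, cob_neg]

@[simp] lemma cob_zero (l : List X) : cob (fun _ => 0) l = 0 := by
  simpa using cob_smul 0 (fun _ => 0) l

lemma cob_cob (φ : List X → ℂ) (l : List X) : cob (cob φ) l = 0 := by
  induction l generalizing φ with
  | nil => simp
  | cons a l ih =>
    rw [cob_cons]
    simp only [cob_cons]
    rw [cob_sub, ih (fun m => φ (a :: m))]
    ring

lemma cob_map (f : X → Y) (φ : List Y → ℂ) (l : List X) :
    cob φ (l.map f) = cob (fun m => φ (m.map f)) l := by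
  induction l generalizing φ with
  | nil => simp
  | cons a l ih => rw [List.map_cons, cob_cons, cob_cons, ih]; rfl

lemma exists_of_cob_ne_zero {φ : List X → ℂ} {l : List X} (h : cob φ l ≠ 0) :
    ∃ m, m.Sublist l ∧ m.length + 1 = l.length ∧ φ m ≠ 0 := by
  induction l generalizing φ with
  | nil => simp at h
  | cons a l ih =>
    rw [cob_cons] at h
    by_cases h1 : φ l = 0
    · rw [h1, zero_sub] at h
      obtain ⟨m, hm, hl, h2⟩ := ih (neg_ne_zero.1 h)
      exact ⟨a :: m, hm.cons_cons a, by simpa using hl, h2⟩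
    · exact ⟨l, List.sublist_cons_self a l, rfl, h1⟩

lemma cob_congr {φ ψ : List X → ℂ} {l : List X}
    (h : ∀ m, m.Sublist l → m.length + 1 = l.length → φ m = ψ m) : cob φ l = cob ψ l := by
  by_contra hne
  have h1 : cob (fun m => φ m - ψ m) l ≠ 0 := by
    rw [cob_sub]; exact sub_ne_zero.2 hne
  obtain ⟨m, hm, hl, h2⟩ := exists_of_cob_ne_zero h1
  exact h2 (sub_eq_zero.2 (h m hm hl))

namespace Alt

variable {φ ψ : List X → ℂ}

lemma cons (h : Alt φ) (a : X) : Alt (fun m => φ (a :: m)) :=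
  fun p b c s => h (a :: p) b c s

lemma map (h : Alt φ) (f : Y → X) : Alt (fun m => φ (m.map f)) := fun p b c s => by
  simpa using h (p.map f) (f b) (f c) (s.map f)

lemma swap (h : Alt φ) (a b : X) (s : List X) : φ (a :: b :: s) = -φ (b :: a :: s) :=
  h [] a b s

protected lemma cob (h : Alt φ) : Alt (cob φ) := by
  intro p a b s
  induction p generalizing φ with
  | nil =>
    simp only [List.nil_append, cob_cons]
    have : (fun m => φ (a :: b :: m)) = fun m => -φ (b :: a :: m) := by
      funext m; exact h.swap a b m
    rw [this, cob_neg]; ring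
  | cons x p ih =>
    rw [List.cons_append, List.cons_append, cob_cons, cob_cons, h p a b s, ih (h.cons x)]; ring

lemma add (h : Alt φ) (h' : Alt ψ) : Alt (fun m => φ m + ψ m) := fun p a b s => by
  simp only [h p a b s, h' p a b s]; ring

lemma sub (h : Alt φ) (h' : Alt ψ) : Alt (fun m => φ m - ψ m) := fun p a b s => by
  simp only [h p a b s, h' p a b s]; ring

lemma const_mul (c : ℂ) (h : Alt φ) : Alt (fun m => c * φ m) := fun p a b s => by
  simp only [h p a b s]; ring

lemma symm_mul {w : List X → ℂ} (hw : ∀ l l', l.Perm l' → w l = w l') (h : Alt φ) :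
    Alt (fun m => w m * φ m) := fun p a b s => by
  simp only [h p a b s]
  rw [hw _ (p ++ b :: a :: s) (List.Perm.append_left p (List.Perm.swap b a s))]; ring

lemma ite {P : List X → Prop} [DecidablePred P] (hP : ∀ l l', l.Perm l' → P l → P l') (h : Alt φ) :
    Alt (fun m => if P m then φ m else 0) := fun p a b s => by
  have hp : (p ++ a :: b :: s).Perm (p ++ b :: a :: s) :=
    List.Perm.append_left p (List.Perm.swap b a s)
  beta_reduce
  by_cases h1 : P (p ++ a :: b :: s)
  · rw [if_pos h1, if_pos (hP _ _ hp h1), h p a b s]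
  · rw [if_neg h1, if_neg (fun h2 => h1 (hP _ _ hp.symm h2)), neg_zero]

end Alt

lemma exists_sign_of_perm {l l' : List X} (h : l.Perm l') :
    ∃ ε : ℂ, (ε = 1 ∨ ε = -1) ∧ ∀ φ : List X → ℂ, Alt φ → φ l = ε * φ l' := by
  induction h with
  | nil => exact ⟨1, Or.inl rfl, fun φ _ => by simp⟩
  | cons x _ ih =>
    obtain ⟨ε, h1, h2⟩ := ih
    exact ⟨ε, h1, fun φ hφ => h2 _ (hφ.cons x)⟩
  | swap x y l => exact ⟨-1, Or.inr rfl, fun φ hφ => by rw [hφ.swap]; ring⟩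
  | trans _ _ ih1 ih2 =>
    obtain ⟨ε, h1, h2⟩ := ih1
    obtain ⟨ε', h1', h2'⟩ := ih2
    refine ⟨ε * ε', ?_, fun φ hφ => by rw [h2 φ hφ, h2' φ hφ]; ring⟩
    rcases h1 with rfl | rfl <;> rcases h1' with rfl | rfl <;> simp

lemma Alt.ne_zero_of_perm {φ : List X → ℂ} (hφ : Alt φ) {l l' : List X} (h : l.Perm l')
    (h0 : φ l ≠ 0) : φ l' ≠ 0 := by
  obtain ⟨ε, -, h2⟩ := exists_sign_of_perm h
  intro h3
  rw [h2 φ hφ, h3, mul_zero] at h0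
  exact h0 rfl

lemma Alt.mul_eq_of_perm {φ ψ : List X → ℂ} (hφ : Alt φ) (hψ : Alt ψ) {l l' : List X}
    (h : l.Perm l') : φ l * ψ l = φ l' * ψ l' := by
  obtain ⟨ε, h1, h2⟩ := exists_sign_of_perm h
  rw [h2 φ hφ, h2 ψ hψ]
  rcases h1 with rfl | rfl <;> ring

lemma Alt.eq_zero_of_not_nodup {φ : List X → ℂ} (hφ : Alt φ) {l : List X} (h : ¬ l.Nodup) :
    φ l = 0 := by
  obtain ⟨a, ha⟩ := List.exists_duplicate_iff_not_nodup.2 h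
  obtain ⟨s, hs⟩ := (List.duplicate_iff_sublist.1 ha).exists_perm_append
  by_contra h0
  have h1 := hφ.ne_zero_of_perm hs h0
  have h2 := hφ.swap a a s
  simp only [List.cons_append, List.nil_append] at h1
  exact h1 (by linear_combination h2 / 2)

end ListCochain

/-! ### Abstract frame complexes -/

open ListCochain

/-- Combinatorial data of a complex of vertices `V`, each carrying a finite set `inc Q` of
generators and three frames `F Q i` whose transversals index the edges at `Q`. -/
structure FrameData (X V : Type*) where
  inc : V → Finset X
  F : V → Fin 3 → Finset X
  m : V → Fin 3 → X
  neg : V → (Fin 3 → X) → Prop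
  o : V → List X → ℂ

namespace FrameData

variable {X V : Type*} (D : FrameData X V)

/-- `l` lists distinct generators of `Q` and misses an element of every frame. -/
def Face (Q : V) (l : List X) : Prop :=
  l.Nodup ∧ (∀ x ∈ l, x ∈ D.inc Q) ∧ ∀ i, ∃ a ∈ D.F Q i, a ∉ l

/-- `l` is a face of `Q` all of whose edges at `Q` descend. -/
def Dn (Q : V) (l : List X) : Prop :=
  D.Face Q l ∧ ∀ t : Fin 3 → X, (∀ i, t i ∈ D.F Q i) → (∀ i, t i ∉ l) → D.neg Q t

def Cell (l : List X) : Prop := ∃ Q, D.Dn Q l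

variable {D}

lemma Face.perm {Q : V} {l l' : List X} (h : D.Face Q l) (hp : l.Perm l') : D.Face Q l' := by
  obtain ⟨h1, h2, h3⟩ := h
  refine ⟨hp.nodup_iff.1 h1, fun x hx => h2 x (hp.mem_iff.2 hx), fun i => ?_⟩
  obtain ⟨a, ha, hl⟩ := h3 i
  exact ⟨a, ha, fun h => hl (hp.mem_iff.2 h)⟩

lemma Dn.perm {Q : V} {l l' : List X} (h : D.Dn Q l) (hp : l.Perm l') : D.Dn Q l' :=
  ⟨h.1.perm hp, fun t ht htl => h.2 t ht fun i hi => htl i (hp.mem_iff.1 hi)⟩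

lemma Cell.perm {l l' : List X} (h : D.Cell l) (hp : l.Perm l') : D.Cell l' :=
  h.imp fun _ hQ => hQ.perm hp

lemma Face.sublist {Q : V} {l l' : List X} (h : D.Face Q l) (hp : l'.Sublist l) :
    D.Face Q l' := by
  obtain ⟨h1, h2, h3⟩ := h
  refine ⟨h1.sublist hp, fun x hx => h2 x (hp.subset hx), fun i => ?_⟩
  obtain ⟨a, ha, hl⟩ := h3 i
  exact ⟨a, ha, fun h => hl (hp.subset h)⟩

variable (D) in
/-- The laws making the complex of a `FrameData` exact. -/
structure Laws [LinearOrder V] : Prop where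
  m_mem : ∀ Q i, D.m Q i ∈ D.F Q i
  exch : ∀ Q t i, (∀ j, t j ∈ D.F Q j) → D.neg Q t → D.neg Q (Function.update t i (D.m Q i))
  mem_inc : ∀ Q i a, a ∈ D.F Q i → a ∈ D.inc Q ∨ D.F Q i = {a}
  disj : ∀ Q i j a, a ∈ D.F Q i → a ∈ D.F Q j → i = j ∨ D.F Q i = {a}
  mem_F : ∀ Q x, x ∈ D.inc Q → ∃ i, x ∈ D.F Q i
  card : ∀ Q (t : Fin 3 → X), (∀ i, t i ∈ D.F Q i) →
    ∃ E : Finset X, E.card = 9 ∧ ∀ x, x ∈ E ↔ x ∈ D.inc Q ∧ ∀ i, x ≠ t i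
  top : ∀ Q Q' l, D.Dn Q l → (∀ x ∈ l, x ∈ D.inc Q') → D.Face Q' l ∧ Q' ≤ Q
  up : ∀ l l' Q, D.Cell l → (∀ x ∈ l, x ∈ l') → D.Face Q l' → D.Cell l'
  fin : ∀ l, D.Cell l → {Q | ∀ x ∈ l, x ∈ D.inc Q}.Finite
  o_alt : ∀ Q, Alt (D.o Q)
  o_supp : ∀ Q l, D.o Q l ≠ 0 ↔ D.Face Q l ∧ l.length = 9
  o_sum : ∀ Q l, D.Face Q l → l.length = 8 → ∑ x ∈ D.inc Q, D.o Q (x :: l) = 0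
  edge : ∀ Q l, D.Face Q l → l.length = 9 →
    ∃ Q', Q' ≠ Q ∧ (∀ T, D.Face T l ↔ T = Q ∨ T = Q') ∧ D.o Q l + D.o Q' l = 0
  bot : ∀ Q, ¬ D.neg Q (D.m Q) → ∀ T, Q ≤ T

open Classical in
variable (D) in
/-- The differential: the coboundary restricted to cells. -/
noncomputable def d : (List X → ℂ) →ₗ[ℂ] (List X → ℂ) where
  toFun φ l := if D.Cell l then cob φ l else 0
  map_add' φ ψ := by
    funext l
    by_cases h : D.Cell l
    · simp only [h, if_true, Pi.add_apply]; exact cob_add φ ψ l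
    · simp [h]
  map_smul' c φ := by
    funext l
    by_cases h : D.Cell l
    · simp only [h, if_true, Pi.smul_apply, smul_eq_mul, RingHom.id_apply]; exact cob_smul c φ l
    · simp [h]

lemma d_of_cell {l : List X} (h : D.Cell l) (φ : List X → ℂ) : D.d φ l = cob φ l := by
  classical exact if_pos h

lemma d_of_not_cell {l : List X} (h : ¬ D.Cell l) (φ : List X → ℂ) : D.d φ l = 0 := by
  classical exact if_neg h

lemma cell_of_d_ne_zero {φ : List X → ℂ} {l : List X} (h : D.d φ l ≠ 0) : D.Cell l := by
  by_contra h1; exact h (d_of_not_cell h1 φ)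

lemma alt_d {φ : List X → ℂ} (h : Alt φ) : Alt (D.d φ) := by
  classical exact Alt.ite (fun _ _ hp h => h.perm hp) h.cob

variable (D) in
/-- Functions supported on cells. -/
def OnCells (φ : List X → ℂ) : Prop := ∀ l, φ l ≠ 0 → D.Cell l

variable [LinearOrder V]

lemma d_d (hD : D.Laws) {φ : List X → ℂ} (hφ : D.OnCells φ) : D.d (D.d φ) = 0 := by
  funext l
  by_cases h : D.Cell l
  · rw [d_of_cell h, Pi.zero_apply, ← cob_cob φ l]
    apply cob_congr
    intro m hm _
    by_cases h' : D.Cell m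
    · rw [d_of_cell h']
    · rw [d_of_not_cell h']
      by_contra h0
      obtain ⟨k, hk, _, h1⟩ := exists_of_cob_ne_zero (Ne.symm h0)
      obtain ⟨Q, hQ⟩ := h
      exact h' (hD.up k m Q (hφ k h1) (fun x hx => hk.subset hx) (hQ.1.sublist hm))
  · rw [d_of_not_cell h]; rfl

variable (D) in
/-- Finitely supported alternating functions on cells with `9 - n` elements. -/
def IsChain (n : ℕ) (φ : List X → ℂ) : Prop :=
  Alt φ ∧ φ.support.Finite ∧ ∀ l, φ l ≠ 0 → D.Cell l ∧ l.length + n = 9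

omit [LinearOrder V] in
lemma IsChain.onCells {n : ℕ} {φ : List X → ℂ} (h : D.IsChain n φ) : D.OnCells φ :=
  fun l hl => (h.2.2 l hl).1

omit [LinearOrder V] in
lemma IsChain.add {n : ℕ} {φ ψ : List X → ℂ} (h : D.IsChain n φ) (h' : D.IsChain n ψ) :
    D.IsChain n (φ + ψ) := by
  refine ⟨h.1.add h'.1, (h.2.1.union h'.2.1).subset (Function.support_add φ ψ), fun l hl => ?_⟩
  by_cases h1 : φ l = 0
  · exact h'.2.2 l (by simpa [h1] using hl)
  · exact h.2.2 l h1

omit [LinearOrder V] in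
lemma IsChain.smul {n : ℕ} {φ : List X → ℂ} (c : ℂ) (h : D.IsChain n φ) :
    D.IsChain n (c • φ) := by
  refine ⟨h.1.const_mul c, h.2.1.subset (Function.support_const_smul_subset c φ),
    fun l hl => h.2.2 l ?_⟩
  rintro h1
  exact hl (by simp [h1])

omit [LinearOrder V] in
variable (D) in
lemma isChain_zero (n : ℕ) : D.IsChain n 0 :=
  ⟨fun _ _ _ _ => by simp, by simp, fun _ h => (h rfl).elim⟩

omit [LinearOrder V] in
lemma IsChain.sub {n : ℕ} {φ ψ : List X → ℂ} (h : D.IsChain n φ) (h' : D.IsChain n ψ) :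
    D.IsChain n (φ - ψ) := by
  have := h.add (h'.smul (-1))
  rwa [neg_one_smul, ← sub_eq_add_neg] at this

lemma finite_cofaces (hD : D.Laws) {l : List X} (hl : D.Cell l) (n : ℕ) :
    {l' : List X | D.Cell l' ∧ l.Sublist l' ∧ l'.length = n}.Finite := by
  refine Set.Finite.subset (s := ⋃ Q ∈ {Q | ∀ x ∈ l, x ∈ D.inc Q},
    {l' : List X | l'.length = n ∧ ∀ x ∈ l', x ∈ D.inc Q}) ?_ ?_
  · apply (hD.fin l hl).biUnion
    intro Q _
    have h1 := List.finite_length_eq {x // x ∈ D.inc Q} n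
    refine (h1.image (List.map Subtype.val)).subset ?_
    rintro l' ⟨h2, h3⟩
    refine ⟨l'.attachWith _ h3, by simpa using h2, by simp⟩
  · rintro l' ⟨⟨Q, hQ⟩, h2, h3⟩
    simp only [Set.mem_iUnion]
    exact ⟨Q, fun x hx => hQ.1.2.1 x (h2.subset hx), h3, hQ.1.2.1⟩

lemma IsChain.d (hD : D.Laws) {n : ℕ} {φ : List X → ℂ} (h : D.IsChain (n + 1) φ) :
    D.IsChain n (D.d φ) := by
  have key : ∀ l, D.d φ l ≠ 0 → ∃ m, m.Sublist l ∧ m.length + 1 = l.length ∧ φ m ≠ 0 := by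
    intro l hl
    have h1 := cell_of_d_ne_zero hl
    rw [d_of_cell h1] at hl
    exact exists_of_cob_ne_zero hl
  refine ⟨alt_d h.1, ?_, fun l hl => ⟨cell_of_d_ne_zero hl, ?_⟩⟩
  · refine Set.Finite.subset (s := ⋃ m ∈ φ.support,
      {l' : List X | D.Cell l' ∧ m.Sublist l' ∧ l'.length = m.length + 1}) ?_ ?_
    · exact h.2.1.biUnion fun m hm => finite_cofaces hD (h.onCells m hm) _
    · intro l hl
      obtain ⟨m, h1, h2, h3⟩ := key l hl
      simp only [Set.mem_iUnion]
      exact ⟨m, h3, cell_of_d_ne_zero hl, h1, h2.symm⟩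
  · obtain ⟨m, h1, h2, h3⟩ := key l hl
    have := (h.2.2 m h3).2
    omega

/-! #### Cancelling the chains at a given vertex -/

lemma Dn.tail (hD : D.Laws) {Q : V} {l : List X} {i : Fin 3} (h : D.Dn Q (D.m Q i :: l)) :
    D.Dn Q l := by
  obtain ⟨hF, hn⟩ := h
  refine ⟨hF.sublist (List.sublist_cons_self _ _), fun t ht htl => ?_⟩
  have hj : ∀ j, j ≠ i → t j ≠ D.m Q i := by
    intro j hji h
    rcases hD.disj Q j i (D.m Q i) (h ▸ ht j) (hD.m_mem Q i) with h1 | h1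
    · exact hji h1
    · obtain ⟨a, ha, hal⟩ := hF.2.2 j
      rw [h1, Finset.mem_singleton] at ha
      exact hal (by simp [ha])
  obtain ⟨a, ha, hal⟩ := hF.2.2 i
  by_cases hi : t i = D.m Q i
  · have h1 := hn (Function.update t i a) (fun j => by
      by_cases hji : j = i
      · subst hji; simpa using ha
      · simpa [hji] using ht j) (fun j => by
      by_cases hji : j = i
      · subst hji; simpa using hal
      · simpa [hji] using ⟨hj j hji, htl j⟩)
    have h2 := hD.exch Q _ i (fun j => by
      by_cases hji : j = i
      · subst hji; simpa using ha
      · simpa [hji] using ht j) h1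
    rwa [Function.update_idem, ← hi, Function.update_eq_self] at h2
  · refine hn t ht fun j => ?_
    by_cases hji : j = i
    · subst hji; simpa using ⟨hi, htl j⟩
    · simpa using ⟨hj j hji, htl j⟩

lemma Dn.cons (hD : D.Laws) {Q : V} {l : List X} {i : Fin 3} (h : D.Dn Q l)
    (hm : D.m Q i ∉ l) {a : X} (ha : a ∈ D.F Q i) (hal : a ∉ l) (ham : a ≠ D.m Q i) :
    D.Dn Q (D.m Q i :: l) := by
  have hns : D.F Q i ≠ {D.m Q i} := fun h => ham (by simpa [h] using ha)
  refine ⟨⟨List.nodup_cons.2 ⟨hm, h.1.1⟩, ?_, fun j => ?_⟩,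
    fun t ht htl => h.2 t ht fun j hj => htl j (List.mem_cons_of_mem _ hj)⟩
  · intro x hx
    rcases List.mem_cons.1 hx with rfl | hx
    · exact (hD.mem_inc Q i _ (hD.m_mem Q i)).resolve_right hns
    · exact h.1.2.1 x hx
  · by_cases hji : j = i
    · subst hji; exact ⟨a, ha, by simp [ham, hal]⟩
    · obtain ⟨b, hb, hbl⟩ := h.1.2.2 j
      refine ⟨b, hb, ?_⟩
      rw [List.mem_cons, not_or]
      refine ⟨fun hbm => ?_, hbl⟩
      rcases hD.disj Q i j (D.m Q i) (hD.m_mem Q i) (hbm ▸ hb) with h1 | h1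
      · exact hji h1.symm
      · exact hns h1

variable (D) in
/-- The only element of the frame `F Q i` outside `l` is `m Q i`. -/
def Tight (Q : V) (i : Fin 3) (l : List X) : Prop := ∀ a ∈ D.F Q i, a ∉ l → a = D.m Q i

variable (D) in
/-- `φ` is supported on cells whose top vertex is at most `Q`. -/
def Below (Q : V) (φ : List X → ℂ) : Prop := ∀ l T, φ l ≠ 0 → D.Dn T l → T ≤ Q

lemma toggle (hD : D.Laws) {n : ℕ} {φ : List X → ℂ} (hφ : D.IsChain n φ)
    (hd : ∀ l, l.length + n = 10 → D.d φ l = 0)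
    {Q : V} (hQ : D.Below Q φ) (i : Fin 3) :
    ∃ ψ, D.IsChain (n + 1) ψ ∧ D.Below Q (φ - D.d ψ) ∧
      (∀ l, D.Dn Q l → (φ - D.d ψ) l ≠ 0 → D.Tight Q i l) ∧
      ∀ j, (∀ l, D.Dn Q l → φ l ≠ 0 → D.Tight Q j l) →
        ∀ l, D.Dn Q l → (φ - D.d ψ) l ≠ 0 → D.Tight Q j l := by
  classical
  set v := D.m Q i with hv
  set φQ : List X → ℂ := fun l => if D.Dn Q l then φ l else 0 with hφQ
  have altQ : Alt φQ := Alt.ite (fun _ _ hp h => h.perm hp) hφ.1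
  have nzQ : ∀ l, φQ l ≠ 0 → D.Dn Q l ∧ φ l ≠ 0 := by
    intro l hl
    by_cases h : D.Dn Q l
    · exact ⟨h, by simpa [hφQ, h] using hl⟩
    · exact (hl (by simp [hφQ, h])).elim
  set ψ : List X → ℂ := fun l => φQ (v :: l) with hψ
  have nzψ : ∀ l, ψ l ≠ 0 → D.Dn Q l := fun l hl => (nzQ _ hl).1.tail hD
  have chψ : D.IsChain (n + 1) ψ := by
    refine ⟨altQ.cons v, ?_, fun l hl => ⟨⟨Q, nzψ l hl⟩, ?_⟩⟩
    · refine (hφ.2.1.preimage (f := fun l => v :: l) ?_).subset ?_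
      · intro a _ b _ h; simpa using h
      · intro l hl; exact (nzQ _ hl).2
    · have := (hφ.2.2 _ (nzQ _ hl).2).2
      simp only [List.length_cons] at this
      omega
  have hval : ∀ l, D.Dn Q l → (φ - D.d ψ) l = cob φQ (v :: l) := by
    intro l hl
    rw [Pi.sub_apply, d_of_cell ⟨Q, hl⟩, cob_cons]
    simp [hφQ, hl, hψ]
  refine ⟨ψ, chψ, ?_, ?_, ?_⟩
  · intro l T hl hT
    by_cases h1 : φ l = 0
    · have h2 : cob ψ l ≠ 0 := by
        rw [Pi.sub_apply, h1, zero_sub, neg_ne_zero, d_of_cell ⟨T, hT⟩] at hl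
        exact hl
      obtain ⟨m, hm, -, h3⟩ := exists_of_cob_ne_zero h2
      exact (hD.top Q T m (nzψ m h3) fun x hx => hT.1.2.1 x (hm.subset hx)).2
    · exact hQ l T h1 hT
  · intro l hl h0 a ha hal
    rw [hval l hl] at h0
    by_contra ham
    have hvl : v ∉ l := fun h => h0 (altQ.cob.eq_zero_of_not_nodup (by simp [h]))
    have hdn := hl.cons hD hvl ha hal ham
    obtain ⟨m, -, hm2, hm3⟩ := exists_of_cob_ne_zero h0
    have hlen := (hφ.2.2 _ (nzQ _ hm3).2).2
    have h1 := hd (v :: l) (by omega)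
    rw [d_of_cell ⟨Q, hdn⟩] at h1
    apply h0
    rw [← h1]
    apply cob_congr
    intro m hm _
    by_cases h2 : D.Dn Q m
    · simp [hφQ, h2]
    · by_contra h3
      have h4 : φ m ≠ 0 := fun h => h3 (by simp [hφQ, h2, h])
      obtain ⟨T, hT⟩ := hφ.onCells m h4
      have h5 := hQ m T h4 hT
      have h6 := (hD.top T Q m hT fun x hx => hdn.1.2.1 x (hm.subset hx)).2
      exact h2 (le_antisymm h5 h6 ▸ hT)
  · intro j hj l hl h0
    by_cases h1 : φ l = 0
    · have h2 : cob ψ l ≠ 0 := by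
        rw [Pi.sub_apply, h1, zero_sub, neg_ne_zero, d_of_cell ⟨Q, hl⟩] at h0
        exact h0
      obtain ⟨m, hm, -, h3⟩ := exists_of_cob_ne_zero h2
      obtain ⟨h4, h5⟩ := nzQ _ h3
      have h6 := hj _ h4 h5
      intro a ha hal
      by_cases hav : a = v
      · by_cases hij : i = j
        · subst hij; exact hav
        · have h7 := hD.m_mem Q j
          rcases hD.disj Q j i a ha (hav ▸ hD.m_mem Q i) with h8 | h8
          · exact (hij h8.symm).elim
          · rw [h8, Finset.mem_singleton] at h7; exact h7.symm
      · exact h6 a ha (by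
          rw [List.mem_cons, not_or]; exact ⟨hav, fun h => hal (hm.subset h)⟩)
    · exact hj l hl h1

lemma cancel (hD : D.Laws) {n : ℕ} {φ : List X → ℂ} (hφ : D.IsChain n φ)
    (hd : ∀ l, l.length + n = 10 → D.d φ l = 0)
    {Q : V} (hQ : D.Below Q φ) :
    ∃ ψ, D.IsChain (n + 1) ψ ∧ D.Below Q (φ - D.d ψ) ∧
      ∀ l, D.Dn Q l → (φ - D.d ψ) l ≠ 0 → ∀ i, D.Tight Q i l := by
  have step : ∀ (φ : List X → ℂ) (ψ : List X → ℂ), D.IsChain n φ →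
      (∀ l, l.length + n = 10 → D.d φ l = 0) → D.IsChain (n + 1) ψ →
      D.IsChain n (φ - D.d ψ) ∧ ∀ l, l.length + n = 10 → D.d (φ - D.d ψ) l = 0 :=
    fun φ ψ h1 h2 h3 => ⟨h1.sub (h3.d hD), fun l hl => by
      rw [map_sub, d_d hD h3.onCells, sub_zero]; exact h2 l hl⟩
  obtain ⟨ψ0, c0, b0, t0, -⟩ := toggle hD hφ hd hQ 0
  obtain ⟨e0, f0⟩ := step φ ψ0 hφ hd c0
  obtain ⟨ψ1, c1, b1, t1, p1⟩ := toggle hD e0 f0 b0 1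
  obtain ⟨e1, f1⟩ := step _ ψ1 e0 f0 c1
  obtain ⟨ψ2, c2, b2, t2, p2⟩ := toggle hD e1 f1 b1 2
  have heq : φ - D.d (ψ0 + ψ1 + ψ2) = φ - D.d ψ0 - D.d ψ1 - D.d ψ2 := by
    rw [map_add, map_add]; abel
  refine ⟨ψ0 + ψ1 + ψ2, (c0.add c1).add c2, heq ▸ b2, ?_⟩
  rw [heq]
  intro l hl h0 i
  fin_cases i
  · exact p2 0 (p1 0 t0) l hl h0
  · exact p2 1 t1 l hl h0
  · exact t2 l hl h0

lemma mem_iff_of_tight (hD : D.Laws) {Q : V} {l : List X} (hl : D.Face Q l)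
    (ht : ∀ i, D.Tight Q i l) (x : X) : x ∈ l ↔ x ∈ D.inc Q ∧ ∀ i, x ≠ D.m Q i := by
  constructor
  · intro hx
    refine ⟨hl.2.1 x hx, fun i hxi => ?_⟩
    obtain ⟨a, ha, hal⟩ := hl.2.2 i
    rw [ht i a ha hal, ← hxi] at hal
    exact hal hx
  · rintro ⟨h1, h2⟩
    by_contra hx
    obtain ⟨i, hi⟩ := hD.mem_F Q x h1
    exact h2 i (ht i x hi hx)

lemma length_of_tight (hD : D.Laws) {Q : V} {l : List X} (hl : D.Face Q l)
    (ht : ∀ i, D.Tight Q i l) : l.length = 9 := by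
  classical
  obtain ⟨E, hE, hm⟩ := hD.card Q (D.m Q) (hD.m_mem Q)
  have : l.toFinset = E := by
    ext x; rw [List.mem_toFinset, mem_iff_of_tight hD hl ht, hm]
  rw [← hE, ← this, List.toFinset_card_of_nodup hl.1]

end FrameData

open ListCochain

section ListsOf

variable {X : Type*}

/-- The embedding `(a, l) ↦ a :: l`. -/
def consEmb : X × List X ↪ List X :=
  ⟨fun p => p.1 :: p.2, fun p q h => by simpa [Prod.ext_iff] using h⟩

@[simp] lemma consEmb_apply (p : X × List X) : consEmb p = p.1 :: p.2 := rfl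

/-- All lists of length `n` with entries in `A`. -/
def listsOf (A : Finset X) : ℕ → Finset (List X)
  | 0 => {[]}
  | n + 1 => (A ×ˢ listsOf A n).map consEmb

lemma mem_listsOf {A : Finset X} {n : ℕ} {l : List X} :
    l ∈ listsOf A n ↔ l.length = n ∧ ∀ x ∈ l, x ∈ A := by
  induction n generalizing l with
  | zero => simp +contextual [listsOf, List.length_eq_zero_iff]
  | succ n ih =>
    cases l with
    | nil => simp [listsOf]
    | cons a l =>
      simp only [listsOf, Finset.mem_map, Finset.mem_product, consEmb_apply,
        Prod.exists, List.cons.injEq, List.length_cons, Nat.add_right_cancel_iff,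
        List.mem_cons, forall_eq_or_imp, ih]
      constructor
      · rintro ⟨a, b, ⟨h1, h2⟩, rfl, rfl⟩
        exact ⟨h2.1, h1, h2.2⟩
      · rintro ⟨h1, h2, h3⟩
        exact ⟨a, l, ⟨h2, h1, h3⟩, rfl, rfl⟩

lemma sum_listsOf_succ (A : Finset X) (n : ℕ) (f : List X → ℂ) :
    ∑ l ∈ listsOf A (n + 1), f l = ∑ a ∈ A, ∑ l ∈ listsOf A n, f (a :: l) := by
  rw [listsOf, Finset.sum_map, Finset.sum_product]; rfl

lemma sum_alt_mul_cob (A : Finset X) (n : ℕ) {w : List X → ℂ} (hw : Alt w) (ψ : List X → ℂ) :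
    ∑ l ∈ listsOf A (n + 1), w l * cob ψ l
      = (n + 1) * ∑ l ∈ listsOf A n, (∑ a ∈ A, w (a :: l)) * ψ l := by
  induction n generalizing w ψ with
  | zero => rw [sum_listsOf_succ]; simp [listsOf, cob_cons, Finset.sum_mul]
  | succ n ih =>
    rw [sum_listsOf_succ]
    simp only [cob_cons, mul_sub, Finset.sum_sub_distrib]
    have h1 : ∀ a, ∑ l ∈ listsOf A (n + 1), w (a :: l) * cob (fun m => ψ (a :: m)) l
        = -((n + 1) * ∑ l ∈ listsOf A n, (∑ b ∈ A, w (b :: a :: l)) * ψ (a :: l)) := by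
      intro a
      rw [ih (hw.cons a), ← mul_neg, ← Finset.sum_neg_distrib]
      congr 1
      refine Finset.sum_congr rfl fun l _ => ?_
      rw [← neg_mul, ← Finset.sum_neg_distrib]
      congr 1
      exact Finset.sum_congr rfl fun b _ => hw.swap a b l
    simp only [h1, Finset.sum_neg_distrib, sub_neg_eq_add]
    rw [← Finset.mul_sum, ← sum_listsOf_succ A n (fun l => (∑ b ∈ A, w (b :: l)) * ψ l),
      Finset.sum_comm]
    simp only [← Finset.sum_mul]
    push_cast
    ring

end ListsOf

namespace FrameData

variable {X V : Type*} {D : FrameData X V} [LinearOrder V]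

variable (D) in
/-- The boundary of a `1`-chain, as a function on vertices. -/
noncomputable def bdFun (φ : List X → ℂ) (Q : V) : ℂ :=
  ∑ l ∈ listsOf (D.inc Q) 9, D.o Q l * φ l

omit [LinearOrder V] in
lemma bdFun_sub (φ ψ : List X → ℂ) (Q : V) :
    D.bdFun (φ - ψ) Q = D.bdFun φ Q - D.bdFun ψ Q := by
  simp [bdFun, mul_sub]

lemma Cell.top_le (hD : D.Laws) {l : List X} {T Q : V} (h : D.Dn T l) (hQ : D.Face Q l) :
    Q ≤ T := (hD.top T Q l h hQ.2.1).2

lemma bdFun_d (hD : D.Laws) {ψ : List X → ℂ} (hψ : D.IsChain 1 ψ) (Q : V) :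
    D.bdFun (D.d ψ) Q = 0 := by
  have h1 : D.bdFun (D.d ψ) Q = ∑ l ∈ listsOf (D.inc Q) 9, D.o Q l * cob ψ l := by
    refine Finset.sum_congr rfl fun l _ => ?_
    by_cases ho : D.o Q l = 0
    · simp [ho]
    have hF := ((hD.o_supp Q l).1 ho).1
    by_cases hc : D.Cell l
    · rw [d_of_cell hc]
    · rw [d_of_not_cell hc]
      congr 1
      by_contra h0
      obtain ⟨m, hm, -, h⟩ := exists_of_cob_ne_zero (Ne.symm h0)
      exact hc (hD.up m l Q (hψ.onCells m h) (fun x hx => hm.subset hx) hF)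
  rw [h1, sum_alt_mul_cob _ 8 (hD.o_alt Q)]
  rw [Finset.sum_eq_zero, mul_zero]
  intro l hl
  obtain ⟨hl8, hlm⟩ := mem_listsOf.1 hl
  by_cases h : ψ l = 0
  · simp [h]
  · obtain ⟨T, hT⟩ := hψ.onCells l h
    rw [hD.o_sum Q l (hD.top T Q l hT hlm).1 hl8, zero_mul]

lemma length_le (hD : D.Laws) {Q : V} {l : List X} (h : D.Face Q l) : l.length ≤ 9 := by
  classical
  choose t ht htl using h.2.2
  obtain ⟨E, hE, hm⟩ := hD.card Q t ht
  rw [← List.toFinset_card_of_nodup h.1, ← hE]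
  refine Finset.card_le_card fun x hx => ?_
  rw [List.mem_toFinset] at hx
  exact (hm x).2 ⟨h.2.1 x hx, fun i hi => htl i (hi ▸ hx)⟩

lemma eq_zero_or_exists_below {φ : List X → ℂ} (hD : D.Laws)
    (hfin : φ.support.Finite) (hc : D.OnCells φ) :
    φ = 0 ∨ ∃ l T, φ l ≠ 0 ∧ D.Dn T l ∧ D.Below T φ := by
  classical
  by_cases h0 : φ = 0
  · exact Or.inl h0
  right
  have hne : φ.support.Nonempty := Function.support_nonempty_iff.2 h0
  have : ∀ l : List X, ∃ T : V, φ l ≠ 0 → D.Dn T l := by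
    intro l
    by_cases h : φ l = 0
    · obtain ⟨l', hl'⟩ := hne
      obtain ⟨T, -⟩ := hc l' hl'
      exact ⟨T, fun h' => (h' h).elim⟩
    · obtain ⟨T, hT⟩ := hc l h
      exact ⟨T, fun _ => hT⟩
  choose top htop using this
  obtain ⟨l, hl, hmax⟩ := hfin.toFinset.exists_max_image top (by simpa using hne)
  refine ⟨l, top l, by simpa using hl, htop l (by simpa using hl), fun l' T h1 h2 => ?_⟩
  exact (Cell.top_le hD (htop l' h1) h2.1).trans (hmax l' (by simpa using h1))

lemma sum_tight (hD : D.Laws) {Q : V} {φ : List X → ℂ} (hφ : Alt φ)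
    (h : ∀ l, D.Face Q l → φ l ≠ 0 → ∀ i, D.Tight Q i l) {l₀ : List X} (hF : D.Face Q l₀)
    (h9 : l₀.length = 9) (h0 : φ l₀ ≠ 0) : D.bdFun φ Q ≠ 0 := by
  classical
  have key : ∀ l ∈ listsOf (D.inc Q) 9, D.o Q l * φ l =
      if D.o Q l * φ l ≠ 0 then D.o Q l₀ * φ l₀ else 0 := by
    intro l _
    by_cases hl : D.o Q l * φ l = 0
    · simp [hl]
    rw [if_pos hl]
    have hFl := ((hD.o_supp Q l).1 (left_ne_zero_of_mul hl)).1
    apply (hD.o_alt Q).mul_eq_of_perm hφ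
    rw [List.perm_ext_iff_of_nodup hFl.1 hF.1]
    intro x
    rw [mem_iff_of_tight hD hFl (h l hFl (right_ne_zero_of_mul hl)),
      mem_iff_of_tight hD hF (h l₀ hF h0)]
  have ho : D.o Q l₀ * φ l₀ ≠ 0 := mul_ne_zero ((hD.o_supp Q l₀).2 ⟨hF, h9⟩) h0
  rw [bdFun, Finset.sum_congr rfl key, ← Finset.sum_filter, Finset.sum_const, nsmul_eq_mul]
  refine mul_ne_zero ?_ ho
  rw [Nat.cast_ne_zero, Finset.card_ne_zero]
  exact ⟨l₀, Finset.mem_filter.2 ⟨mem_listsOf.2 ⟨h9, hF.2.1⟩, ho⟩⟩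

/-- The frame complex is exact at positive degrees. -/
theorem exact_chains (hD : D.Laws) [WellFoundedLT V] {n : ℕ} {φ : List X → ℂ}
    (hφ : D.IsChain n φ) (hd : ∀ l, l.length + n = 10 → D.d φ l = 0)
    (hb : n = 0 → ∀ Q, D.bdFun φ Q = 0) : ∃ ψ, D.IsChain (n + 1) ψ ∧ D.d ψ = φ := by
  have main : ∀ Q, ∀ φ : List X → ℂ, D.IsChain n φ → (∀ l, l.length + n = 10 → D.d φ l = 0) →
      (n = 0 → ∀ Q, D.bdFun φ Q = 0) → D.Below Q φ → ∃ ψ, D.IsChain (n + 1) ψ ∧ D.d ψ = φ := by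
    intro Q
    induction Q using WellFoundedLT.induction with
    | ind Q ih =>
      intro φ hφ hd hb hQ
      obtain ⟨ψ, cψ, bψ, tψ⟩ := cancel hD hφ hd hQ
      have hφ' : D.IsChain n (φ - D.d ψ) := hφ.sub (cψ.d hD)
      have hd' : ∀ l, l.length + n = 10 → D.d (φ - D.d ψ) l = 0 := fun l hl => by
        rw [map_sub, d_d hD cψ.onCells, sub_zero]; exact hd l hl
      have hb' : n = 0 → ∀ Q, D.bdFun (φ - D.d ψ) Q = 0 := by
        rintro rfl Q
        rw [bdFun_sub, hb rfl, bdFun_d hD cψ, sub_zero]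
      have hlt : ∀ l T, (φ - D.d ψ) l ≠ 0 → D.Dn T l → T < Q := by
        intro l T hl hT
        refine lt_of_le_of_ne (bψ l T hl hT) ?_
        rintro rfl
        have h9 := length_of_tight hD hT.1 (tψ l hT hl)
        have hn := (hφ'.2.2 l hl).2
        have hn0 : n = 0 := by omega
        refine sum_tight hD hφ'.1 (fun l' hF h0 => ?_) hT.1 h9 hl (hb' hn0 T)
        obtain ⟨T', hT'⟩ := hφ'.onCells l' h0
        have := le_antisymm (bψ l' T' h0 hT') (Cell.top_le hD hT' hF)
        exact tψ l' (this ▸ hT') h0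
      rcases eq_zero_or_exists_below hD hφ'.2.1 hφ'.onCells with h0 | ⟨l, T, hl, hT, hbT⟩
      · exact ⟨ψ, cψ, (sub_eq_zero.1 h0).symm⟩
      · obtain ⟨ψ', cψ', hψ'⟩ := ih T (hlt l T hl hT) _ hφ' hd' hb' hbT
        exact ⟨ψ' + ψ, cψ'.add cψ, by rw [map_add, hψ', sub_add_cancel]⟩
  rcases eq_zero_or_exists_below hD hφ.2.1 hφ.onCells with h0 | ⟨l, T, hl, hT, hbT⟩
  · exact ⟨0, D.isChain_zero _, by rw [map_zero, h0]⟩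
  · exact main T φ hφ hd hb hbT

/-! #### Degree zero -/

variable (D) in
/-- The submodule of chains. -/
def chains (n : ℕ) : Submodule ℂ (List X → ℂ) where
  carrier := {φ | D.IsChain n φ}
  add_mem' := IsChain.add
  zero_mem' := D.isChain_zero n
  smul_mem' c _ h := h.smul c

/-- The end points of an edge. -/
noncomputable def ends (hD : D.Laws) (l : List X) : V →₀ ℂ :=
  open Classical in
  if h : D.Cell l then Finsupp.ofSupportFinite (fun Q => D.o Q l)
    ((hD.fin l h).subset fun Q hQ => ((hD.o_supp Q l).1 hQ).1.2.1) else 0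

lemma ends_apply (hD : D.Laws) {l : List X} (h : D.Cell l) (Q : V) :
    ends hD l Q = D.o Q l := by
  rw [ends, dif_pos h]; rfl

lemma ends_sum (hD : D.Laws) {l : List X} (h : D.Cell l) (h9 : l.length = 9) :
    Finsupp.linearCombination ℂ (fun _ : V => (1 : ℂ)) (ends hD l) = 0 := by
  classical
  obtain ⟨Q, hQ⟩ := h
  obtain ⟨Q', hne, hT, ho⟩ := hD.edge Q l hQ.1 h9
  have : ends hD l = Finsupp.single Q (D.o Q l) + Finsupp.single Q' (D.o Q' l) := by
    ext T
    rw [ends_apply hD ⟨Q, hQ⟩, Finsupp.add_apply, Finsupp.single_apply, Finsupp.single_apply]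
    by_cases h1 : Q = T
    · subst h1; simp [hne]
    · by_cases h2 : Q' = T
      · subst h2; simp [h1]
      · simp only [h1, h2, if_false, add_zero]
        by_contra h3
        rcases (hT T).1 ((hD.o_supp T l).1 h3).1 with h | h
        · exact h1 h.symm
        · exact h2 h.symm
  rw [this, map_add]
  simpa using ho

/-- The boundary of `1`-chains. -/
noncomputable def bd (hD : D.Laws) : D.chains 0 →ₗ[ℂ] V →₀ ℂ where
  toFun φ := Finsupp.linearCombination ℂ (ends hD) (Finsupp.ofSupportFinite φ.1 φ.2.2.1)
  map_add' φ ψ := by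
    rw [← map_add]; congr 1; ext; rfl
  map_smul' c φ := by
    rw [← map_smul]; congr 1; ext; rfl

lemma bd_apply (hD : D.Laws) (φ : D.chains 0) (Q : V) : bd hD φ Q = D.bdFun φ.1 Q := by
  classical
  have h1 : bd hD φ Q = ∑ l ∈ φ.2.2.1.toFinset, D.o Q l * φ.1 l := by
    simp only [bd, LinearMap.coe_mk, AddHom.coe_mk, Finsupp.linearCombination_apply,
      Finsupp.sum, Finsupp.finsetSum_apply, Finsupp.smul_apply, smul_eq_mul]
    refine Finset.sum_congr ?_ fun l hl => ?_
    · ext l; simp [Finsupp.ofSupportFinite]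
    · have : φ.1 l ≠ 0 := by simpa [Finsupp.ofSupportFinite] using hl
      rw [ends_apply hD (φ.2.onCells l this), mul_comm]; rfl
  rw [h1, bdFun]
  refine Finset.sum_congr_of_eq_on_inter (fun l _ hl => ?_) (fun l _ hl => ?_) fun _ _ _ => rfl
  · by_contra h
    obtain ⟨hF, h9⟩ := (hD.o_supp Q l).1 (left_ne_zero_of_mul h)
    exact hl (mem_listsOf.2 ⟨h9, hF.2.1⟩)
  · have : φ.1 l = 0 := by simpa using hl
    rw [this, mul_zero]

lemma sum_bd (hD : D.Laws) (φ : D.chains 0) :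
    Finsupp.linearCombination ℂ (fun _ : V => (1 : ℂ)) (bd hD φ) = 0 := by
  change Finsupp.linearCombination ℂ _ (Finsupp.linearCombination ℂ (ends hD) _) = 0
  rw [Finsupp.linearCombination_apply ℂ (v := ends hD), Finsupp.sum, map_sum]
  refine Finset.sum_eq_zero fun l hl => ?_
  have h1 : φ.1 l ≠ 0 := by simpa [Finsupp.ofSupportFinite] using hl
  have h2 := φ.2.2.2 l h1
  rw [map_smul, ends_sum hD h2.1 (by omega), smul_zero]

lemma tight_edge (hD : D.Laws) {Q : V} (h : D.neg Q (D.m Q)) :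
    ∃ l, D.Dn Q l ∧ (∀ i, D.Tight Q i l) ∧ l.length = 9 := by
  classical
  obtain ⟨E, hE, hm⟩ := hD.card Q (D.m Q) (hD.m_mem Q)
  have ht : ∀ i, D.Tight Q i E.toList := by
    intro i a ha hal
    rw [Finset.mem_toList, hm, not_and_or] at hal
    have key : D.F Q i = {a} → a = D.m Q i := fun h => by
      have := hD.m_mem Q i
      rw [h, Finset.mem_singleton] at this
      exact this.symm
    rcases hal with h1 | h1
    · exact key ((hD.mem_inc Q i a ha).resolve_left h1)
    · push Not at h1
      obtain ⟨j, rfl⟩ := h1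
      rcases hD.disj Q i j _ ha (hD.m_mem Q j) with h2 | h2
      · rw [h2]
      · exact key h2
  refine ⟨E.toList, ⟨⟨E.nodup_toList, fun x hx => ((hm x).1 (by simpa using hx)).1, fun i =>
    ⟨_, hD.m_mem Q i, fun h => ((hm _).1 (by simpa using h)).2 i rfl⟩⟩, fun t h1 h2 => ?_⟩, ht,
    by simpa using hE⟩
  have : t = D.m Q := funext fun i => ht i _ (h1 i) (h2 i)
  rwa [this]

open Classical in
lemma exists_edge_chain (hD : D.Laws) {Q : V} (h : D.neg Q (D.m Q)) :
    ∃ ζ : D.chains 0, bd hD ζ Q ≠ 0 ∧ ∀ T, bd hD ζ T ≠ 0 → T ≤ Q := by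
  obtain ⟨l, hl, ht, h9⟩ := tight_edge hD h
  set ζ : List X → ℂ := fun l' => if l'.Perm l then D.o Q l' else 0 with hζ
  have nz : ∀ l', ζ l' ≠ 0 → l'.Perm l := by
    intro l' h'
    by_contra h2
    exact h' (by simp [hζ, h2])
  have hch : D.IsChain 0 ζ := by
    refine ⟨Alt.ite (fun _ _ hp h => hp.symm.trans h) (hD.o_alt Q), ?_, fun l' hl' => ?_⟩
    · refine (l.permutations.toFinset.finite_toSet).subset fun l' hl' => ?_
      simpa using nz l' hl'
    · exact ⟨⟨Q, hl.perm (nz l' hl').symm⟩, by rw [(nz l' hl').length_eq, h9]⟩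
  refine ⟨⟨ζ, hch⟩, ?_, fun T hT => ?_⟩
  · rw [bd_apply]
    refine sum_tight hD hch.1 (fun l' _ h0 i a ha hal => ?_) hl.1 h9 ?_
    · exact ht i a ha fun h => hal ((nz l' h0).mem_iff.2 h)
    · simpa [hζ] using (hD.o_supp Q l).2 ⟨hl.1, h9⟩
  · rw [bd_apply] at hT
    obtain ⟨l', -, h0⟩ := Finset.exists_ne_zero_of_sum_ne_zero hT
    exact Cell.top_le hD (hl.perm (nz l' (right_ne_zero_of_mul h0)).symm)
      ((hD.o_supp T l').1 (left_ne_zero_of_mul h0)).1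

theorem exact_zero (hD : D.Laws) [WellFoundedLT V] (φ : V →₀ ℂ)
    (hφ : Finsupp.linearCombination ℂ (fun _ : V => (1 : ℂ)) φ = 0) :
    ∃ ψ : D.chains 0, bd hD ψ = φ := by
  classical
  have main : ∀ Q : V, ∀ φ : V →₀ ℂ, (∀ T, φ T ≠ 0 → T ≤ Q) →
      Finsupp.linearCombination ℂ (fun _ : V => (1 : ℂ)) φ = 0 →
      ∃ ψ : D.chains 0, bd hD ψ = φ := by
    intro Q
    induction Q using WellFoundedLT.induction with
    | ind Q ih =>
      have aux : ∀ φ : V →₀ ℂ, (∀ T, φ T ≠ 0 → T < Q) →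
          Finsupp.linearCombination ℂ (fun _ : V => (1 : ℂ)) φ = 0 →
          ∃ ψ : D.chains 0, bd hD ψ = φ := by
        intro φ hφ hs
        by_cases h0 : φ = 0
        · exact ⟨0, by rw [h0, map_zero]⟩
        have hne : φ.support.Nonempty := Finsupp.support_nonempty_iff.2 h0
        obtain ⟨T, hT, hmax⟩ := φ.support.exists_max_image id hne
        exact ih T (hφ T (Finsupp.mem_support_iff.1 hT)) φ
          (fun T' hT' => hmax T' (Finsupp.mem_support_iff.2 hT')) hs
      intro φ hφ hs
      by_cases hn : D.neg Q (D.m Q)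
      · obtain ⟨ζ, h1, h2⟩ := exists_edge_chain hD hn
        set c := φ Q / bd hD ζ Q with hc
        obtain ⟨ψ, hψ⟩ := aux (φ - c • bd hD ζ) (fun T hT => by
          refine lt_of_le_of_ne ?_ ?_
          · by_cases h3 : φ T = 0
            · refine h2 T fun h4 => hT ?_
              simp [h3, h4]
            · exact hφ T h3
          · rintro rfl
            apply hT
            simp [hc, h1]) (by rw [map_sub, map_smul, sum_bd, hs]; simp)
        exact ⟨ψ + c • ζ, by rw [map_add, map_smul, hψ, sub_add_cancel]⟩
      · have h1 : φ = Finsupp.single Q (φ Q) := by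
          ext T
          rw [Finsupp.single_apply]
          split_ifs with h
          · rw [h]
          · by_contra h2
            exact h (le_antisymm (hD.bot Q hn T) (hφ T h2))
        rw [h1] at hs
        have h2 : φ Q = 0 := by simpa using hs
        exact ⟨0, by rw [map_zero, h1, h2, Finsupp.single_zero]⟩
  by_cases h0 : φ = 0
  · exact ⟨0, by rw [h0, map_zero]⟩
  obtain ⟨T, hT, hmax⟩ := φ.support.exists_max_image id (Finsupp.support_nonempty_iff.2 h0)
  exact main T φ (fun T' hT' => hmax T' (Finsupp.mem_support_iff.2 hT')) hφ

end FrameData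

/-! ### Group cohomology from an explicit resolution -/

open CategoryTheory

namespace ExplicitResolution

variable {G : Type} [Group G] (R : ℕ → Rep.{0} ℂ G) (d : ∀ n, R (n + 1) ⟶ R n)
  (ε : R 0 ⟶ Rep.trivial ℂ G ℂ)

/-- A complex of representations as a chain complex. -/
noncomputable def complex (dd : ∀ n x, (d n).hom ((d (n + 1)).hom x) = 0) :
    ChainComplex (Rep ℂ G) ℕ :=
  ChainComplex.of R d fun n => by
    ext x
    exact dd n x

variable (dd : ∀ n x, (d n).hom ((d (n + 1)).hom x) = 0)

lemma complex_d (n : ℕ) : (complex R d dd).d (n + 1) n = d n :=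
  ChainComplex.of_d R d n

noncomputable def aug (hε : ∀ x, ε.hom ((d 0).hom x) = 0) :
    complex R d dd ⟶ (ChainComplex.single₀ (Rep ℂ G)).obj (Rep.trivial ℂ G ℂ) :=
  ((complex R d dd).toSingle₀Equiv _).symm
    ⟨ε, by
      rw [complex_d]
      ext x
      exact hε x⟩

lemma aug_f (hε : ∀ x, ε.hom ((d 0).hom x) = 0) : (aug R d ε dd hε).f 0 = ε :=
  ChainComplex.toSingle₀Equiv_symm_apply_f_zero ..

lemma quasiIso_aug (hε : ∀ x, ε.hom ((d 0).hom x) = 0) (hs : ∃ x, ε.hom x = (1 : ℂ))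
    (h0 : ∀ x, ε.hom x = 0 → ∃ y, (d 0).hom y = x)
    (h : ∀ n x, (d n).hom x = 0 → ∃ y, (d (n + 1)).hom y = x) :
    QuasiIso (aug R d ε dd hε) where
  quasiIsoAt m := by
    induction m with
    | zero =>
      rw [ChainComplex.quasiIsoAt₀_iff, ShortComplex.quasiIso_iff_of_zeros' _ rfl rfl rfl]
      constructor
      · apply (forget₂ _ (ModuleCat ℂ)).reflects_exact_of_faithful
        rw [ShortComplex.moduleCat_exact_iff]
        intro x hx
        obtain ⟨y, hy⟩ := h0 x (by
          change ((aug R d ε dd hε).f 0).hom x = 0 at hx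
          rw [aug_f] at hx
          exact hx)
        refine ⟨y, ?_⟩
        change ((complex R d dd).d 1 0).hom y = x
        rw [complex_d]
        exact hy
      · rw [Rep.epi_iff_surjective]
        intro x
        obtain ⟨y, hy⟩ := hs
        refine ⟨(show ℂ from x) • y, ?_⟩
        change ((aug R d ε dd hε).f 0).hom _ = x
        rw [aug_f]
        exact (map_smul ε.hom.toLinearMap _ y).trans (by erw [hy]; exact mul_one _)
    | succ m _ =>
      rw [quasiIsoAt_iff_exactAt' (hL := ChainComplex.exactAt_succ_single_obj ..),
          HomologicalComplex.exactAt_iff' _ (m + 2) (m + 1) m (by simp) (by simp)]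
      apply (forget₂ _ (ModuleCat ℂ)).reflects_exact_of_faithful
      rw [ShortComplex.moduleCat_exact_iff]
      intro x hx
      obtain ⟨y, hy⟩ := h m x (by
        change ((complex R d dd).d (m + 1) m).hom x = 0 at hx
        rw [complex_d] at hx
        exact hx)
      refine ⟨y, ?_⟩
      change ((complex R d dd).d (m + 2) (m + 1)).hom y = x
      rw [complex_d]
      exact hy

/-- The dimension of `H^(n+1)(G, ℂ)` is the number of points separating classes of invariant
cocycles on an explicit projective resolution. -/
theorem finrank_groupCohomology (dd : ∀ n x, (d n).hom ((d (n + 1)).hom x) = 0)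
    (hp : ∀ n, Projective (R n))
    (hε : ∀ x, ε.hom ((d 0).hom x) = 0) (hs : ∃ x, ε.hom x = (1 : ℂ))
    (h0 : ∀ x, ε.hom x = 0 → ∃ y, (d 0).hom y = x)
    (h : ∀ n x, (d n).hom x = 0 → ∃ y, (d (n + 1)).hom y = x)
    (n r : ℕ) (x : Fin r → R (n + 1))
    (hx : ∀ i (f : R n ⟶ Rep.trivial ℂ G ℂ), f.hom ((d n).hom (x i)) = (0 : ℂ))
    (hsurj : ∀ v : Fin r → ℂ, ∃ f : R (n + 1) ⟶ Rep.trivial ℂ G ℂ,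
      (∀ y, f.hom ((d (n + 1)).hom y) = (0 : ℂ)) ∧ ∀ i, f.hom (x i) = v i)
    (hker : ∀ f : R (n + 1) ⟶ Rep.trivial ℂ G ℂ,
      (∀ y, f.hom ((d (n + 1)).hom y) = (0 : ℂ)) → (∀ i, f.hom (x i) = (0 : ℂ)) →
        ∃ k : R n ⟶ Rep.trivial ℂ G ℂ, ∀ y, k.hom ((d n).hom y) = f.hom y) :
    Module.finrank ℂ (groupCohomology (Rep.trivial ℂ G ℂ) (n + 1)) = r := by
  let P : ProjectiveResolution (Rep.trivial ℂ G ℂ) :=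
    { complex := complex R d dd
      projective := hp
      π := aug R d ε dd hε
      quasiIso := quasiIso_aug R d ε dd hε hs h0 h }
  let K := (complex R d dd).linearYonedaObj ℂ (Rep.trivial ℂ G ℂ)
  let S := K.sc' n (n + 1) (n + 2)
  let e : groupCohomology (Rep.trivial ℂ G ℂ) (n + 1) ≅ S.moduleCatLeftHomologyData.H :=
    groupCohomologyIso _ (n + 1) P ≪≫ K.homologyIsoSc' n (n + 1) (n + 2) (by simp) (by simp) ≪≫
      S.moduleCatHomologyIso
  rw [e.toLinearEquiv.finrank_eq]
  let Φ : LinearMap.ker S.g.hom →ₗ[ℂ] (Fin r → ℂ) :=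
    { toFun := fun f i => (show R (n + 1) ⟶ Rep.trivial ℂ G ℂ from f.1).hom (x i)
      map_add' := fun f g => rfl
      map_smul' := fun c f => rfl }
  have hg (f : R (n + 1) ⟶ Rep.trivial ℂ G ℂ) :
      S.g.hom f = d (n + 1) ≫ f := by
    rw [← complex_d R d dd]; rfl
  have hf (f : R n ⟶ Rep.trivial ℂ G ℂ) :
      S.f.hom f = d n ≫ f := by
    rw [← complex_d R d dd]; rfl
  have hΦ : Function.Surjective Φ := by
    intro v
    obtain ⟨f, h1, h2⟩ := hsurj v
    refine ⟨⟨f, ?_⟩, funext h2⟩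
    refine (hg (f)).trans ?_
    refine Rep.hom_ext ?_
    ext y
    exact h1 y
  have hr : LinearMap.range S.moduleCatToCycles = LinearMap.ker Φ := by
    apply le_antisymm
    · rintro _ ⟨k, rfl⟩
      rw [LinearMap.mem_ker]
      funext i
      refine Eq.trans ?_ (hx i (show R n ⟶ Rep.trivial ℂ G ℂ from k))
      exact congrArg (fun f : R (n + 1) ⟶ Rep.trivial ℂ G ℂ => f.hom (x i)) (hf k)
    · intro f hfk
      obtain ⟨k, hk⟩ := hker (show R (n + 1) ⟶ Rep.trivial ℂ G ℂ from f.1) (by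
        intro y
        have := (hg f.1).symm.trans f.2
        exact congrArg (fun f : R (n + 2) ⟶ Rep.trivial ℂ G ℂ => f.hom y) this)
        (fun i => congrFun (LinearMap.mem_ker.1 hfk) i)
      refine ⟨k, ?_⟩
      apply Subtype.ext
      refine (hf (k)).trans ?_
      refine Rep.hom_ext ?_
      ext y
      exact hk y
  have e2 := Submodule.quotEquivOfEq _ _ hr ≪≫ₗ Φ.quotKerEquivOfSurjective hΦ
  refine (LinearEquiv.finrank_eq e2).trans ?_
  simp

end ExplicitResolution

/-! ### Averaging over a group -/

open CategoryTheory

namespace Averaging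

variable {G : Type} [Group G] {T : Type} [MulAction G T]

/-- A weight function with finitely many nonzero translates along each orbit in `S`, summing to
one. -/
def IsWeight (G : Type) [Group G] [MulAction G T] (S : Set T) (w : T → ℂ) : Prop :=
  ∀ t ∈ S, {γ : G | w (γ⁻¹ • t) ≠ 0}.Finite ∧ ∑ᶠ γ : G, w (γ⁻¹ • t) = 1

/-- Normalising a counting function to a weight. -/
noncomputable def weight (G : Type) [Group G] [MulAction G T] (c : T → ℕ) (t : T) : ℂ :=
  (c t : ℂ) / ∑ᶠ γ : G, (c (γ⁻¹ • t) : ℂ)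

lemma isWeight_weight {S : Set T} {c : T → ℕ} (h1 : ∀ t ∈ S, {γ : G | c (γ⁻¹ • t) ≠ 0}.Finite)
    (h2 : ∀ t ∈ S, ∃ γ : G, c (γ⁻¹ • t) ≠ 0) : IsWeight G S (weight G c) := by
  intro t ht
  have key (γ : G) : weight G c (γ⁻¹ • t) = (c (γ⁻¹ • t) : ℂ) / ∑ᶠ γ : G, (c (γ⁻¹ • t) : ℂ) := by
    rw [weight]
    congr 1
    refine finsum_eq_of_bijective (fun δ => γ * δ) (Group.mulLeft_bijective γ) fun δ => ?_
    rw [mul_inv_rev, mul_smul]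
  have hsup : (Function.support fun γ : G => (c (γ⁻¹ • t) : ℂ)).Finite := by
    refine (h1 t ht).subset fun γ hγ => ?_
    simpa using hγ
  have hne : ∑ᶠ γ : G, (c (γ⁻¹ • t) : ℂ) ≠ 0 := by
    obtain ⟨γ, hγ⟩ := h2 t ht
    rw [finsum_eq_sum _ hsup]
    have : ∑ i ∈ hsup.toFinset, c (i⁻¹ • t) ≠ 0 := by
      rw [Ne, Finset.sum_eq_zero_iff]
      intro h
      exact hγ (h γ (by simpa using hγ))
    exact_mod_cast this
  constructor
  · refine (h1 t ht).subset fun γ hγ h0 => hγ ?_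
    rw [key, h0]; simp
  · simp_rw [key, div_eq_mul_inv]
    rw [← finsum_mul]
    exact mul_inv_cancel₀ hne

variable {M : Type} [AddCommGroup M] [Module ℂ M]

/-- A representation realised on finitely supported functions supported in `S`, stable under
multiplication by `w`. -/
structure Model (ρ : Representation ℂ G M) (S : Set T) (w : T → ℂ) where
  ev : M →ₗ[ℂ] T → ℂ
  inj : Function.Injective ev
  ev_ρ : ∀ g x t, ev (ρ g x) t = ev x (g⁻¹ • t)
  fin : ∀ x, (Function.support (ev x)).Finite
  supp : ∀ x t, ev x t ≠ 0 → t ∈ S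
  mul : M →ₗ[ℂ] M
  ev_mul : ∀ x t, ev (mul x) t = w t * ev x t

namespace Model

variable {ρ : Representation ℂ G M} {S : Set T} {w : T → ℂ} (A : Model ρ S w)
  {N : Type} [AddCommGroup N] [Module ℂ N]

include A in
lemma finite_mul (hw : IsWeight G S w) (x : M) : {γ : G | A.mul (ρ γ⁻¹ x) ≠ 0}.Finite := by
  refine (((A.fin x).biUnion (t := fun t => {γ : G | w (γ⁻¹ • t) ≠ 0})
    fun t ht => (hw t (A.supp x t ht)).1)).subset ?_
  intro γ hγ
  obtain ⟨t, ht⟩ : ∃ t, A.ev (A.mul (ρ γ⁻¹ x)) t ≠ 0 := by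
    by_contra! h
    exact hγ (A.inj (by funext t; simpa using h t))
  rw [A.ev_mul, A.ev_ρ, inv_inv] at ht
  simp only [Set.mem_iUnion]
  exact ⟨γ • t, right_ne_zero_of_mul ht, by simpa using left_ne_zero_of_mul ht⟩

lemma finsum_eq (hw : IsWeight G S w) (x : M) : ∑ᶠ γ : G, ρ γ (A.mul (ρ γ⁻¹ x)) = x := by
  have hf : (Function.support fun γ : G => ρ γ (A.mul (ρ γ⁻¹ x))).Finite := by
    refine (A.finite_mul hw x).subset fun γ hγ h => hγ ?_
    simp only [] at h ⊢
    rw [h, map_zero]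
  apply A.inj
  funext t
  have h1 : A.ev (∑ᶠ γ : G, ρ γ (A.mul (ρ γ⁻¹ x))) t =
      ∑ᶠ γ : G, A.ev (ρ γ (A.mul (ρ γ⁻¹ x))) t :=
    ((LinearMap.proj t ∘ₗ A.ev).toAddMonoidHom.map_finsum hf)
  rw [h1]
  have h2 (γ : G) : A.ev (ρ γ (A.mul (ρ γ⁻¹ x))) t = w (γ⁻¹ • t) * A.ev x t := by
    rw [A.ev_ρ, A.ev_mul, A.ev_ρ, inv_inv, smul_inv_smul]
  simp_rw [h2]
  by_cases h0 : A.ev x t = 0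
  · simp [h0]
  · obtain ⟨h3, h4⟩ := hw t (A.supp x t h0)
    rw [← finsum_mul, h4, one_mul]

/-- Averaging a linear map. -/
noncomputable def avg (hw : IsWeight G S w) (σ : Representation ℂ G N) (f : M →ₗ[ℂ] N) :
    ρ.IntertwiningMap σ where
  toFun x := ∑ᶠ γ : G, σ γ (f (A.mul (ρ γ⁻¹ x)))
  map_add' x y := by
    rw [← finsum_add_distrib]
    · simp
    · exact (A.finite_mul hw x).subset fun γ hγ h => hγ (by simp [h])
    · exact (A.finite_mul hw y).subset fun γ hγ h => hγ (by simp [h])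
  map_smul' c x := by
    rw [RingHom.id_apply, smul_finsum']
    · simp
    · exact (A.finite_mul hw x).subset fun γ hγ h => hγ (by simp [h])
  isIntertwining' g := by
    ext x
    have hf : (Function.support fun γ : G => σ γ (f (A.mul (ρ γ⁻¹ x)))).Finite :=
      (A.finite_mul hw x).subset fun γ hγ h => hγ (by simp [h])
    simp only [LinearMap.coe_comp, Function.comp_apply, LinearMap.coe_mk, AddHom.coe_mk]
    refine Eq.trans ?_ ((σ g).toAddMonoidHom.map_finsum hf).symm
    symm
    refine finsum_eq_of_bijective (fun δ => g * δ) (Group.mulLeft_bijective g) fun δ => ?_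
    simp [mul_inv_rev]

lemma avg_apply (hw : IsWeight G S w) (σ : Representation ℂ G N) (f : M →ₗ[ℂ] N) (x : M) :
    A.avg hw σ f x = ∑ᶠ γ : G, σ γ (f (A.mul (ρ γ⁻¹ x))) := rfl

include A in
lemma projective (hw : IsWeight G S w) : Projective (Rep.of ρ) where
  factors {E F} f e he := by
    rw [Rep.epi_iff_surjective] at he
    obtain ⟨s, hs⟩ := e.hom.toLinearMap.exists_rightInverse_of_surjective
      (LinearMap.range_eq_top.2 he)
    refine ⟨Rep.ofHom (A.avg hw E.ρ (s ∘ₗ f.hom.toLinearMap)), ?_⟩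
    refine Rep.hom_ext ?_
    ext x
    have hf : (Function.support fun γ : G =>
        E.ρ γ ((s ∘ₗ f.hom.toLinearMap) (A.mul (ρ γ⁻¹ x)))).Finite :=
      (A.finite_mul hw x).subset fun γ hγ h => hγ (by simp only []; rw [h, map_zero, map_zero])
    have hf' : (Function.support fun γ : G => ρ γ (A.mul (ρ γ⁻¹ x))).Finite :=
      (A.finite_mul hw x).subset fun γ hγ h => hγ (by simp only []; rw [h, map_zero])
    change e.hom (A.avg hw E.ρ (s ∘ₗ f.hom.toLinearMap) x) = f.hom x
    rw [A.avg_apply]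
    refine (e.hom.toLinearMap.toAddMonoidHom.map_finsum hf).trans ?_
    conv_rhs => rw [← A.finsum_eq hw x]
    refine Eq.trans ?_ (f.hom.toLinearMap.toAddMonoidHom.map_finsum hf').symm
    refine finsum_congr fun γ => ?_
    have h1 : e.hom (s (f.hom (A.mul (ρ γ⁻¹ x)))) = f.hom (A.mul (ρ γ⁻¹ x)) :=
      LinearMap.congr_fun hs _
    change e.hom (E.ρ γ (s (f.hom (A.mul (ρ γ⁻¹ x))))) = f.hom (ρ γ (A.mul (ρ γ⁻¹ x)))
    rw [Rep.hom_comm_apply, h1]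
    exact (Rep.hom_comm_apply f γ _).symm

/-- Sum over the group. -/
noncomputable def sum (x : M) (t : T) : ℂ := ∑ᶠ γ : G, A.ev x (γ⁻¹ • t)

include A in
lemma finite_sum (hw : IsWeight G S w) (x : M) {t : T} (ht : t ∈ S) :
    {γ : G | A.ev x (γ⁻¹ • t) ≠ 0}.Finite := by
  have hfib (u : T) (hu : u ∈ S) : {γ : G | γ⁻¹ • t = u}.Finite := by
    obtain ⟨δ, hδ⟩ : ∃ δ : G, w (δ⁻¹ • u) ≠ 0 := by
      by_contra! h
      have := (hw u hu).2
      simp [h] at this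
    refine (((hw t ht).1).preimage (mul_left_injective δ).injOn).subset fun γ hγ => ?_
    simp only [Set.mem_preimage, Set.mem_setOf_eq, mul_inv_rev, mul_smul]
    rw [show γ⁻¹ • t = u from hγ]
    exact hδ
  refine ((A.fin x).biUnion (t := fun u => {γ : G | γ⁻¹ • t = u})
    fun u hu => hfib u (A.supp x u hu)).subset fun γ hγ => ?_
  simp only [Set.mem_iUnion]
  exact ⟨γ⁻¹ • t, hγ, rfl⟩

lemma smul_sum (x : M) (g : G) (t : T) : A.sum x (g • t) = A.sum x t := by
  symm
  refine finsum_eq_of_bijective (fun γ => g * γ) (Group.mulLeft_bijective g) fun γ => ?_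
  rw [mul_inv_rev, mul_smul, inv_smul_smul]

/-- An invariant functional only depends on the sum over the group. -/
lemma apply_eq (hw : IsWeight G S w) (f : ρ.IntertwiningMap (Representation.trivial ℂ G ℂ))
    (x y : M) (h : ∀ t, A.ev y t = w t * A.sum x t) : f x = f y := by
  have hf : (Function.support fun γ : G => ρ γ (A.mul (ρ γ⁻¹ x))).Finite :=
    (A.finite_mul hw x).subset fun γ hγ h => hγ (by simp only []; rw [h, map_zero])
  have hf' : (Function.support fun γ : G => A.mul (ρ γ⁻¹ x)).Finite := A.finite_mul hw x
  have hy : y = ∑ᶠ γ : G, A.mul (ρ γ⁻¹ x) := by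
    apply A.inj
    funext t
    have h1 : A.ev (∑ᶠ γ : G, A.mul (ρ γ⁻¹ x)) t = ∑ᶠ γ : G, A.ev (A.mul (ρ γ⁻¹ x)) t :=
      ((LinearMap.proj t ∘ₗ A.ev).toAddMonoidHom.map_finsum hf')
    rw [h1, h t]
    simp_rw [A.ev_mul]
    rw [← mul_finsum]
    congr 1
    refine finsum_eq_of_bijective (fun γ => γ⁻¹) inv_involutive.bijective fun γ => ?_
    rw [A.ev_ρ, inv_inv]
  conv_lhs => rw [← A.finsum_eq hw x]
  rw [hy]
  refine (f.toLinearMap.toAddMonoidHom.map_finsum hf).trans ?_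
  refine Eq.trans ?_ (f.toLinearMap.toAddMonoidHom.map_finsum hf').symm
  refine finsum_congr fun γ => ?_
  exact LinearMap.congr_fun (f.isIntertwining' γ) (A.mul (ρ γ⁻¹ x))

end Model

end Averaging

/-! ### The frame complex as a projective resolution -/

open CategoryTheory ListCochain Averaging

namespace FrameData

variable {X V : Type} {G : Type} [Group G] [MulAction G X] [MulAction G V]

/-- The entrywise action on lists. -/
@[reducible] def listAction (G X : Type) [Group G] [MulAction G X] : MulAction G (List X) where
  smul g l := l.map (g • ·)
  one_smul l := by change l.map _ = l; simp
  mul_smul g h l := by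
    change l.map _ = (l.map _).map _
    simp [mul_smul]

attribute [local instance] listAction

omit [Group G] [MulAction G X] in
lemma smul_list [Group G] [MulAction G X] (g : G) (l : List X) : g • l = l.map (g • ·) := rfl

lemma length_smul (g : G) (l : List X) : (g • l).length = l.length := by simp [smul_list]

lemma mem_smul {g : G} {l : List X} {x : X} : x ∈ g • l ↔ g⁻¹ • x ∈ l := by
  simp only [smul_list, List.mem_map]
  constructor
  · rintro ⟨y, hy, rfl⟩; simpa
  · intro h; exact ⟨_, h, by simp⟩

lemma perm_smul {g : G} {l l' : List X} (h : l.Perm l') : (g • l).Perm (g • l') := h.map _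

/-- A group acting on frame data, with finitely many orbits of vertices and finite stabilizers. -/
structure Symmetry (D : FrameData X V) (G : Type) [Group G] [MulAction G X] [MulAction G V]
    (U : Finset V) : Prop where
  cell : ∀ (g : G) l, D.Cell l → D.Cell (g • l)
  inc : ∀ (g : G) Q x, x ∈ D.inc Q → g • x ∈ D.inc (g • Q)
  o : ∀ (g : G) Q l, D.o (g • Q) (g • l) = D.o Q l
  fin : ∀ Q Q' : V, {g : G | g • Q = Q'}.Finite
  cov : ∀ Q : V, ∃ g : G, g • Q ∈ U

variable {D : FrameData X V} {U : Finset V}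

namespace Symmetry

variable (hG : D.Symmetry G U)
include hG

lemma cell_iff (g : G) {l : List X} : D.Cell (g • l) ↔ D.Cell l :=
  ⟨fun h => by simpa using hG.cell g⁻¹ _ h, hG.cell g l⟩

lemma inc_iff (g : G) {Q : V} {x : X} : x ∈ D.inc (g • Q) ↔ g⁻¹ • x ∈ D.inc Q :=
  ⟨fun h => by simpa using hG.inc g⁻¹ _ _ h, fun h => by simpa using hG.inc g _ _ h⟩

omit hG in
lemma cob_smul_list (g : G) (φ : List X → ℂ) (l : List X) :
    cob φ (g • l) = cob (fun m => φ (g • m)) l := cob_map _ _ _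

lemma d_smul_list (g : G) (φ : List X → ℂ) (l : List X) :
    D.d φ (g • l) = D.d (fun m => φ (g • m)) l := by
  by_cases h : D.Cell l
  · rw [d_of_cell h, d_of_cell ((hG.cell_iff g).2 h), cob_smul_list]
  · rw [d_of_not_cell h, d_of_not_cell (fun h' => h ((hG.cell_iff g).1 h'))]

lemma isChain_smul (g : G) {n : ℕ} {φ : List X → ℂ} (h : D.IsChain n φ) :
    D.IsChain n (fun l => φ (g • l)) := by
  refine ⟨h.1.map _, ?_, fun l hl => ?_⟩
  · exact h.2.1.preimage (MulAction.injective g).injOn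
  · have := h.2.2 _ hl
    rwa [length_smul, hG.cell_iff] at this

/-- The representation on chains. -/
def chainRep (n : ℕ) : Representation ℂ G (D.chains n) where
  toFun g :=
    { toFun := fun φ => ⟨fun l => φ.1 (g⁻¹ • l), hG.isChain_smul g⁻¹ φ.2⟩
      map_add' := fun _ _ => rfl
      map_smul' := fun _ _ => rfl }
  map_one' := by
    ext φ l
    simp
  map_mul' g h := by
    ext φ l
    simp [mul_smul]

omit hG in
/-- The representation on functions on vertices. -/
noncomputable def vertexRep (G V : Type) [Group G] [MulAction G V] :
    Representation ℂ G (V →₀ ℂ) where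
  toFun g := Finsupp.lmapDomain ℂ ℂ (g • ·)
  map_one' := by ext; simp
  map_mul' g h := by ext; simp [mul_smul]

omit hG in
lemma vertexRep_apply (g : G) (φ : V →₀ ℂ) (Q : V) : vertexRep G V g φ Q = φ (g⁻¹ • Q) := by
  conv_lhs => rw [← smul_inv_smul g Q]
  exact Finsupp.mapDomain_apply (MulAction.injective g) φ _

variable [LinearOrder V] (hD : D.Laws)

/-- The terms of the resolution. -/
noncomputable def term : ℕ → Rep.{0} ℂ G
  | 0 => Rep.of (vertexRep G V)
  | n + 1 => Rep.of (hG.chainRep n)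

/-- The differential between chains. -/
noncomputable def dMap (n : ℕ) : (hG.chainRep (n + 1)).IntertwiningMap (hG.chainRep n) where
  toFun φ := ⟨D.d φ.1, φ.2.d hD⟩
  map_add' _ _ := Subtype.ext (map_add _ _ _)
  map_smul' _ _ := Subtype.ext (map_smul _ _ _)
  isIntertwining' g := by
    ext φ l
    exact (hG.d_smul_list g⁻¹ φ.1 l).symm

lemma bdFun_smul (g : G) (φ : List X → ℂ) (Q : V) :
    D.bdFun (fun l => φ (g • l)) Q = D.bdFun φ (g • Q) := by
  refine Finset.sum_bij (fun l _ => g • l) (fun l hl => ?_)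
    (fun l _ l' _ h => MulAction.injective g h) (fun l hl => ⟨g⁻¹ • l, ?_, by simp⟩)
    fun l _ => by rw [hG.o]
  · rw [mem_listsOf] at hl ⊢
    refine ⟨by rw [length_smul, hl.1], fun x hx => ?_⟩
    rw [hG.inc_iff]
    exact hl.2 _ (mem_smul.1 hx)
  · rw [mem_listsOf] at hl ⊢
    refine ⟨by rw [length_smul, hl.1], fun x hx => ?_⟩
    have := hl.2 _ (mem_smul.1 hx)
    rw [hG.inc_iff] at this
    simpa using this

/-- The last differential. -/
noncomputable def bdMap : (hG.chainRep 0).IntertwiningMap (vertexRep G V) where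
  __ := bd hD
  isIntertwining' g := by
    ext φ : 1
    ext Q
    change bd hD _ Q = vertexRep G V g (bd hD φ) Q
    rw [vertexRep_apply, bd_apply, bd_apply]
    exact hG.bdFun_smul g⁻¹ φ.1 Q

noncomputable def diff : ∀ n, hG.term (n + 1) ⟶ hG.term n
  | 0 => Rep.ofHom (hG.bdMap hD)
  | n + 1 => Rep.ofHom (hG.dMap hD n)

omit hG in
/-- The augmentation. -/
noncomputable def augMap (G V : Type) [Group G] [MulAction G V] :
    (vertexRep G V).IntertwiningMap (Representation.trivial ℂ G ℂ) where
  __ := Finsupp.linearCombination ℂ (fun _ : V => (1 : ℂ))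
  isIntertwining' g := by
    ext Q
    simp [vertexRep]

/-! #### Weights -/

omit [LinearOrder V] in
open Classical in
/-- The number of base vertices containing a list. -/
noncomputable def count (D : FrameData X V) (U : Finset V) (l : List X) : ℕ :=
  if D.Cell l then (U.filter fun Q => ∀ x ∈ l, x ∈ D.inc Q).card else 0

omit [LinearOrder V] [MulAction G X] [MulAction G V] [Group G] hG in
lemma count_ne_zero {l : List X} :
    count D U l ≠ 0 ↔ D.Cell l ∧ ∃ Q ∈ U, ∀ x ∈ l, x ∈ D.inc Q := by
  by_cases h : D.Cell l
  · simp [count, h, Finset.filter_eq_empty_iff]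
  · simp [count, h]

omit [LinearOrder V] [MulAction G X] [MulAction G V] [Group G] hG in
lemma count_perm {l l' : List X} (h : l.Perm l') : count D U l = count D U l' := by
  have h1 : D.Cell l ↔ D.Cell l' := ⟨fun h2 => h2.perm h, fun h2 => h2.perm h.symm⟩
  by_cases h2 : D.Cell l
  · simp only [count, if_pos h2, if_pos (h1.1 h2)]
    congr 1
    ext Q
    simp [h.mem_iff]
  · simp only [count, if_neg h2, if_neg (fun h3 => h2 (h1.2 h3))]

lemma isWeight_list (hD : D.Laws) : IsWeight G {l | D.Cell l} (weight G (count D U)) := by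
  apply isWeight_weight
  · intro l hl
    refine (((hD.fin l hl).biUnion (t := fun Q => ⋃ Q' ∈ (U : Set V), {γ : G | γ • Q' = Q})
      fun Q _ => U.finite_toSet.biUnion fun Q' _ => hG.fin Q' Q)).subset fun γ hγ => ?_
    obtain ⟨_, Q, hQ, h⟩ := count_ne_zero.1 hγ
    simp only [Set.mem_iUnion]
    refine ⟨γ • Q, fun x hx => ?_, Q, hQ, rfl⟩
    rw [hG.inc_iff]
    exact h _ (mem_smul.2 (by simpa using hx))
  · rintro l ⟨Q, hQ⟩
    obtain ⟨g, hg⟩ := hG.cov Q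
    refine ⟨g⁻¹, count_ne_zero.2 ⟨(hG.cell_iff _).2 ⟨Q, hQ⟩, g • Q, hg, fun x hx => ?_⟩⟩
    rw [hG.inc_iff]
    rw [inv_inv, mem_smul] at hx
    exact hQ.1.2.1 _ hx

lemma isWeight_vertex : IsWeight G (Set.univ : Set V)
    (weight G fun Q => if Q ∈ U then 1 else 0) := by
  classical
  apply isWeight_weight
  · intro Q _
    refine (U.finite_toSet.biUnion (t := fun Q' => {γ : G | γ • Q' = Q})
      fun Q' _ => hG.fin Q' Q).subset fun γ hγ => ?_
    simp only [Set.mem_iUnion]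
    exact ⟨γ⁻¹ • Q, by simpa using hγ, by simp⟩
  · intro Q _
    obtain ⟨g, hg⟩ := hG.cov Q
    exact ⟨g⁻¹, by simpa using hg⟩

omit [LinearOrder V] hG in
lemma weight_perm {l l' : List X} (h : l.Perm l') :
    weight G (count D U) l = weight G (count D U) l' := by
  rw [weight, weight, count_perm h]
  simp_rw [count_perm (perm_smul h)]

omit [LinearOrder V] hG in
lemma isChain_weight_mul {n : ℕ} {z : List X → ℂ} (hz : Alt z)
    (hz' : ∀ l, z l ≠ 0 → D.Cell l ∧ l.length + n = 9) :
    D.IsChain n fun l => weight G (count D U) l * z l := by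
  classical
  refine ⟨hz.symm_mul fun _ _ => weight_perm, ?_, fun l hl => hz' l (right_ne_zero_of_mul hl)⟩
  refine (U.biUnion fun Q => listsOf (D.inc Q) (9 - n)).finite_toSet.subset fun l hl => ?_
  have h1 : count D U l ≠ 0 := by
    intro h
    exact left_ne_zero_of_mul hl (by simp [weight, h])
  obtain ⟨_, Q, hQ, h⟩ := count_ne_zero.1 h1
  rw [Finset.mem_coe, Finset.mem_biUnion]
  have := (hz' l (right_ne_zero_of_mul hl)).2
  exact ⟨Q, hQ, mem_listsOf.2 ⟨by omega, h⟩⟩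

omit [LinearOrder V] in
/-- Chains as a model. -/
noncomputable def chainModel (n : ℕ) :
    Model (hG.chainRep n) {l | D.Cell l} (weight G (count D U)) where
  ev := (D.chains n).subtype
  inj := Subtype.val_injective
  ev_ρ _ _ _ := rfl
  fin φ := φ.2.2.1
  supp φ l hl := (φ.2.2.2 l hl).1
  mul :=
    { toFun := fun φ => ⟨_, isChain_weight_mul (U := U) (G := G) φ.2.1 φ.2.2.2⟩
      map_add' := fun φ ψ => Subtype.ext (funext fun l => mul_add _ _ _)
      map_smul' := fun c φ => Subtype.ext (funext fun l => mul_left_comm _ _ _) }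
  ev_mul _ _ := rfl

omit [LinearOrder V] hG in
/-- Vertices as a model. -/
noncomputable def vertexModel (w : V → ℂ) : Model (vertexRep G V) (Set.univ : Set V) w where
  ev := Finsupp.lcoeFun
  inj := DFunLike.coe_injective
  ev_ρ := vertexRep_apply
  fin φ := φ.finite_support
  supp _ _ _ := trivial
  mul :=
    { toFun := fun φ => Finsupp.ofSupportFinite (fun Q => w Q * φ Q)
        (φ.finite_support.subset fun Q hQ => by
          simpa using right_ne_zero_of_mul hQ)
      map_add' := fun φ ψ => by ext Q; exact mul_add _ _ _
      map_smul' := fun c φ => by ext Q; exact mul_left_comm _ _ _ }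
  ev_mul _ _ := rfl

lemma projective_term (hD : D.Laws) : ∀ n, Projective (hG.term n)
  | 0 => (vertexModel _).projective (isWeight_vertex hG)
  | n + 1 => (hG.chainModel n).projective (hG.isWeight_list hD)

/-! #### Cohomology -/

omit [LinearOrder V] hG in
variable (G D) in
/-- Invariant alternating functions on cells of length `n`. -/
def inv (n : ℕ) : Submodule ℂ (List X → ℂ) where
  carrier := {z | Alt z ∧ (∀ l, z l ≠ 0 → D.Cell l ∧ l.length = n) ∧ ∀ (g : G) l, z (g • l) = z l}
  add_mem' := by
    rintro a b ⟨h1, h2, h3⟩ ⟨h1', h2', h3'⟩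
    refine ⟨h1.add h1', fun l hl => ?_, fun g l => by simp [h3, h3']⟩
    by_cases h : a l = 0
    · exact h2' l (by simpa [h] using hl)
    · exact h2 l h
  zero_mem' := ⟨fun p a b s => by simp, by simp, by simp⟩
  smul_mem' c a h := by
    obtain ⟨h1, h2, h3⟩ := h
    exact ⟨h1.const_mul c, fun l hl => h2 l (right_ne_zero_of_mul hl), fun g l => by simp [h3]⟩

omit [LinearOrder V] in
/-- Multiplying an invariant function by the weight. -/
noncomputable def toChain (n m : ℕ) (hm : m + n = 9) : inv G D m →ₗ[ℂ] D.chains n where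
  toFun z := ⟨fun l => weight G (count D U) l * z.1 l, isChain_weight_mul z.2.1 fun l hl => by
    obtain ⟨h1, h2⟩ := z.2.2.1 l hl
    exact ⟨h1, by omega⟩⟩
  map_add' _ _ := Subtype.ext (funext fun _ => mul_add _ _ _)
  map_smul' _ _ := Subtype.ext (funext fun _ => mul_left_comm _ _ _)

lemma sum_eq_zero (n : ℕ) (φ : D.chains n) (l : List X) (hl : ¬ D.Cell l) :
    (hG.chainModel n).sum φ l = 0 := by
  refine finsum_eq_zero_of_forall_eq_zero fun γ => ?_
  by_contra h
  exact hl ((hG.cell_iff _).1 (φ.2.2.2 _ h).1)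

lemma finite_sum_chain (hD : D.Laws) (n : ℕ) (φ : D.chains n) (l : List X) :
    (Function.support fun γ : G => φ.1 (γ⁻¹ • l)).Finite := by
  by_cases h : D.Cell l
  · exact (hG.chainModel n).finite_sum (hG.isWeight_list hD) φ h
  · refine Set.finite_empty.subset fun γ hγ => h ?_
    exact (hG.cell_iff _).1 (φ.2.2.2 _ hγ).1

/-- Summing a chain over the group. -/
noncomputable def toInv (hD : D.Laws) (n m : ℕ) (hm : m + n = 9) :
    D.chains n →ₗ[ℂ] inv G D m where
  toFun φ := ⟨(hG.chainModel n).sum φ, by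
    refine ⟨fun p a b s => ?_, fun l hl => ?_, fun g l => Model.smul_sum _ φ g l⟩
    · rw [Model.sum, Model.sum, ← finsum_neg_distrib]
      refine finsum_congr fun γ => ?_
      have := (φ.2.1.map (fun x => γ⁻¹ • x)) p a b s
      exact this
    · obtain ⟨γ, hγ⟩ : ∃ γ : G, φ.1 (γ⁻¹ • l) ≠ 0 := by
        by_contra! h
        exact hl (finsum_eq_zero_of_forall_eq_zero h)
      have := φ.2.2.2 _ hγ
      rw [hG.cell_iff, length_smul] at this
      exact ⟨this.1, by omega⟩⟩
  map_add' φ ψ := by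
    ext l
    exact finsum_add_distrib (hG.finite_sum_chain hD n φ l) (hG.finite_sum_chain hD n ψ l)
  map_smul' c φ := by
    ext l
    exact (smul_finsum' c (hG.finite_sum_chain hD n φ l)).symm

omit [LinearOrder V] hG in
lemma cob_finsum {ι : Type} (φ : ι → List X → ℂ)
    (h : ∀ l, (Function.support fun i => φ i l).Finite) (l : List X) :
    (Function.support fun i => cob (φ i) l).Finite ∧
      cob (fun m => ∑ᶠ i, φ i m) l = ∑ᶠ i, cob (φ i) l := by
  induction l generalizing φ with
  | nil => simp
  | cons a l ih =>
    obtain ⟨h1, h2⟩ := ih (fun i m => φ i (a :: m)) fun m => h (a :: m)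
    simp only [cob_cons]
    refine ⟨((h l).union h1).subset (Function.support_sub _ _), ?_⟩
    rw [h2, finsum_sub_distrib (h l) h1]

lemma toInv_d (hD : D.Laws) (n m : ℕ) (hm : m + 1 + n = 9) (φ : D.chains (n + 1)) :
    (hG.toInv hD n (m + 1) hm (hG.dMap hD n φ)).1 =
      D.d (hG.toInv hD (n + 1) m (by omega) φ).1 := by
  funext l
  by_cases h : D.Cell l
  · rw [d_of_cell h]
    refine Eq.trans ?_ (cob_finsum (fun (γ : G) l => φ.1 (γ⁻¹ • l))
      (hG.finite_sum_chain hD _ φ) l).2.symm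
    refine finsum_congr fun γ => ?_
    refine (hG.d_smul_list γ⁻¹ φ.1 l).trans ?_
    rw [d_of_cell h]
  · rw [d_of_not_cell h]
    exact hG.sum_eq_zero _ _ _ h

lemma toInv_ρ (hD : D.Laws) (n m : ℕ) (hm : m + n = 9) (g : G) (φ : D.chains n) :
    hG.toInv hD n m hm (hG.chainRep n g φ) = hG.toInv hD n m hm φ := by
  ext l
  refine finsum_eq_of_bijective (fun γ => γ * g) (Group.mulRight_bijective g) fun γ => ?_
  change φ.1 (g⁻¹ • γ⁻¹ • l) = φ.1 ((γ * g)⁻¹ • l)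
  rw [mul_inv_rev, mul_smul]

lemma toInv_toChain (hD : D.Laws) (n m : ℕ) (hm : m + n = 9) (z : inv G D m) :
    hG.toInv hD n m hm (toChain (U := U) n m hm z) = z := by
  ext l
  change ∑ᶠ γ : G, weight G (count D U) (γ⁻¹ • l) * z.1 (γ⁻¹ • l) = z.1 l
  simp_rw [z.2.2.2]
  by_cases h : z.1 l = 0
  · simp [h]
  · rw [← finsum_mul, (hG.isWeight_list hD l (z.2.2.1 l h).1).2, one_mul]

lemma apply_eq_toInv (hD : D.Laws) (n m : ℕ) (hm : m + n = 9)
    (f : (hG.chainRep n).IntertwiningMap (Representation.trivial ℂ G ℂ)) (φ : D.chains n) :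
    f φ = f (toChain (U := U) n m hm (hG.toInv hD n m hm φ)) :=
  (hG.chainModel n).apply_eq (hG.isWeight_list hD) f φ _ fun _ => rfl

/-- Group cohomology in degree `9 - m` computed from invariant alternating functions. -/
theorem finrank_groupCohomology [WellFoundedLT V] [Nonempty V] (hD : D.Laws) (n m r : ℕ)
    (hm : m + 2 + n = 9)
    (L : inv G D (m + 1) →ₗ[ℂ] (Fin r → ℂ)) (z : Fin r → inv G D (m + 1))
    (hz : ∀ i, D.d (z i).1 = 0) (hLz : ∀ i, L (z i) = Pi.single i 1)
    (hL : ∀ y ∈ inv G D m, ∀ x : inv G D (m + 1), x.1 = D.d y → L x = 0)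
    (hker : ∀ x : inv G D (m + 1), D.d x.1 = 0 → L x = 0 → ∃ y ∈ inv G D m, D.d y = x.1) :
    Module.finrank ℂ (groupCohomology (Rep.trivial ℂ G ℂ) (n + 2)) = r := by
  have key (f : (hG.chainRep (n + 1)).IntertwiningMap (Representation.trivial ℂ G ℂ))
      (hf : ∀ y : D.chains (n + 2), f (hG.dMap hD (n + 1) y) = 0) (y : inv G D m)
      (x : inv G D (m + 1)) (hx : x.1 = D.d y.1) :
      f (toChain (U := U) (n + 1) (m + 1) (by omega) x) = 0 := by
    have h1 := hG.toInv_d hD (n + 1) m (by omega) (toChain (U := U) (n + 2) m (by omega) y)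
    rw [hG.toInv_toChain hD, ← hx] at h1
    rw [← Subtype.ext h1, ← hG.apply_eq_toInv hD]
    exact hf _
  refine ExplicitResolution.finrank_groupCohomology hG.term (hG.diff hD)
    (Rep.ofHom (augMap G V)) ?_ (hG.projective_term hD) ?_ ?_ ?_ ?_ (n + 1) r
    (fun i => toChain (U := U) (n + 1) (m + 1) (by omega) (z i)) ?_ ?_ ?_
  · rintro (_ | k) (x : D.chains _)
    · change bd hD (hG.dMap hD 0 x) = 0
      ext Q
      rw [bd_apply]
      exact bdFun_d hD x.2 Q
    · exact Subtype.ext (d_d hD x.2.onCells)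
  · exact fun x => sum_bd hD x
  · obtain ⟨Q⟩ := ‹Nonempty V›
    exact ⟨Finsupp.single Q 1, by
      change Finsupp.linearCombination ℂ (fun _ : V => (1 : ℂ)) (Finsupp.single Q 1) = 1
      simp⟩
  · exact fun x hx => exact_zero hD x hx
  · rintro (_ | k) (x : D.chains _) hx
    · obtain ⟨ψ, h1, h2⟩ := exact_chains hD x.2 (fun l hl => d_of_not_cell (fun ⟨Q, h⟩ => by
        have h1 := length_le hD h.1
        change l.length + 0 = 10 at hl
        omega) _) fun _ Q => by
          rw [← bd_apply hD x]
          exact DFunLike.congr_fun (show bd hD x = 0 from hx) Q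
      exact ⟨⟨ψ, h1⟩, Subtype.ext h2⟩
    · obtain ⟨ψ, h1, h2⟩ := exact_chains hD x.2
        (fun l _ => congrFun (congrArg Subtype.val hx) l) (by omega)
      exact ⟨⟨ψ, h1⟩, Subtype.ext h2⟩
  · intro i f
    change f.hom (hG.dMap hD n (toChain (U := U) (n + 1) (m + 1) (by omega) (z i))) = (0 : ℂ)
    have h1 := hG.toInv_d hD n (m + 1) (by omega)
      (toChain (U := U) (n + 1) (m + 1) (by omega) (z i))
    rw [hG.toInv_toChain hD, hz] at h1
    refine (hG.apply_eq_toInv hD n (m + 2) (by omega) f.hom _).trans ?_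
    have h2 : hG.toInv hD n (m + 2) (by omega) (hG.dMap hD n
        (toChain (U := U) (n + 1) (m + 1) (by omega) (z i))) = (0 : inv G D (m + 2)) :=
      Subtype.ext h1
    rw [h2, map_zero]
    exact map_zero f.hom
  · intro v
    let l : D.chains (n + 1) →ₗ[ℂ] ℂ := Fintype.linearCombination ℂ v ∘ₗ L ∘ₗ
      hG.toInv hD (n + 1) (m + 1) (by omega)
    refine ⟨Rep.ofHom ⟨l, fun g => ?_⟩, fun y => ?_, fun i => ?_⟩
    · ext φ
      change l (hG.chainRep (n + 1) g φ) = l φ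
      simp only [l, LinearMap.comp_apply, hG.toInv_ρ hD]
    · change l (hG.dMap hD (n + 1) y) = 0
      simp only [l, LinearMap.comp_apply]
      rw [hL _ (hG.toInv hD (n + 2) m (by omega) y).2 _ (hG.toInv_d hD (n + 1) m (by omega) y),
        map_zero]
    · change l (toChain (U := U) (n + 1) (m + 1) (by omega) (z i)) = v i
      simp only [l, LinearMap.comp_apply, hG.toInv_toChain hD, hLz]
      simp [Fintype.linearCombination_apply, Pi.single_apply]
  · intro f hf hfx
    let F : inv G D (m + 1) →ₗ[ℂ] ℂ :=
      f.hom.toLinearMap ∘ₗ toChain (U := U) (n + 1) (m + 1) (by omega)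
    let δ : inv G D (m + 1) →ₗ[ℂ] (List X → ℂ) := D.d ∘ₗ (inv G D (m + 1)).subtype
    have hF : F ∈ LinearMap.range δ.dualMap := by
      rw [LinearMap.range_dualMap_eq_dualAnnihilator_ker, Submodule.mem_dualAnnihilator]
      intro x hx
      obtain ⟨y, hy, hyx⟩ := hker (x - ∑ i, L x i • z i) (by
        have h1 : D.d x.1 = 0 := hx
        have h2 : δ (x - ∑ i, L x i • z i) = 0 := by
          rw [map_sub, map_sum]
          have this : ∀ i, δ (L x i • z i) = 0 := by
            intro i
            rw [map_smul]; change L x i • D.d (z i).1 = 0; rw [hz, smul_zero]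
          simp only [this, Finset.sum_const_zero, sub_zero]
          exact h1
        exact h2) (by
        rw [map_sub, map_sum]
        simp only [map_smul, hLz]
        ext j
        simp [Finset.sum_apply, Pi.single_apply])
      have h3 : F (x - ∑ i, L x i • z i) = 0 := key f.hom hf ⟨y, hy⟩ _ hyx.symm
      rw [map_sub, map_sum] at h3
      have this : ∀ i, F (L x i • z i) = 0 := by
        intro i
        rw [map_smul]
        exact (congrArg (L x i • ·) (hfx i)).trans (smul_zero _)
      simpa only [this, Finset.sum_const_zero, sub_zero] using h3
    obtain ⟨H, hH⟩ := hF
    let l : D.chains n →ₗ[ℂ] ℂ := H ∘ₗ (inv G D (m + 2)).subtype ∘ₗ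
      hG.toInv hD n (m + 2) (by omega)
    refine ⟨Rep.ofHom ⟨l, fun g => ?_⟩, fun φ => ?_⟩
    · ext φ
      change l (hG.chainRep n g φ) = l φ
      simp only [l, LinearMap.comp_apply, hG.toInv_ρ hD]
    · change l (hG.dMap hD n φ) = _
      refine Eq.trans ?_ (hG.apply_eq_toInv hD (n + 1) (m + 1) (by omega) f.hom φ).symm
      refine Eq.trans ?_ (LinearMap.congr_fun hH (hG.toInv hD (n + 1) (m + 1) (by omega) φ))
      simp only [l, LinearMap.comp_apply]
      exact congrArg H (hG.toInv_d hD n (m + 1) (by omega) φ)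

end Symmetry

end FrameData

/-! ### Symmetric matrices and their orientation -/

namespace SymForm

open Matrix

/-- The index pairs of a symmetric `4 × 4` matrix. -/
def ix : Fin 10 → Fin 4 × Fin 4 :=
  ![(0, 0), (0, 1), (0, 2), (0, 3), (1, 1), (1, 2), (1, 3), (2, 2), (2, 3), (3, 3)]

section Ring

variable {R : Type*} [CommRing R]

/-- Coordinates of a symmetric matrix. -/
def co (x : Matrix (Fin 4) (Fin 4) R) (p : Fin 10) : R := x (ix p).1 (ix p).2

/-- The symmetric matrix with given coordinates. -/
def ofCo (v : Fin 10 → R) : Matrix (Fin 4) (Fin 4) R :=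
  !![v 0, v 1, v 2, v 3; v 1, v 4, v 5, v 6; v 2, v 5, v 7, v 8; v 3, v 6, v 8, v 9]

lemma co_ofCo (v : Fin 10 → R) : co (ofCo v) = v := by
  funext p; fin_cases p <;> rfl

lemma ofCo_isSymm (v : Fin 10 → R) : (ofCo v).IsSymm := by
  ext i j; fin_cases i <;> fin_cases j <;> rfl

lemma ofCo_co {x : Matrix (Fin 4) (Fin 4) R} (hx : x.IsSymm) : ofCo (co x) = x := by
  ext i j
  fin_cases i <;> fin_cases j <;> first | rfl | exact hx.apply _ _

lemma ofCo_eq_sum (v : Fin 10 → R) : ofCo v = ∑ p, v p • ofCo (Pi.single p (1 : R)) := by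
  ext i j
  simp only [Matrix.sum_apply, Matrix.smul_apply, smul_eq_mul, Fin.sum_univ_succ]
  fin_cases i <;> fin_cases j <;> simp [ofCo, Pi.single_apply]

lemma co_add (x y : Matrix (Fin 4) (Fin 4) R) : co (x + y) = co x + co y := rfl

lemma co_smul (c : R) (x : Matrix (Fin 4) (Fin 4) R) : co (c • x) = c • co x := rfl

lemma isSymm_conj (M : Matrix (Fin 4) (Fin 4) R) {x : Matrix (Fin 4) (Fin 4) R} (hx : x.IsSymm) :
    (M * x * Mᵀ).IsSymm := by
  rw [IsSymm, transpose_mul, transpose_mul, transpose_transpose, hx.eq, Matrix.mul_assoc]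

/-- The matrix of `x ↦ M x Mᵀ` on symmetric matrices. -/
def symSq (M : Matrix (Fin 4) (Fin 4) R) : Matrix (Fin 10) (Fin 10) R :=
  of fun p => co (M * ofCo (Pi.single p 1) * Mᵀ)

lemma co_conj (M : Matrix (Fin 4) (Fin 4) R) {x : Matrix (Fin 4) (Fin 4) R} (hx : x.IsSymm) :
    co (M * x * Mᵀ) = co x ᵥ* symSq M := by
  conv_lhs => rw [← ofCo_co hx, ofCo_eq_sum]
  funext q
  simp only [Matrix.mul_sum, Matrix.sum_mul, Matrix.mul_smul, Matrix.smul_mul, co,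
    Matrix.sum_apply, vecMul, dotProduct, symSq, of_apply, Matrix.smul_apply, smul_eq_mul]

lemma symSq_mul (M N : Matrix (Fin 4) (Fin 4) R) : symSq (M * N) = symSq N * symSq M := by
  ext p q
  have h := congrFun (co_conj M (isSymm_conj N (ofCo_isSymm (Pi.single p (1 : R))))) q
  rw [mul_apply_eq_vecMul]
  refine Eq.trans ?_ h
  simp only [symSq, of_apply, transpose_mul, Matrix.mul_assoc]

lemma symSq_diagonal (d : Fin 4 → R) :
    symSq (diagonal d) = diagonal fun p => d (ix p).1 * d (ix p).2 := by
  ext p q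
  rw [symSq, of_apply, co, diagonal_transpose, mul_diagonal, diagonal_mul]
  by_cases h : p = q
  · subst h
    rw [diagonal_apply_eq]
    have : ofCo (Pi.single p (1 : R)) (ix p).1 (ix p).2 = 1 := by
      have := congrFun (co_ofCo (Pi.single p (1 : R))) p
      simpa [co] using this
    rw [this, mul_one]
  · rw [diagonal_apply_ne _ h]
    have : ofCo (Pi.single p (1 : R)) (ix q).1 (ix q).2 = 0 := by
      have := congrFun (co_ofCo (Pi.single p (1 : R))) q
      simpa [co, Pi.single_apply, Ne.symm h] using this
    rw [this, mul_zero, zero_mul]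

lemma det_symSq_diagonal (d : Fin 4 → R) :
    (symSq (diagonal d)).det = (diagonal d).det ^ 5 := by
  rw [symSq_diagonal, det_diagonal, det_diagonal]
  simp only [Fin.prod_univ_succ, ix]
  simp
  ring

lemma symSq_one : symSq (1 : Matrix (Fin 4) (Fin 4) R) = 1 := by
  rw [← diagonal_one, symSq_diagonal]; simp

lemma symSq_map {R' : Type*} [CommRing R'] (f : R →+* R') (M : Matrix (Fin 4) (Fin 4) R) :
    (symSq M).map f = symSq (M.map f) := by
  ext p q
  simp only [symSq, map_apply, of_apply, co, Matrix.mul_apply, transpose_apply, map_sum, map_mul]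
  refine Finset.sum_congr rfl fun i _ => ?_
  congr 1
  refine Finset.sum_congr rfl fun j _ => ?_
  congr 1
  fin_cases j <;> fin_cases i <;> simp [ofCo, Pi.single_apply, apply_ite f]

end Ring

lemma det_symSq_pos_rat (M : Matrix (Fin 4) (Fin 4) ℚ) (h : M.det ≠ 0) :
    0 < M.det * (symSq M).det := by
  refine diagonal_transvection_induction_of_det_ne_zero
    (fun M => 0 < M.det * (symSq M).det) M h ?_ ?_ ?_
  · intro d hd
    rw [det_symSq_diagonal, ← pow_succ']
    exact Even.pow_pos (by decide) hd
  · intro t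
    have h1 : t.toMatrix =
        transvection t.i t.j (t.c / 2) * transvection t.i t.j (t.c / 2) := by
      rw [transvection_mul_transvection_same _ _ t.hij, add_halves]; rfl
    have h2 : IsUnit (symSq (transvection t.i t.j (t.c / 2))).det := by
      refine IsUnit.of_mul_eq_one (symSq (transvection t.i t.j (-(t.c / 2)))).det ?_
      rw [← det_mul, ← symSq_mul, transvection_mul_transvection_same _ _ t.hij, neg_add_cancel,
        transvection_zero, symSq_one, det_one]
    have h3 := h2.ne_zero
    rw [h1, symSq_mul, det_mul, det_mul, det_transvection_of_ne _ _ t.hij]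
    simpa using mul_self_pos.2 h3
  · intro A B _ _ hA hB
    rw [symSq_mul, det_mul, det_mul]
    nlinarith [mul_pos hA hB]

lemma det_symSq_pos (g : Matrix (Fin 4) (Fin 4) ℤ) (h : g.det = 1) : 0 < (symSq g).det := by
  have h1 : (g.map (Int.castRingHom ℚ)).det = 1 := by
    have := (Int.castRingHom ℚ).map_det g
    rw [RingHom.mapMatrix_apply] at this
    rw [← this, h]; simp
  have h2 := det_symSq_pos_rat _ (h1 ▸ one_ne_zero)
  rw [h1, one_mul, ← symSq_map] at h2
  have h3 := (Int.castRingHom ℚ).map_det (symSq g)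
  rw [RingHom.mapMatrix_apply] at h3
  rw [← h3] at h2
  simpa using h2

/-! #### Integral forms -/

/-- Integral `4 × 4` matrices. -/
abbrev S := Matrix (Fin 4) (Fin 4) ℤ

/-- The trace pairing. -/
def pr (Q x : S) : ℤ := (Q * x).trace

/-- Squares of integral vectors. -/
def sq (v : Fin 4 → ℤ) : S := vecMulVec v v

lemma isSymm_sq (v : Fin 4 → ℤ) : (sq v).IsSymm := by
  ext i j; exact mul_comm _ _

lemma pr_add_left (Q Q' x : S) : pr (Q + Q') x = pr Q x + pr Q' x := by
  simp [pr, Matrix.add_mul]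

lemma pr_sub_left (Q Q' x : S) : pr (Q - Q') x = pr Q x - pr Q' x := by
  simp [pr, Matrix.sub_mul]

lemma pr_smul_left (c : ℤ) (Q x : S) : pr (c • Q) x = c * pr Q x := by
  rw [pr, Matrix.smul_mul, trace_smul, smul_eq_mul, pr]

lemma pr_neg_left (Q x : S) : pr (-Q) x = - pr Q x := by
  simp [pr]

lemma pr_zero_left (x : S) : pr 0 x = 0 := by simp [pr]

lemma pr_add_right (Q x y : S) : pr Q (x + y) = pr Q x + pr Q y := by
  simp [pr, Matrix.mul_add]

lemma pr_smul_right (c : ℤ) (Q x : S) : pr Q (c • x) = c * pr Q x := by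
  rw [pr, Matrix.mul_smul, trace_smul, smul_eq_mul, pr]

lemma pr_sum_left {ι : Type*} (s : Finset ι) (Q : ι → S) (x : S) :
    pr (∑ i ∈ s, Q i) x = ∑ i ∈ s, pr (Q i) x := by
  simp [pr, Finset.sum_mul, trace_sum]

lemma pr_sum_right {ι : Type*} (s : Finset ι) (Q : S) (x : ι → S) :
    pr Q (∑ i ∈ s, x i) = ∑ i ∈ s, pr Q (x i) := by
  simp [pr, Finset.mul_sum, trace_sum]

lemma pr_sq (Q : S) (v : Fin 4 → ℤ) : pr Q (sq v) = v ⬝ᵥ Q *ᵥ v := by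
  rw [pr, sq, mul_vecMulVec, trace_vecMulVec, dotProduct_comm]

lemma pr_eq_sum {x : S} (hx : x.IsSymm) (Q : S) (hQ : Q.IsSymm) :
    pr Q x = ∑ p, co x p * (if (ix p).1 = (ix p).2 then co Q p else 2 * co Q p) := by
  rw [← ofCo_co hx, ← ofCo_co hQ, co_ofCo, co_ofCo]
  simp only [pr, trace, diag, Matrix.mul_apply, Fin.sum_univ_succ]
  simp [ofCo, ix]
  ring

/-- The determinant of the coordinates of ten symmetric matrices. -/
def om (L : List S) : ℤ := (of fun i : Fin 10 => co (L.getD i 0)).det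

lemma om_cons (x : S) (l : List S) : om (x :: l) =
    (updateRow (of fun i : Fin 10 => co ((0 :: l : List S).getD i 0)) 0 (co x)).det := by
  rw [om]
  congr 1
  ext i j
  cases i using Fin.cases <;> simp [updateRow_apply]

lemma om_add (x y : S) (l : List S) : om ((x + y) :: l) = om (x :: l) + om (y :: l) := by
  rw [om_cons, om_cons x, om_cons y, co_add, det_updateRow_add]

lemma om_smul (c : ℤ) (x : S) (l : List S) : om ((c • x) :: l) = c * om (x :: l) := by
  rw [om_cons, om_cons x, co_smul, det_updateRow_smul]

lemma om_swap (p : List S) (a b : S) (s : List S) (h : (p ++ a :: b :: s).length = 10) :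
    om (p ++ a :: b :: s) = - om (p ++ b :: a :: s) := by
  simp only [List.length_append, List.length_cons] at h
  let i : Fin 10 := ⟨p.length, by omega⟩
  let j : Fin 10 := ⟨p.length + 1, by omega⟩
  have hij : i ≠ j := by simp [i, j]
  have key : (of fun k : Fin 10 => co ((p ++ a :: b :: s).getD k 0)) =
      (of fun k : Fin 10 => co ((p ++ b :: a :: s).getD k 0)).submatrix (Equiv.swap i j) id := by
    ext k q
    simp only [of_apply, submatrix_apply, id]
    congr 1
    by_cases h1 : k = i
    · subst h1; rw [Equiv.swap_apply_left]; simp [i, j, List.getD_append_right]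
    by_cases h2 : k = j
    · subst h2; rw [Equiv.swap_apply_right]; simp [i, j, List.getD_append_right]
    rw [Equiv.swap_apply_of_ne_of_ne h1 h2]
    rcases lt_or_ge k.1 p.length with h3 | h3
    · rw [List.getD_append _ _ _ _ h3, List.getD_append _ _ _ _ h3]
    · have h4 : k.1 ≠ p.length := fun h => h1 (Fin.ext h)
      have h5 : k.1 ≠ p.length + 1 := fun h => h2 (Fin.ext h)
      rw [List.getD_append_right _ _ _ _ h3, List.getD_append_right _ _ _ _ h3]
      obtain ⟨m, hm⟩ : ∃ m, k.1 - p.length = m + 2 := ⟨k.1 - p.length - 2, by omega⟩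
      rw [hm]; simp
  rw [om, key, det_permute]
  simp [Equiv.Perm.sign_swap hij, om]

lemma om_map (g : S) (L : List S) (hL : ∀ x ∈ L, x.IsSymm) :
    om (L.map fun x => g * x * gᵀ) = om L * (symSq g).det := by
  rw [om, om, ← det_mul]
  congr 1
  ext i j
  rw [mul_apply_eq_vecMul]
  change co ((L.map fun x => g * x * gᵀ).getD i 0) j = (co (L.getD i 0) ᵥ* symSq g) j
  rcases lt_or_ge i.1 L.length with h | h
  · rw [List.getD_eq_getElem _ _ (by simpa using h), List.getD_eq_getElem _ _ h, List.getElem_map,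
      co_conj _ (hL _ (List.getElem_mem h))]
  · rw [List.getD_eq_default _ _ (by simpa using h), List.getD_eq_default _ _ h]
    change (0 : ℤ) = (0 ᵥ* _) j
    rw [zero_vecMul]; rfl

lemma om_eq_zero_iff (L : List S) (hL : ∀ x ∈ L, x.IsSymm) (h10 : L.length = 10) :
    om L = 0 ↔ ∃ E : S, E ≠ 0 ∧ E.IsSymm ∧ ∀ x ∈ L, pr E x = 0 := by
  rw [om, ← exists_mulVec_eq_zero_iff]
  have hrow (i : Fin 10) : L.getD i 0 = L[i.1]'(by omega) := List.getD_eq_getElem _ _ (by omega)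
  constructor
  · rintro ⟨v, hv, h⟩
    refine ⟨ofCo fun p => if (ix p).1 = (ix p).2 then 2 * v p else v p, ?_, ofCo_isSymm _, ?_⟩
    · intro h0
      apply hv
      funext p
      have := congrFun (congrArg co h0) p
      rw [co_ofCo] at this
      change _ = (0 : ℤ) at this
      split_ifs at this
      · simpa using this
      · simpa using this
    · intro x hx
      obtain ⟨i, hi, rfl⟩ := List.getElem_of_mem hx
      have h1 := congrFun h ⟨i, by omega⟩
      rw [mulVec, dotProduct] at h1
      simp only [of_apply, hrow, Pi.zero_apply] at h1
      rw [pr_eq_sum (hL _ hx) _ (ofCo_isSymm _), co_ofCo, ← mul_zero 2, ← h1, Finset.mul_sum]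
      refine Finset.sum_congr rfl fun p _ => ?_
      split_ifs <;> ring
  · rintro ⟨E, hE, hs, h⟩
    refine ⟨fun p => if (ix p).1 = (ix p).2 then co E p else 2 * co E p, ?_, ?_⟩
    · intro h0
      apply hE
      rw [← ofCo_co hs]
      have : co E = 0 := by
        funext p
        have := congrFun h0 p
        simp only [Pi.zero_apply] at this
        split_ifs at this
        · exact this
        · simpa using this
      rw [this]
      ext i j; fin_cases i <;> fin_cases j <;> rfl
    · funext i
      have hm : L[i.1]'(by omega) ∈ L := List.getElem_mem _
      rw [mulVec, dotProduct]
      simp only [of_apply, hrow, Pi.zero_apply]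
      rw [← pr_eq_sum (hL _ hm) _ hs]
      exact h _ hm

end SymForm

/-! ### Perfect forms with frames -/

namespace SymForm

open Matrix

/-- A transversal of three frames. -/
def Trans (F : Fin 3 → Finset S) (t : Fin 3 → S) : Prop := ∀ i, t i ∈ F i

/-- `e` is the edge direction attached to the transversal `t`. -/
def IsEdge (F : Fin 3 → Finset S) (t : Fin 3 → S) (e : S) : Prop :=
  e.IsSymm ∧ ∀ i, ∀ w ∈ F i, pr e w = if w = t i then 2 else 0

/-- A perfect form `Q` of minimum `2`, with minimal squares `I`, whose cone of forms is dual to a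
product of simplices with vertices given by the frames `F`. -/
structure Perf (P : S → Prop) (Q : S) (I : Finset S) (F : Fin 3 → Finset S) : Prop where
  symm : Q.IsSymm
  two_le : ∀ v, v ≠ 0 → 2 ≤ pr Q (sq v)
  mem_I : ∀ x, x ∈ I ↔ (∃ v, x = sq v) ∧ pr Q x = 2
  mem_F : ∀ x ∈ I, ∃ i, x ∈ F i
  mem_inc : ∀ i, ∀ x ∈ F i, x ∈ I ∨ F i = {x}
  disj : ∀ i j, ∀ x ∈ F i, x ∈ F j → i = j ∨ F i = {x}
  card : ∀ t, Trans F t → (I.filter fun x => ∀ i, x ≠ t i).card = 9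
  sum : ∃ k : ℤ, 0 < k ∧ ∀ i, k • ∑ x ∈ F i, x = ∑ x ∈ I, x
  ne : ∀ i, (F i).Nonempty
  perfect : ∀ E : S, E.IsSymm → (∀ x ∈ I, pr E x = 0) → E = 0
  edge : ∀ t, Trans F t → ∃ e, IsEdge F t e ∧ P (Q + e)
  fin : ∀ B : ℤ, {v | pr Q (sq v) ≤ B}.Finite

namespace Perf

variable {P : S → Prop} {Q : S} {I : Finset S} {F : Fin 3 → Finset S} (h : Perf P Q I F)
include h

lemma two_le_of_mem {Q' : S} {I' : Finset S} {F' : Fin 3 → Finset S} (h' : Perf P Q' I' F')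
    {x : S} (hx : x ∈ I') : 2 ≤ pr Q x := by
  obtain ⟨⟨v, rfl⟩, h2⟩ := (h'.mem_I x).1 hx
  refine h.two_le v ?_
  rintro rfl
  rw [pr_sq, zero_dotProduct] at h2
  exact absurd h2 (by norm_num)

lemma pr_eq {x : S} (hx : x ∈ I) : pr Q x = 2 := ((h.mem_I x).1 hx).2

lemma isSymm_of_mem {x : S} (hx : x ∈ I) : x.IsSymm := by
  obtain ⟨⟨v, rfl⟩, -⟩ := (h.mem_I x).1 hx
  exact isSymm_sq v

lemma sum_eq (R : S) (i : Fin 3) : ∑ x ∈ F i, pr R x = ∑ x ∈ F 0, pr R x := by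
  obtain ⟨k, hk, h1⟩ := h.sum
  have := congrArg (pr R) ((h1 i).trans (h1 0).symm)
  rw [pr_smul_right, pr_smul_right, pr_sum_right, pr_sum_right] at this
  exact mul_left_cancel₀ hk.ne' this

lemma nonneg_F {R : S} (hR : ∀ x ∈ I, 0 ≤ pr R x) (i : Fin 3) {w : S} (hw : w ∈ F i) :
    0 ≤ pr R w := by
  rcases h.mem_inc i w hw with h1 | h1
  · exact hR w h1
  · obtain ⟨k, hk, h2⟩ := h.sum
    have := congrArg (pr R) (h2 i)
    rw [pr_smul_right, pr_sum_right, pr_sum_right, h1, Finset.sum_singleton] at this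
    have h3 := Finset.sum_nonneg hR
    rw [← this] at h3
    exact nonneg_of_mul_nonneg_right h3 hk

lemma zero_of_F {R : S} (hs : R.IsSymm) (hR : ∀ i, ∀ x ∈ F i, pr R x = 0) : R = 0 := by
  refine h.perfect R hs fun x hx => ?_
  obtain ⟨i, hi⟩ := h.mem_F x hx
  exact hR i x hi

lemma ext {R R' : S} (hs : R.IsSymm) (hs' : R'.IsSymm) (hR : ∀ i, ∀ x ∈ F i, pr R x = pr R' x) :
    R = R' := by
  refine sub_eq_zero.1 (h.zero_of_F (hs.sub hs') fun i x hx => ?_)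
  rw [pr_sub_left, hR i x hx, sub_self]

lemma exists_pos {R : S} (hs : R.IsSymm) (h0 : R ≠ 0) (hR : ∀ x ∈ I, 0 ≤ pr R x) (i : Fin 3) :
    ∃ a ∈ F i, 0 < pr R a := by
  by_contra! hc
  apply h0
  refine h.zero_of_F hs fun j x hx => ?_
  have h1 : ∑ x ∈ F j, pr R x = 0 := by
    rw [h.sum_eq R j, ← h.sum_eq R i]
    exact Finset.sum_eq_zero fun w hw => le_antisymm (hc w hw) (h.nonneg_F hR i hw)
  exact (Finset.sum_eq_zero_iff_of_nonneg fun w hw => h.nonneg_F hR j hw).1 h1 x hx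

lemma exists_pos_I {R : S} (hs : R.IsSymm) (h0 : R ≠ 0) (hR : ∀ x ∈ I, 0 ≤ pr R x) :
    ∃ a ∈ I, 0 < pr R a := by
  by_contra! hc
  exact h0 (h.perfect R hs fun x hx => le_antisymm (hc x hx) (hR x hx))

omit h in
lemma _root_.SymForm.IsEdge.nonneg (h : Perf P Q I F) {t : Fin 3 → S} {e : S}
    (he : IsEdge F t e) {x : S} (hx : x ∈ I) : 0 ≤ pr e x := by
  obtain ⟨i, hi⟩ := h.mem_F x hx
  rw [he.2 i x hi]
  split_ifs <;> norm_num

omit h in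
lemma _root_.SymForm.IsEdge.ne_zero {t : Fin 3 → S} {e : S} (ht : Trans F t)
    (he : IsEdge F t e) : e ≠ 0 := by
  rintro rfl
  have := he.2 0 (t 0) (ht 0)
  rw [pr_zero_left, if_pos rfl] at this
  exact absurd this (by norm_num)

/-- An edge direction vanishes on the minimal squares outside the transversal. -/
lemma edge_eq_zero {t : Fin 3 → S} {e : S} (he : IsEdge F t e) {x : S} (hx : x ∈ I)
    (hxt : ∀ i, x ≠ t i) : pr e x = 0 := by
  obtain ⟨i, hi⟩ := h.mem_F x hx
  rw [he.2 i x hi, if_neg (hxt i)]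

/-- Every symmetric matrix is a combination of edge directions. -/
lemma decomp {R : S} (hs : R.IsSymm) (e : (Fin 3 → S) → S)
    (he : ∀ t, Trans F t → IsEdge F t (e t)) :
    (2 * (∑ x ∈ F 0, pr R x) ^ 2) • R =
      ∑ t ∈ Fintype.piFinset F, (∏ i, pr R (t i)) • e t := by
  classical
  refine h.ext (hs.smul _) ?_ fun i w hw => ?_
  · rw [IsSymm, transpose_sum]
    refine Finset.sum_congr rfl fun t ht => ?_
    rw [transpose_smul, (he t (Fintype.mem_piFinset.1 ht)).1.eq]
  · rw [pr_smul_left, pr_sum_left]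
    have h1 : ∀ t ∈ Fintype.piFinset F, pr ((∏ i, pr R (t i)) • e t) w =
        ∏ j, pr R (t j) * if j = i then (if w = t j then 2 else 0) else 1 := by
      intro t ht
      rw [pr_smul_left, (he t (Fintype.mem_piFinset.1 ht)).2 i w hw, Finset.prod_mul_distrib]
      congr 1
      rw [Finset.prod_ite_eq' Finset.univ i (fun j => if w = t j then (2 : ℤ) else 0),
        if_pos (Finset.mem_univ _)]
    rw [Finset.sum_congr rfl h1]
    have h2 := Finset.prod_univ_sum (fun j => F j)
      (fun j x => pr R x * if j = i then (if w = x then (2 : ℤ) else 0) else 1)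
    rw [← h2]
    have h3 : ∀ j, (∑ x ∈ F j, pr R x * if j = i then (if w = x then (2 : ℤ) else 0) else 1) =
        if j = i then 2 * pr R w else ∑ x ∈ F 0, pr R x := by
      intro j
      split_ifs with hj
      · subst hj
        simp only [mul_ite, mul_zero]
        rw [Finset.sum_ite_eq, if_pos hw]; ring
      · simp only [mul_one]; exact h.sum_eq R j
    rw [Finset.prod_congr rfl fun j _ => h3 j]
    fin_cases i <;> simp [Fin.prod_univ_succ] <;> ring

section Sign

variable {Γ : Type*} [AddCommGroup Γ] [LinearOrder Γ] [IsOrderedAddMonoid Γ] (f : S →+ Γ)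
  {R : S} (hs : R.IsSymm) (hR : ∀ x ∈ I, 0 ≤ pr R x) {e : (Fin 3 → S) → S}
  (he : ∀ t, Trans F t → IsEdge F t (e t))
include hs hR he

lemma map_nonpos (hf : ∀ t, Trans F t → (∀ i, 0 < pr R (t i)) → f (e t) ≤ 0) : f R ≤ 0 := by
  classical
  by_cases h0 : R = 0
  · rw [h0, map_zero]
  have h1 := congrArg f (h.decomp hs e he)
  rw [map_zsmul, map_sum] at h1
  have h2 : ∑ t ∈ Fintype.piFinset F, f ((∏ i, pr R (t i)) • e t) ≤ 0 := by
    refine Finset.sum_nonpos fun t ht => ?_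
    rw [Fintype.mem_piFinset] at ht
    rw [map_zsmul]
    have h3 : ∀ i, 0 ≤ pr R (t i) := fun i => h.nonneg_F hR i (ht i)
    by_cases h4 : ∀ i, 0 < pr R (t i)
    · have h5 := zsmul_nonneg (neg_nonneg.2 (hf t ht h4))
        (Finset.prod_nonneg fun i (_ : i ∈ Finset.univ) => h3 i)
      rw [zsmul_neg] at h5
      exact neg_nonneg.1 h5
    · push Not at h4
      obtain ⟨i, hi⟩ := h4
      rw [Finset.prod_eq_zero (Finset.mem_univ i) (le_antisymm hi (h3 i)), zero_zsmul]
  rw [← h1] at h2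
  by_contra! h3
  refine absurd h2 (not_le.2 (zsmul_pos h3 ?_))
  obtain ⟨a, ha, ha'⟩ := h.exists_pos hs h0 hR 0
  have : 0 < ∑ x ∈ F 0, pr R x :=
    Finset.sum_pos' (fun x hx => h.nonneg_F hR 0 hx) ⟨a, ha, ha'⟩
  positivity

lemma map_nonneg (hf : ∀ t, Trans F t → 0 ≤ f (e t)) : 0 ≤ f R := by
  have := h.map_nonpos (-f) hs hR he fun t ht _ => by simpa using hf t ht
  simpa using this

end Sign

end Perf

end SymForm

/-! ### The frame complex of perfect forms -/

namespace SymForm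

open Matrix

/-- Framings of all forms in a class of perfect forms. -/
structure Sys (P : S → Prop) where
  I : {Q // P Q} → Finset S
  F : {Q // P Q} → Fin 3 → Finset S
  e : {Q // P Q} → (Fin 3 → S) → S
  perf : ∀ Q, Perf P Q.1 (I Q) (F Q)
  isEdge : ∀ Q t, Trans (F Q) t → IsEdge (F Q) t (e Q t)
  prop : ∀ Q t, Trans (F Q) t → P (Q.1 + e Q t)

namespace Sys

variable {P : S → Prop} (Y : Sys P)

/-- The faces of a framed form. -/
def Face (Q : {Q // P Q}) (l : List S) : Prop :=
  l.Nodup ∧ (∀ x ∈ l, x ∈ Y.I Q) ∧ ∀ i, ∃ a ∈ Y.F Q i, a ∉ l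

variable {Y}

lemma face_iff {Q : {Q // P Q}} {l : List S} : Y.Face Q l ↔ l.Nodup ∧ (∀ x ∈ l, x ∈ Y.I Q) ∧
    ∃ E : S, E ≠ 0 ∧ E.IsSymm ∧ (∀ x ∈ l, pr E x = 0) ∧ ∀ x ∈ Y.I Q, 0 ≤ pr E x := by
  refine and_congr_right fun _ => and_congr_right fun hI => ⟨fun h => ?_, ?_⟩
  · choose t ht htl using h
    have he := Y.isEdge Q t ht
    exact ⟨_, he.ne_zero ht, he.1, fun x hx => (Y.perf Q).edge_eq_zero he (hI x hx)
      fun i hi => htl i (hi ▸ hx), fun x hx => he.nonneg (Y.perf Q) hx⟩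
  · rintro ⟨E, h0, hs, hl, hE⟩ i
    obtain ⟨a, ha, hp⟩ := (Y.perf Q).exists_pos hs h0 hE i
    exact ⟨a, ha, fun h => hp.ne' (hl a h)⟩

lemma face_of_subset {Q T : {Q // P Q}} {l : List S} (h : Y.Face Q l)
    (hT : ∀ x ∈ l, x ∈ Y.I T) : Y.Face T l := by
  by_cases hQT : Q = T
  · exact hQT ▸ h
  refine face_iff.2 ⟨h.1, hT, Q.1 - T.1, fun h0 => hQT (Subtype.ext (sub_eq_zero.1 h0)),
    (Y.perf Q).symm.sub (Y.perf T).symm, fun x hx => ?_, fun x hx => ?_⟩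
  · rw [pr_sub_left, (Y.perf Q).pr_eq (h.2.1 x hx), (Y.perf T).pr_eq (hT x hx), sub_self]
  · rw [pr_sub_left, (Y.perf T).pr_eq hx, sub_nonneg]
    exact (Y.perf Q).two_le_of_mem (Y.perf T) hx

/-- The neighbour of `Q` across the facet opposite to `t`. -/
def nb (Y : Sys P) (Q : {Q // P Q}) (t : Fin 3 → S) (ht : Trans (Y.F Q) t) : {Q // P Q} :=
  ⟨Q.1 + Y.e Q t, Y.prop Q t ht⟩

lemma mem_nb {Q : {Q // P Q}} {t : Fin 3 → S} (ht : Trans (Y.F Q) t) {x : S}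
    (hx : x ∈ Y.I Q) (hxt : ∀ i, x ≠ t i) : x ∈ Y.I (Y.nb Q t ht) := by
  refine ((Y.perf _).mem_I x).2 ⟨(((Y.perf Q).mem_I x).1 hx).1, ?_⟩
  rw [nb, pr_add_left, (Y.perf Q).pr_eq hx, (Y.perf Q).edge_eq_zero (Y.isEdge Q t ht) hx hxt,
    add_zero]

lemma mem_I_nb_pr {Q : {Q // P Q}} {t : Fin 3 → S} (ht : Trans (Y.F Q) t) {x : S}
    (hx : x ∈ Y.I (Y.nb Q t ht)) : pr (Y.e Q t) x ≤ 0 := by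
  have h1 := (Y.perf _).pr_eq hx
  have h2 := (Y.perf Q).two_le_of_mem (Y.perf _) hx
  rw [nb, pr_add_left] at h1
  linarith

lemma nb_ne {Q : {Q // P Q}} {t : Fin 3 → S} (ht : Trans (Y.F Q) t) : Y.nb Q t ht ≠ Q := by
  intro h
  have := congrArg Subtype.val h
  exact (Y.isEdge Q t ht).ne_zero ht (by simpa [nb] using this)

/-- Only the zero vector is orthogonal to all of `l`. -/
def Span (l : List S) : Prop := ∀ u : Fin 4 → ℤ, (∀ x ∈ l, pr (sq u) x = 0) → u = 0

lemma finite_of_span {l : List S} (h : Span l) : {Q | ∀ x ∈ l, x ∈ Y.I Q}.Finite := by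
  classical
  rcases Set.eq_empty_or_nonempty {Q | ∀ x ∈ l, x ∈ Y.I Q} with h0 | ⟨Q0, hQ0⟩
  · rw [h0]; exact Set.finite_empty
  have hsq : ∀ x : l.toFinset, ∃ v, x.1 = sq v := fun x =>
    (((Y.perf Q0).mem_I _).1 (hQ0 _ (List.mem_toFinset.1 x.2))).1
  choose v hv using hsq
  refine Set.Finite.of_finite_image (f := fun Q => fun p : l.toFinset × l.toFinset =>
    v p.1 ⬝ᵥ Q.1 *ᵥ v p.2) ?_ ?_
  · refine (Set.Finite.pi (fun _ => Set.finite_Icc (-2 : ℤ) 2)).subset ?_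
    rintro _ ⟨Q, hQ, rfl⟩ p -
    have h2 : ∀ x : l.toFinset, v x ⬝ᵥ Q.1 *ᵥ v x = 2 := fun x => by
      rw [← pr_sq, ← hv]; exact (Y.perf Q).pr_eq (hQ _ (List.mem_toFinset.1 x.2))
    have hn : ∀ w, 0 ≤ w ⬝ᵥ Q.1 *ᵥ w := fun w => by
      by_cases hw : w = 0
      · rw [hw, zero_dotProduct]
      · rw [← pr_sq]; linarith [(Y.perf Q).two_le w hw]
    have hc : v p.2 ⬝ᵥ Q.1 *ᵥ v p.1 = v p.1 ⬝ᵥ Q.1 *ᵥ v p.2 := by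
      rw [dotProduct_mulVec, ← mulVec_transpose, (Y.perf Q).symm.eq, dotProduct_comm]
    have ha := hn (v p.1 + v p.2)
    have hb := hn (v p.1 - v p.2)
    rw [mulVec_add, add_dotProduct, dotProduct_add, dotProduct_add, h2, h2, hc] at ha
    rw [mulVec_sub, sub_dotProduct, dotProduct_sub, dotProduct_sub, h2, h2, hc] at hb
    exact ⟨by change -2 ≤ v p.1 ⬝ᵥ Q.1 *ᵥ v p.2; linarith,
      by change v p.1 ⬝ᵥ Q.1 *ᵥ v p.2 ≤ 2; linarith⟩
  · intro Q hQ Q' hQ' he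
    refine Subtype.ext (sub_eq_zero.1 ?_)
    have hz : ∀ w : Fin 4 → ℤ, (∀ x, w ⬝ᵥ v x = 0) → w = 0 := fun w hw => h w fun x hx => by
      have := hv ⟨x, List.mem_toFinset.2 hx⟩
      simp only at this
      rw [this, pr, sq, sq, vecMulVec_mul_vecMulVec, hw]; simp
    have h1 : ∀ x, (Q.1 - Q'.1) *ᵥ v x = 0 := fun x => hz _ fun y => by
      rw [dotProduct_comm, sub_mulVec, dotProduct_sub, sub_eq_zero]
      exact congrFun he (y, x)
    ext i j
    exact congrFun (hz ((Q.1 - Q'.1) i) fun x => congrFun (h1 x) i) j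

section Order

variable {Γ : Type*} [AddCommGroup Γ] [LinearOrder Γ] [IsOrderedAddMonoid Γ] (f : S →+ Γ)

variable (Y) in
lemma exists_m (Q : {Q // P Q}) : ∃ m t0 : Fin 3 → S, Trans (Y.F Q) m ∧ Trans (Y.F Q) t0 ∧
    ∀ i, ∀ a ∈ Y.F Q i, f (Y.e Q (Function.update t0 i (m i))) ≤
      f (Y.e Q (Function.update t0 i a)) := by
  choose t0 h0 using (Y.perf Q).ne
  choose m hm hmin using fun i =>
    Finset.exists_min_image (Y.F Q i) (fun a => f (Y.e Q (Function.update t0 i a))) ⟨_, h0 i⟩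
  exact ⟨m, t0, hm, h0, hmin⟩

open Classical in
variable (Y) in
/-- The frame data of a class of perfect forms. -/
noncomputable def data : FrameData S {Q // P Q} where
  inc := Y.I
  F := Y.F
  m Q := (Y.exists_m f Q).choose
  neg Q t := f (Y.e Q t) < 0
  o Q l := if Y.Face Q l ∧ l.length = 9 then
    (((om ((∑ x ∈ Y.I Q, x) :: l)).sign : ℤ) : ℂ) else 0

lemma o_of {Q : {Q // P Q}} {l : List S} (h : Y.Face Q l) (hl : l.length = 9) :
    (Y.data f).o Q l = (((om ((∑ x ∈ Y.I Q, x) :: l)).sign : ℤ) : ℂ) := if_pos ⟨h, hl⟩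

lemma trans_update {F : Fin 3 → Finset S} {t : Fin 3 → S} (ht : Trans F t) {i : Fin 3} {a : S}
    (ha : a ∈ F i) : Trans F (Function.update t i a) := by
  intro j
  by_cases hj : j = i
  · subst hj; rwa [Function.update_self]
  · rw [Function.update_of_ne hj]; exact ht j

lemma e_exchange {Q : {Q // P Q}} {t t' : Fin 3 → S} (ht : Trans (Y.F Q) t)
    (ht' : Trans (Y.F Q) t') {i : Fin 3} {m : S} (hm : m ∈ Y.F Q i) :
    Y.e Q (Function.update t i m) + Y.e Q (Function.update t' i (t i)) =
      Y.e Q t + Y.e Q (Function.update t' i m) := by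
  have h1 := Y.isEdge Q _ (trans_update ht hm)
  have h2 := Y.isEdge Q _ (trans_update ht' (ht i))
  have h3 := Y.isEdge Q _ ht
  have h4 := Y.isEdge Q _ (trans_update ht' hm)
  refine (Y.perf Q).ext (h1.1.add h2.1) (h3.1.add h4.1) fun j w hw => ?_
  rw [pr_add_left, pr_add_left, h1.2 j w hw, h2.2 j w hw, h3.2 j w hw, h4.2 j w hw]
  by_cases hj : j = i
  · subst hj; simp only [Function.update_self]; ring
  · simp only [Function.update_of_ne hj]

variable [LinearOrder {Q // P Q}] (hle : ∀ Q T : {Q // P Q}, Q ≤ T ↔ f Q.1 ≤ f T.1)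
  (hinj : Function.Injective f) (hpos : ∀ u, u ≠ 0 → 0 < f (sq u))

include hle in
lemma le_of_dn {Q T : {Q // P Q}} {l : List S} (h : (Y.data f).Dn Q l)
    (hT : ∀ x ∈ l, x ∈ Y.I T) : T ≤ Q := by
  rw [hle, ← sub_nonpos, ← map_sub]
  refine (Y.perf Q).map_nonpos f ((Y.perf T).symm.sub (Y.perf Q).symm) (fun x hx => ?_)
    (Y.isEdge Q) fun t ht htp => (h.2 t ht fun i hi => (htp i).ne' ?_).le
  · rw [pr_sub_left, (Y.perf Q).pr_eq hx, sub_nonneg]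
    exact (Y.perf T).two_le_of_mem (Y.perf Q) hx
  · rw [pr_sub_left, (Y.perf T).pr_eq (hT _ hi), (Y.perf Q).pr_eq (h.1.2.1 _ hi), sub_self]

include hpos in
lemma span_of_dn {Q : {Q // P Q}} {l : List S} (h : (Y.data f).Dn Q l) : Span l := by
  intro u hu
  by_contra h0
  refine absurd (hpos u h0) (not_lt.2 ?_)
  refine (Y.perf Q).map_nonpos f (isSymm_sq u) (fun x hx => ?_)
    (Y.isEdge Q) fun t ht htp => (h.2 t ht fun i hi => (htp i).ne' (hu _ hi)).le
  obtain ⟨⟨v, rfl⟩, -⟩ := ((Y.perf Q).mem_I x).1 hx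
  rw [pr, sq, sq, vecMulVec_mul_vecMulVec]
  rw [trace_vecMulVec, dotProduct_smul, smul_eq_mul]
  exact mul_self_nonneg _

include hle hinj hpos in
lemma cell_iff {l : List S} : (Y.data f).Cell l ↔ (∃ Q, Y.Face Q l) ∧ Span l := by
  constructor
  · rintro ⟨Q, hQ⟩
    exact ⟨⟨Q, hQ.1⟩, span_of_dn f hpos hQ⟩
  · rintro ⟨⟨Q, hQ⟩, hl⟩
    obtain ⟨T, hT, hmax⟩ := (finite_of_span (Y := Y) hl).exists_maximal ⟨Q, hQ.2.1⟩
    refine ⟨T, face_of_subset hQ hT, fun t ht htl => ?_⟩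
    have h1 : ∀ x ∈ l, x ∈ Y.I (Y.nb T t ht) := fun x hx =>
      mem_nb ht (hT x hx) fun i hi => htl i (hi ▸ hx)
    have h2 : Y.nb T t ht < T := by
      refine lt_of_le_of_ne ?_ (nb_ne ht)
      exact (le_total _ _).elim (fun h => hmax h1 h) id
    change f _ < 0
    have h3 : f (T.1 + Y.e T t) ≤ f T.1 := (hle _ _).1 h2.le
    rw [map_add] at h3
    refine lt_of_le_of_ne (by simpa using h3) fun h4 => ?_
    rw [← map_zero f] at h4
    exact (Y.isEdge T t ht).ne_zero ht (hinj h4)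

end Order

end Sys

end SymForm

/-! ### The laws for perfect forms -/

namespace SymForm

open Matrix ListCochain

lemma om_eq_zero {L : List S} (hL : ∀ x ∈ L, x.IsSymm) (h10 : L.length = 10) {E : S} (h0 : E ≠ 0)
    (hs : E.IsSymm) (hE : ∀ x ∈ L, pr E x = 0) : om L = 0 :=
  (om_eq_zero_iff L hL h10).2 ⟨E, h0, hs, hE⟩

namespace Sys

variable {P : S → Prop} {Y : Sys P} {Q : {Q // P Q}} {l : List S}

lemma isSymm_sum_I (Y : Sys P) (Q : {Q // P Q}) : (∑ x ∈ Y.I Q, x).IsSymm := by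
  rw [IsSymm, transpose_sum]
  exact Finset.sum_congr rfl fun x hx => ((Y.perf Q).isSymm_of_mem hx).eq

lemma isSymm_cons (h : ∀ x ∈ l, x ∈ Y.I Q) : ∀ x ∈ (∑ x ∈ Y.I Q, x) :: l, x.IsSymm := by
  intro x hx
  rcases List.mem_cons.1 hx with rfl | hx
  · exact isSymm_sum_I Y Q
  · exact (Y.perf Q).isSymm_of_mem (h x hx)

lemma exists_pr_sum (Y : Sys P) (Q : {Q // P Q}) : ∃ k : ℤ, 0 < k ∧ ∀ E : S,
    pr E (∑ x ∈ Y.I Q, x) = k * ∑ x ∈ Y.F Q 0, pr E x := by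
  obtain ⟨k, hk, h⟩ := (Y.perf Q).sum
  exact ⟨k, hk, fun E => by rw [← h 0, pr_smul_right, pr_sum_right]⟩

lemma exists_trans (h : Y.Face Q l) : ∃ t, Trans (Y.F Q) t ∧ ∀ i, t i ∉ l := by
  choose t ht htl using h.2.2
  exact ⟨t, ht, htl⟩

lemma subset_filter (h : Y.Face Q l) {t : Fin 3 → S} (htl : ∀ i, t i ∉ l) :
    l.toFinset ⊆ (Y.I Q).filter fun x => ∀ i, x ≠ t i := fun x hx => by
  rw [List.mem_toFinset] at hx
  exact Finset.mem_filter.2 ⟨h.2.1 x hx, fun i hi => htl i (hi ▸ hx)⟩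

lemma mem_or (h : Y.Face Q l) (h9 : l.length = 9) {t : Fin 3 → S} (ht : Trans (Y.F Q) t)
    (htl : ∀ i, t i ∉ l) {x : S} (hx : x ∈ Y.I Q) (hxt : ∀ i, x ≠ t i) : x ∈ l := by
  have h1 := Finset.eq_of_subset_of_card_le (subset_filter h htl) (by
    rw [(Y.perf Q).card t ht, List.toFinset_card_of_nodup h.1, h9])
  rw [← List.mem_toFinset, h1]
  exact Finset.mem_filter.2 ⟨hx, hxt⟩

/-- The line of symmetric matrices vanishing on a maximal face. -/
lemma two_smul_eq (h : Y.Face Q l) (h9 : l.length = 9) {t : Fin 3 → S} (ht : Trans (Y.F Q) t)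
    (htl : ∀ i, t i ∉ l) {E : S} (hs : E.IsSymm) (hE : ∀ x ∈ l, pr E x = 0) :
    (2 : ℤ) • E = (∑ x ∈ Y.F Q 0, pr E x) • Y.e Q t := by
  have hF : ∀ i, ∀ w ∈ Y.F Q i, w ≠ t i → pr E w = 0 := fun i w hw hwt => by
    rcases (Y.perf Q).mem_inc i w hw with h1 | h1
    · refine hE w (mem_or h h9 ht htl h1 fun j hj => ?_)
      rcases (Y.perf Q).disj i j w hw (hj ▸ ht j) with h2 | h2
      · exact hwt (h2 ▸ hj)
      · have := ht i
        rw [h2, Finset.mem_singleton] at this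
        exact hwt this.symm
    · have := ht i
      rw [h1, Finset.mem_singleton] at this
      exact absurd this.symm hwt
  refine (Y.perf Q).ext (hs.smul _) ((Y.isEdge Q t ht).1.smul _) fun i w hw => ?_
  rw [pr_smul_left, pr_smul_left, (Y.isEdge Q t ht).2 i w hw]
  split_ifs with hwt
  · rw [← (Y.perf Q).sum_eq E i, Finset.sum_eq_single (t i) (fun b hb hbt => hF i b hb hbt)
      (fun h => absurd (ht i) h), hwt, mul_comm]
  · rw [hF i w hw hwt, mul_zero, mul_zero]

lemma om_ne_zero (h : Y.Face Q l) (h9 : l.length = 9) : om ((∑ x ∈ Y.I Q, x) :: l) ≠ 0 := by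
  intro h0
  obtain ⟨E, hE, hs, hz⟩ := (om_eq_zero_iff _ (isSymm_cons h.2.1) (by simp [h9])).1 h0
  obtain ⟨t, ht, htl⟩ := exists_trans h
  have h1 := two_smul_eq h h9 ht htl hs fun x hx => hz x (List.mem_cons_of_mem _ hx)
  obtain ⟨k, hk, h2⟩ := exists_pr_sum Y Q
  have h3 := h2 E
  rw [hz _ List.mem_cons_self] at h3
  rw [(mul_eq_zero.1 h3.symm).resolve_left hk.ne', zero_smul] at h1
  exact hE ((smul_eq_zero.1 h1).resolve_left (by norm_num))

section Order

variable {Γ : Type*} [AddCommGroup Γ] [LinearOrder Γ] [IsOrderedAddMonoid Γ] (f : S →+ Γ)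

lemma o_supp : (Y.data f).o Q l ≠ 0 ↔ (Y.data f).Face Q l ∧ l.length = 9 := by
  constructor
  · intro h
    by_contra h1
    exact h (if_neg h1)
  · rintro ⟨h, h9⟩
    rw [o_of f h h9]
    have := om_ne_zero h h9
    exact_mod_cast fun h => this (Int.sign_eq_zero_iff_zero.1 h)

lemma o_alt : Alt ((Y.data f).o Q) := by
  intro p a b s
  have hp : (p ++ a :: b :: s).Perm (p ++ b :: a :: s) := (List.Perm.swap b a s).append_left p
  by_cases h : Y.Face Q (p ++ a :: b :: s) ∧ (p ++ a :: b :: s).length = 9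
  · have h' : Y.Face Q (p ++ b :: a :: s) ∧ (p ++ b :: a :: s).length = 9 :=
      ⟨FrameData.Face.perm (D := Y.data f) h.1 hp, hp.length_eq ▸ h.2⟩
    rw [o_of f h.1 h.2, o_of f h'.1 h'.2, ← List.cons_append, ← List.cons_append,
      om_swap _ _ _ _ (by simpa using h.2)]
    simp
  · have h' : ¬ (Y.Face Q (p ++ b :: a :: s) ∧ (p ++ b :: a :: s).length = 9) := fun h' =>
      h ⟨FrameData.Face.perm (D := Y.data f) h'.1 hp.symm, hp.length_eq ▸ h'.2⟩
    have h1 : (Y.data f).o Q (p ++ a :: b :: s) = 0 := if_neg h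
    have h2 : (Y.data f).o Q (p ++ b :: a :: s) = 0 := if_neg h'
    rw [h1, h2, neg_zero]

lemma sum_pr_edge {t : Fin 3 → S} (ht : Trans (Y.F Q) t) :
    ∑ x ∈ Y.F Q 0, pr (Y.e Q t) x = 2 := by
  rw [Finset.sum_congr rfl fun x hx => (Y.isEdge Q t ht).2 0 x hx,
    Finset.sum_ite_eq' _ (t 0) (fun _ => (2 : ℤ)), if_pos (ht 0)]

lemma o_sum (h : Y.Face Q l) (h8 : l.length = 8) :
    ∑ x ∈ Y.I Q, (Y.data f).o Q (x :: l) = 0 := by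
  classical
  obtain ⟨t, ht, htl⟩ := exists_trans h
  have hc : (((Y.I Q).filter fun x => ∀ i, x ≠ t i) \ l.toFinset).card = 1 := by
    rw [Finset.card_sdiff_of_subset (subset_filter h htl), (Y.perf Q).card t ht,
      List.toFinset_card_of_nodup h.1, h8]
  obtain ⟨a, ha⟩ := Finset.card_eq_one.1 hc
  have hmem : ∀ x, (x ∈ Y.I Q ∧ ∀ i, x ≠ t i) ∧ x ∉ l ↔ x = a := fun x => by
    have := Finset.ext_iff.1 ha x
    rwa [Finset.mem_sdiff, Finset.mem_filter, List.mem_toFinset, Finset.mem_singleton] at this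
  obtain ⟨⟨haI, hat⟩, hal⟩ := (hmem a).2 rfl
  obtain ⟨i, hai⟩ := (Y.perf Q).mem_F a haI
  have hns : ∀ x, Y.F Q i ≠ {x} := fun x hx => by
    have h1 := ht i
    rw [hx, Finset.mem_singleton] at h1 hai
    exact hat i (hai.trans h1.symm)
  have htI : t i ∈ Y.I Q := ((Y.perf Q).mem_inc i _ (ht i)).resolve_right (hns _)
  have htj : ∀ j, j ≠ i → t j ≠ t i := fun j hj h1 =>
    ((Y.perf Q).disj i j (t i) (ht i) (h1 ▸ ht j)).elim (fun h2 => hj h2.symm) (hns _)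
  have hFa : Y.Face Q (a :: l) := by
    refine ⟨List.nodup_cons.2 ⟨hal, h.1⟩, List.forall_mem_cons.2 ⟨haI, h.2.1⟩, fun j =>
      ⟨t j, ht j, fun hj => ?_⟩⟩
    rcases List.mem_cons.1 hj with hj | hj
    exacts [hat j hj.symm, htl j hj]
  have hFt : Y.Face Q (t i :: l) := by
    refine ⟨List.nodup_cons.2 ⟨htl i, h.1⟩, List.forall_mem_cons.2 ⟨htI, h.2.1⟩, fun j => ?_⟩
    by_cases hj : j = i
    · subst hj
      refine ⟨a, hai, fun h1 => ?_⟩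
      rcases List.mem_cons.1 h1 with h1 | h1
      exacts [hat j h1, hal h1]
    · refine ⟨t j, ht j, fun h1 => ?_⟩
      rcases List.mem_cons.1 h1 with h1 | h1
      exacts [htj j hj h1, htl j h1]
  rw [← Finset.sum_subset (s₁ := {a, t i}) (by
    intro x hx
    rcases Finset.mem_insert.1 hx with rfl | hx
    · exact haI
    · rwa [Finset.mem_singleton.1 hx]), Finset.sum_pair (hat i)]
  · rw [o_of f hFa (by simp [h8]), o_of f hFt (by simp [h8])]
    have hta := trans_update ht hai
    obtain ⟨k, -, hk⟩ := exists_pr_sum Y Q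
    have h0 : om ((a + t i) :: (∑ x ∈ Y.I Q, x) :: l) = 0 := by
      have hp : ∀ w ∈ Y.F Q i, pr (Y.e Q t - Y.e Q (Function.update t i a)) w =
          (if w = t i then 2 else 0) - if w = a then 2 else 0 := fun w hw => by
        rw [pr_sub_left, (Y.isEdge Q t ht).2 i w hw, (Y.isEdge Q _ hta).2 i w hw,
          Function.update_self]
      refine om_eq_zero (E := Y.e Q t - Y.e Q (Function.update t i a)) ?_ (by simp [h8]) ?_
        ((Y.isEdge Q t ht).1.sub (Y.isEdge Q _ hta).1) ?_
      · refine List.forall_mem_cons.2 ⟨?_, isSymm_cons h.2.1⟩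
        exact ((Y.perf Q).isSymm_of_mem haI).add ((Y.perf Q).isSymm_of_mem htI)
      · intro h1
        have := hp _ (ht i)
        rw [h1, pr_zero_left, if_pos rfl, if_neg (hat i).symm] at this
        exact absurd this (by norm_num)
      · refine List.forall_mem_cons.2 ⟨?_, List.forall_mem_cons.2 ⟨?_, fun x hx => ?_⟩⟩
        · rw [pr_add_right, hp _ hai, hp _ (ht i), if_neg (hat i), if_pos rfl, if_pos rfl,
            if_neg (hat i).symm]
          norm_num
        · rw [hk]
          simp only [pr_sub_left, Finset.sum_sub_distrib]
          rw [sum_pr_edge ht, sum_pr_edge hta, sub_self, mul_zero]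
        · rw [pr_sub_left, (Y.perf Q).edge_eq_zero (Y.isEdge Q t ht) (h.2.1 x hx)
            fun j hj => htl j (hj ▸ hx), (Y.perf Q).edge_eq_zero (Y.isEdge Q _ hta) (h.2.1 x hx),
            sub_self]
          intro j hj
          by_cases hji : j = i
          · subst hji
            rw [Function.update_self] at hj
            exact hal (hj ▸ hx)
          · rw [Function.update_of_ne hji] at hj
            exact htl j (hj ▸ hx)
    have hsw : ∀ y, om ((∑ x ∈ Y.I Q, x) :: y :: l) = - om (y :: (∑ x ∈ Y.I Q, x) :: l) :=
      fun y => om_swap [] _ _ _ (by simp [h8])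
    rw [om_add] at h0
    rw [hsw, hsw, eq_neg_of_add_eq_zero_left h0]
    simp
  · intro x hx hxn
    by_contra h1
    obtain ⟨hF, -⟩ := (o_supp f).1 h1
    refine hxn ?_
    rw [Finset.mem_insert, Finset.mem_singleton]
    by_contra! hcon
    have hxl : x ∉ l := (List.nodup_cons.1 hF.1).1
    have h2 : ∃ j, x = t j := by
      by_contra! h3
      exact hcon.1 ((hmem x).1 ⟨⟨hx, h3⟩, hxl⟩)
    obtain ⟨j, rfl⟩ := h2
    obtain ⟨b, hb, hbl⟩ := hF.2.2 j
    change b ∈ Y.F Q j at hb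
    rw [List.mem_cons, not_or] at hbl
    have hnj : ∀ y, Y.F Q j ≠ {y} := fun y hy => by
      have h4 := ht j
      rw [hy, Finset.mem_singleton] at h4 hb
      exact hbl.1 (hb.trans h4.symm)
    have hbI := ((Y.perf Q).mem_inc j b hb).resolve_right (hnj _)
    have hba : b = a := (hmem b).1 ⟨⟨hbI, fun j' hj' => ?_⟩, hbl.2⟩
    · subst hba
      rcases (Y.perf Q).disj j i b hb hai with h5 | h5
      · exact hcon.2 (h5 ▸ rfl)
      · exact hnj _ h5
    · rcases (Y.perf Q).disj j j' b hb (hj' ▸ ht j') with h5 | h5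
      · exact hbl.1 (h5 ▸ hj')
      · exact hnj _ h5

lemma exists_edge (h : Y.Face Q l) (h9 : l.length = 9) :
    ∃ Q', Q' ≠ Q ∧ (∀ T, Y.Face T l ↔ T = Q ∨ T = Q') ∧
      (Y.data f).o Q l + (Y.data f).o Q' l = 0 := by
  obtain ⟨t, ht, htl⟩ := exists_trans h
  have he := Y.isEdge Q t ht
  have he0 := he.ne_zero ht
  have hnb : ∀ x ∈ l, x ∈ Y.I (Y.nb Q t ht) := fun x hx =>
    mem_nb ht (h.2.1 x hx) fun i hi => htl i (hi ▸ hx)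
  have hF' := face_of_subset h hnb
  obtain ⟨b, hb, hb0⟩ := (Y.perf (Y.nb Q t ht)).exists_pos_I (R := -Y.e Q t)
    he.1.neg (neg_ne_zero.2 he0) fun x hx => by
      rw [pr_neg_left]; linarith [mem_I_nb_pr ht hx]
  rw [pr_neg_left] at hb0
  refine ⟨Y.nb Q t ht, nb_ne ht, fun T => ⟨fun hT => ?_, ?_⟩, ?_⟩
  · have h2 := two_smul_eq h h9 ht htl (E := T.1 - Q.1) ((Y.perf T).symm.sub (Y.perf Q).symm)
      fun x hx => by
        rw [pr_sub_left, (Y.perf T).pr_eq (hT.2.1 x hx), (Y.perf Q).pr_eq (h.2.1 x hx), sub_self]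
    obtain ⟨a, ha, ha0⟩ := (Y.perf Q).exists_pos_I he.1 he0 fun x hx => he.nonneg (Y.perf Q) hx
    set s := ∑ x ∈ Y.F Q 0, pr (T.1 - Q.1) x
    have hpr : ∀ x, 2 * (pr T.1 x - pr Q.1 x) = s * pr (Y.e Q t) x := fun x => by
      rw [← pr_sub_left, ← pr_smul_left, h2, pr_smul_left]
    have hs0 : 0 ≤ s := by
      have h3 := (Y.perf T).two_le_of_mem (Y.perf Q) ha
      have h4 := (Y.perf Q).pr_eq ha
      have h5 := hpr a
      nlinarith
    have hs2 : s ≤ 2 := by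
      have h3 := (Y.perf T).two_le_of_mem (Y.perf _) hb
      have h4 := (Y.perf _).pr_eq hb
      rw [nb, pr_add_left] at h4
      have h5 := hpr b
      nlinarith
    have hs1 : s ≠ 1 := fun hs1 => by
      refine he0 ((Y.perf T).perfect _ he.1 fun x hx => ?_)
      have h3 := (Y.perf Q).two_le_of_mem (Y.perf T) hx
      have h4 := (Y.perf (Y.nb Q t ht)).two_le_of_mem (Y.perf T) hx
      have h5 := (Y.perf T).pr_eq hx
      have h6 := hpr x
      rw [nb, pr_add_left] at h4
      rw [hs1] at h6
      omega
    have h02 : s = 0 ∨ s = 2 := by omega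
    rcases h02 with h3 | h3
    · rw [h3, zero_smul] at h2
      exact Or.inl (Subtype.ext (sub_eq_zero.1 ((smul_eq_zero.1 h2).resolve_left (by norm_num))))
    · rw [h3] at h2
      refine Or.inr (Subtype.ext ?_)
      have h4 := smul_right_injective S (two_ne_zero (α := ℤ)) h2
      exact sub_eq_iff_eq_add'.1 h4
  · rintro (rfl | rfl)
    exacts [h, hF']
  · rw [o_of f h h9, o_of f hF' h9]
    obtain ⟨k, hk, hk'⟩ := exists_pr_sum Y Q
    have hp : 0 < pr (Y.e Q t) (∑ x ∈ Y.I Q, x) := by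
      rw [hk', sum_pr_edge ht]; linarith
    have hq : pr (Y.e Q t) (∑ x ∈ Y.I (Y.nb Q t ht), x) < 0 := by
      rw [pr_sum_right]
      exact Finset.sum_neg' (fun x hx => mem_I_nb_pr ht hx) ⟨b, hb, by linarith⟩
    set p := pr (Y.e Q t) (∑ x ∈ Y.I Q, x)
    set q := pr (Y.e Q t) (∑ x ∈ Y.I (Y.nb Q t ht), x)
    have h0 : om ((p • (∑ x ∈ Y.I (Y.nb Q t ht), x) + (-q) • (∑ x ∈ Y.I Q, x)) :: l) = 0 := by
      refine om_eq_zero (E := Y.e Q t) ?_ (by simp [h9]) he0 he.1 ?_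
      · refine List.forall_mem_cons.2 ⟨((isSymm_sum_I Y _).smul _).add ((isSymm_sum_I Y _).smul _),
          fun x hx => (Y.perf Q).isSymm_of_mem (h.2.1 x hx)⟩
      · refine List.forall_mem_cons.2 ⟨?_, fun x hx => (Y.perf Q).edge_eq_zero he (h.2.1 x hx)
          fun i hi => htl i (hi ▸ hx)⟩
        rw [pr_add_right, pr_smul_right, pr_smul_right]
        change p * q + -q * p = 0
        ring
    rw [om_add, om_smul, om_smul] at h0
    have h1 := om_ne_zero h h9
    set A := om ((∑ x ∈ Y.I Q, x) :: l)
    set B := om ((∑ x ∈ Y.I (Y.nb Q t ht), x) :: l)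
    rcases lt_or_gt_of_ne h1 with hA | hA
    · have hB : 0 < B := by nlinarith
      rw [Int.sign_eq_neg_one_of_neg hA, Int.sign_eq_one_of_pos hB]; norm_num
    · have hB : B < 0 := by nlinarith
      rw [Int.sign_eq_one_of_pos hA, Int.sign_eq_neg_one_of_neg hB]; norm_num

variable [LinearOrder {Q // P Q}] (hle : ∀ Q T : {Q // P Q}, Q ≤ T ↔ f Q.1 ≤ f T.1)
  (hinj : Function.Injective f) (hpos : ∀ u, u ≠ 0 → 0 < f (sq u))

include hle hinj hpos in
theorem laws : (Y.data f).Laws := by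
  have hm_mem : ∀ Q i, (Y.data f).m Q i ∈ (Y.data f).F Q i := fun Q =>
    (Y.exists_m f Q).choose_spec.choose_spec.1
  have hexch : ∀ Q t i, (∀ j, t j ∈ (Y.data f).F Q j) → (Y.data f).neg Q t →
      (Y.data f).neg Q (Function.update t i ((Y.data f).m Q i)) := by
    intro Q t i ht hn
    obtain ⟨h1, h2, h3⟩ := (Y.exists_m f Q).choose_spec.choose_spec
    have h4 := congrArg f (e_exchange ht h2 (h1 i))
    rw [map_add, map_add] at h4
    have h5 := h3 i (t i) (ht i)
    change f _ < 0 at hn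
    change f _ < 0
    refine lt_of_le_of_lt ?_ hn
    by_contra! h6
    exact h4.not_gt (add_lt_add_of_lt_of_le h6 h5)
  have hcell : ∀ l, (Y.data f).Cell l ↔ _ := fun l => cell_iff f hle hinj hpos
  refine ⟨hm_mem, hexch, fun Q => (Y.perf Q).mem_inc, fun Q => (Y.perf Q).disj,
    fun Q => (Y.perf Q).mem_F, fun Q t ht => ⟨_, (Y.perf Q).card t ht, fun x => Finset.mem_filter⟩,
    fun Q Q' l hQ hl => ⟨face_of_subset hQ.1 hl, le_of_dn f hle hQ hl⟩, fun l l' Q hl hll hQ => ?_,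
    fun l hl => finite_of_span ((hcell l).1 hl).2, fun Q => o_alt f, fun Q l => o_supp f,
    fun Q l hl h8 => o_sum f hl h8, fun Q l hl h9 => exists_edge f hl h9, fun Q hQ T => ?_⟩
  · exact (hcell l').2 ⟨⟨Q, hQ⟩, fun u hu => ((hcell l).1 hl).2 u fun x hx => hu x (hll x hx)⟩
  · rw [hle, ← sub_nonneg, ← map_sub]
    refine (Y.perf Q).map_nonneg f ((Y.perf T).symm.sub (Y.perf Q).symm) (fun x hx => ?_)
      (Y.isEdge Q) fun t ht => ?_
    · rw [pr_sub_left, (Y.perf Q).pr_eq hx, sub_nonneg]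
      exact (Y.perf T).two_le_of_mem (Y.perf Q) hx
    · by_contra! hn
      refine hQ ?_
      have h1 := hexch Q _ 0 ht hn
      have h2 := hexch Q _ 1 (trans_update ht (hm_mem Q 0)) h1
      have h3 := hexch Q _ 2 (trans_update (trans_update ht (hm_mem Q 0)) (hm_mem Q 1)) h2
      convert h3 using 1
      funext i
      fin_cases i <;> rfl

end Order

end Sys

end SymForm

/-! ### The action of the special linear group on perfect forms -/

namespace SymForm

open Matrix

/-- The special linear group of rank four. -/
abbrev G4 := SpecialLinearGroup (Fin 4) ℤ

instance : MulAction G4 S where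
  smul g x := g.1 * x * g.1ᵀ
  one_smul x := by change (1 : G4).1 * x * (1 : G4).1ᵀ = x; simp
  mul_smul g h x := by
    change (g * h).1 * x * (g * h).1ᵀ = g.1 * (h.1 * x * h.1ᵀ) * g.1ᵀ
    simp [Matrix.mul_assoc]

lemma smul_def (g : G4) (x : S) : g • x = g.1 * x * g.1ᵀ := rfl

lemma smul_sq (g : G4) (v : Fin 4 → ℤ) : g • sq v = sq (g.1 *ᵥ v) := by
  rw [smul_def, sq, mul_vecMulVec, vecMulVec_mul, vecMul_transpose, sq]

lemma smul_sum {ι : Type*} (g : G4) (s : Finset ι) (x : ι → S) :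
    g • ∑ i ∈ s, x i = ∑ i ∈ s, g • x i := by
  simp only [smul_def, Matrix.mul_sum, Matrix.sum_mul]

lemma val_mul (g h : G4) : (g * h).1 = g.1 * h.1 := rfl

lemma val_inv_mul (g : G4) : (g⁻¹).1 * g.1 = 1 := congrArg Subtype.val (inv_mul_cancel g)

lemma val_mul_inv (g : G4) : g.1 * (g⁻¹).1 = 1 := congrArg Subtype.val (mul_inv_cancel g)

/-- The contragredient action on forms. -/
def dual (g : G4) (Q : S) : S := (g⁻¹).1ᵀ * Q * (g⁻¹).1

lemma dual_mul (g h : G4) (Q : S) : dual (g * h) Q = dual g (dual h Q) := by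
  rw [dual, dual, dual, _root_.mul_inv_rev, val_mul, transpose_mul]
  simp only [Matrix.mul_assoc]

lemma dual_one (Q : S) : dual 1 Q = Q := by simp [dual]

lemma dual_add (g : G4) (Q R : S) : dual g (Q + R) = dual g Q + dual g R := by
  simp only [dual, Matrix.mul_add, Matrix.add_mul]

lemma isSymm_dual (g : G4) {Q : S} (h : Q.IsSymm) : (dual g Q).IsSymm := by
  rw [IsSymm, dual, transpose_mul, transpose_mul, transpose_transpose, h.eq, Matrix.mul_assoc]

lemma pr_dual (g : G4) (Q x : S) : pr (dual g Q) (g • x) = pr Q x := by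
  have h1 := val_inv_mul g
  rw [pr, pr, dual, smul_def, Matrix.mul_assoc, Matrix.mul_assoc, ← Matrix.mul_assoc (g⁻¹).1,
    ← Matrix.mul_assoc (g⁻¹).1, h1, Matrix.one_mul, trace_mul_comm, Matrix.mul_assoc,
    Matrix.mul_assoc, ← transpose_mul, h1, transpose_one, Matrix.mul_one]

lemma pr_dual' (g : G4) (Q x : S) : pr (dual g Q) x = pr Q (g⁻¹ • x) := by
  conv_lhs => rw [← smul_inv_smul g x, pr_dual]

lemma smul_inj (g : G4) : Function.Injective fun x : S => g • x := MulAction.injective g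

open Classical in
lemma Perf.smul {P : S → Prop} {Q : S} {I : Finset S} {F : Fin 3 → Finset S} (h : Perf P Q I F)
    (g : G4) (hP : ∀ Q, P Q → P (dual g Q)) :
    Perf P (dual g Q) (I.image (g • ·)) (fun i => (F i).image (g • ·)) := by
  have hmem : ∀ (A : Finset S) (x : S), x ∈ A.image (g • ·) ↔ g⁻¹ • x ∈ A := fun A x => by
    rw [Finset.mem_image]
    constructor
    · rintro ⟨y, hy, rfl⟩; simpa using hy
    · intro hx; exact ⟨_, hx, smul_inv_smul g x⟩
  have hsing : ∀ (i : Fin 3) (x : S), F i = {g⁻¹ • x} → (F i).image (g • ·) = {x} :=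
      fun i x hx => by
    rw [hx, Finset.image_singleton, smul_inv_smul]
  have htr : ∀ t, Trans (fun i => (F i).image (g • ·)) t → Trans F fun i => g⁻¹ • t i :=
    fun t ht i => (hmem _ _).1 (ht i)
  have hsqi : ∀ v, sq v = g • sq ((g⁻¹).1 *ᵥ v) := fun v => by
    rw [← smul_sq, smul_inv_smul]
  have hv0 : ∀ v, (g⁻¹).1 *ᵥ v = 0 → v = 0 := fun v hv => by
    have : g.1 *ᵥ ((g⁻¹).1 *ᵥ v) = v := by
      rw [mulVec_mulVec, val_mul_inv, one_mulVec]
    rw [← this, hv, mulVec_zero]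
  refine ⟨isSymm_dual g h.symm, fun v hv => ?_, fun x => ?_, fun x hx => ?_, fun i x hx => ?_,
    fun i j x hx hx' => ?_, fun t ht => ?_, ?_, fun i => (h.ne i).image _, fun E hs hE => ?_,
    fun t ht => ?_, fun B => ?_⟩
  · rw [hsqi, pr_dual]
    exact h.two_le _ fun h0 => hv (hv0 v h0)
  · rw [hmem, h.mem_I, pr_dual']
    refine and_congr_left fun _ => ⟨?_, ?_⟩
    · rintro ⟨v, hv⟩
      exact ⟨g.1 *ᵥ v, by rw [← smul_sq, ← hv, smul_inv_smul]⟩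
    · rintro ⟨v, rfl⟩
      exact ⟨_, smul_sq _ _⟩
  · obtain ⟨i, hi⟩ := h.mem_F _ ((hmem _ _).1 hx)
    exact ⟨i, (hmem _ _).2 hi⟩
  · rw [hmem] at hx ⊢
    exact (h.mem_inc i _ hx).imp id (hsing i x)
  · rw [hmem] at hx hx'
    exact (h.disj i j _ hx hx').imp id (hsing i x)
  · rw [← h.card _ (htr t ht)]
    refine (Finset.card_bij (fun x _ => g • x) (fun x hx => ?_) (fun x _ y _ hxy => smul_inj g hxy)
      fun y hy => ?_).symm
    · rw [Finset.mem_filter] at hx ⊢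
      exact ⟨Finset.mem_image_of_mem _ hx.1, fun i hi => hx.2 i (by rw [← hi, inv_smul_smul])⟩
    · rw [Finset.mem_filter, hmem] at hy
      exact ⟨_, Finset.mem_filter.2 ⟨hy.1, fun i hi => hy.2 i (smul_inj g⁻¹ hi)⟩,
        smul_inv_smul _ _⟩
  · obtain ⟨k, hk, h1⟩ := h.sum
    refine ⟨k, hk, fun i => ?_⟩
    rw [Finset.sum_image fun x _ y _ hxy => smul_inj g hxy,
      Finset.sum_image fun x _ y _ hxy => smul_inj g hxy, ← smul_sum, ← smul_sum, ← h1 i,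
      smul_def, smul_def, Matrix.mul_smul, Matrix.smul_mul]
  · have h1 : dual g⁻¹ E = 0 := h.perfect _ (isSymm_dual _ hs) fun x hx => by
      rw [pr_dual', inv_inv]
      exact hE _ (Finset.mem_image_of_mem _ hx)
    rw [← dual_one E, ← mul_inv_cancel g, dual_mul, h1]
    simp [dual]
  · obtain ⟨e, he, heP⟩ := h.edge _ (htr t ht)
    refine ⟨dual g e, ⟨isSymm_dual g he.1, fun i w hw => ?_⟩, dual_add g Q e ▸ hP _ heP⟩
    rw [pr_dual', he.2 i _ ((hmem _ _).1 hw)]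
    simp only [(smul_inj g⁻¹).eq_iff]
  · refine ((h.fin B).preimage (f := fun v => (g⁻¹).1 *ᵥ v) fun v _ w _ hvw => ?_).subset
      fun v hv => ?_
    · refine sub_eq_zero.1 (hv0 _ ?_)
      rw [mulVec_sub]; exact sub_eq_zero.2 hvw
    · change pr Q _ ≤ B
      rw [← smul_sq, ← pr_dual']; exact hv

/-- A class of forms stable under the special linear group acts on itself. -/
@[reducible] def formAction (P : S → Prop) (hP : ∀ (g : G4) Q, P Q → P (dual g Q)) :
    MulAction G4 {Q // P Q} where
  smul g Q := ⟨dual g Q.1, hP g _ Q.2⟩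
  one_smul Q := Subtype.ext (dual_one Q.1)
  mul_smul g h Q := Subtype.ext (dual_mul g h Q.1)

namespace Sys

variable {P : S → Prop} (Y : Sys P) [MulAction G4 {Q // P Q}]
  (hact : ∀ (g : G4) (Q : {Q // P Q}), (g • Q).1 = dual g Q.1)
include hact

lemma mem_I_smul (g : G4) (Q : {Q // P Q}) (x : S) : g • x ∈ Y.I (g • Q) ↔ x ∈ Y.I Q := by
  rw [(Y.perf _).mem_I, (Y.perf Q).mem_I, hact, pr_dual]
  refine and_congr_left fun _ => ⟨?_, ?_⟩
  · rintro ⟨v, hv⟩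
    exact ⟨(g⁻¹).1 *ᵥ v, by rw [← smul_sq, ← hv, inv_smul_smul]⟩
  · rintro ⟨v, rfl⟩
    exact ⟨_, smul_sq _ _⟩

lemma face_smul (g : G4) (Q : {Q // P Q}) {l : List S} (h : Y.Face Q l) :
    Y.Face (g • Q) (l.map (g • ·)) := by
  rw [face_iff] at h ⊢
  obtain ⟨h1, h2, E, h3, h4, h5, h6⟩ := h
  refine ⟨h1.map (smul_inj g), ?_, dual g E, ?_, isSymm_dual g h4, ?_, ?_⟩
  · rw [List.forall_mem_map]
    exact fun x hx => (Y.mem_I_smul hact g Q x).2 (h2 x hx)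
  · intro h0
    apply h3
    rw [← dual_one E, ← inv_mul_cancel g, dual_mul, h0]
    simp [dual]
  · rw [List.forall_mem_map]
    exact fun x hx => by rw [pr_dual, h5 x hx]
  · intro x hx
    rw [pr_dual']
    refine h6 _ ?_
    rwa [← Y.mem_I_smul hact g, smul_inv_smul]

lemma face_smul_iff (g : G4) (Q : {Q // P Q}) {l : List S} :
    Y.Face (g • Q) (l.map (g • ·)) ↔ Y.Face Q l := by
  refine ⟨fun h => ?_, Y.face_smul hact g Q⟩
  have := Y.face_smul hact g⁻¹ _ h
  simpa [Function.comp_def] using this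

lemma sum_I_smul (g : G4) (Q : {Q // P Q}) :
    ∑ x ∈ Y.I (g • Q), x = g • ∑ x ∈ Y.I Q, x := by
  rw [smul_sum]
  refine (Finset.sum_bij (fun x _ => g • x) (fun x hx => (Y.mem_I_smul hact g Q x).2 hx)
    (fun x _ y _ hxy => smul_inj g hxy) (fun y hy => ⟨g⁻¹ • y, ?_, smul_inv_smul _ _⟩)
    fun _ _ => rfl).symm
  rwa [← Y.mem_I_smul hact g, smul_inv_smul]

section Order

variable {Γ : Type*} [AddCommGroup Γ] [LinearOrder Γ] [IsOrderedAddMonoid Γ] (f : S →+ Γ)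

lemma o_smul (g : G4) (Q : {Q // P Q}) (l : List S) :
    (Y.data f).o (g • Q) (l.map (g • ·)) = (Y.data f).o Q l := by
  by_cases h : Y.Face Q l ∧ l.length = 9
  · rw [o_of f h.1 h.2, o_of f ((Y.face_smul_iff hact g Q).2 h.1) (by simpa using h.2),
      Y.sum_I_smul hact]
    have := om_map g.1 _ (isSymm_cons (Y := Y) (Q := Q) h.1.2.1)
    rw [List.map_cons] at this
    change ((Int.sign (om ((g.1 * _ * g.1ᵀ) :: l.map fun x => g.1 * x * g.1ᵀ)) : ℤ) : ℂ) = _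
    rw [this, Int.sign_mul, Int.sign_eq_one_of_pos (det_symSq_pos _ g.2), mul_one]
  · have h1 : (Y.data f).o Q l = 0 := if_neg h
    have h2 : (Y.data f).o (g • Q) (l.map (g • ·)) = 0 := if_neg fun h' =>
      h ⟨(Y.face_smul_iff hact g Q).1 h'.1, by simpa using h'.2⟩
    rw [h1, h2]

include Y in
lemma finite_smul_eq (Q Q' : {Q // P Q}) : {g : G4 | g • Q = Q'}.Finite := by
  have h1 : (Set.univ.pi fun j : Fin 4 =>
      {v : Fin 4 → ℤ | pr Q'.1 (sq v) ≤ pr Q.1 (sq (Pi.single j 1))}).Finite :=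
    Set.Finite.pi fun j => (Y.perf Q').fin _
  refine (h1.preimage (f := fun (g : G4) j => g.1 *ᵥ Pi.single j 1) ?_).subset ?_
  · intro g _ h _ hgh
    refine Subtype.ext (Matrix.ext fun i j => ?_)
    have := congrFun (congrFun hgh j) i
    simpa using this
  · rintro g rfl j -
    change pr _ _ ≤ _
    rw [← smul_sq, hact, pr_dual]

end Order

end Sys

end SymForm

/-! ### The two standard perfect forms -/

namespace SymForm

open Matrix

/-- The form of the root lattice `A₄`. -/
def QA : S := !![2, 1, 1, 1; 1, 2, 1, 1; 1, 1, 2, 1; 1, 1, 1, 2]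

/-- The form of the root lattice `D₄`. -/
def QD : S := !![2, 0, 1, 1; 0, 2, 1, 1; 1, 1, 2, 1; 1, 1, 1, 2]

/-- The values of the form `QA`. -/
def qA (v : Fin 4 → ℤ) : ℤ :=
  v 0 * v 0 + v 1 * v 1 + v 2 * v 2 + v 3 * v 3 + (v 0 + v 1 + v 2 + v 3) * (v 0 + v 1 + v 2 + v 3)

/-- The values of the form `QD`. -/
def qD (v : Fin 4 → ℤ) : ℤ :=
  (v 0 + v 1 + v 2 + v 3) * (v 0 + v 1 + v 2 + v 3) + (v 0 - v 1) * (v 0 - v 1) + v 2 * v 2 +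
    v 3 * v 3

lemma pr_QA (v : Fin 4 → ℤ) : pr QA (sq v) = qA v := by
  rw [pr_sq]; simp [QA, qA, dotProduct, mulVec, Fin.sum_univ_four]; ring

lemma pr_QD (v : Fin 4 → ℤ) : pr QD (sq v) = qD v := by
  rw [pr_sq]; simp [QD, qD, dotProduct, mulVec, Fin.sum_univ_four]; ring

lemma isSymm_QA : QA.IsSymm := by rw [IsSymm]; decide +kernel

lemma isSymm_QD : QD.IsSymm := by rw [IsSymm]; decide +kernel

lemma even_qA (v : Fin 4 → ℤ) : ∃ k, qA v = 2 * k :=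
  ⟨v 0 * v 0 + v 1 * v 1 + v 2 * v 2 + v 3 * v 3 + v 0 * v 1 + v 0 * v 2 + v 0 * v 3 + v 1 * v 2 +
    v 1 * v 3 + v 2 * v 3, by rw [qA]; ring⟩

lemma even_qD (v : Fin 4 → ℤ) : ∃ k, qD v = 2 * k :=
  ⟨v 0 * v 0 + v 1 * v 1 + v 2 * v 2 + v 3 * v 3 + v 0 * v 2 + v 0 * v 3 + v 1 * v 2 +
    v 1 * v 3 + v 2 * v 3, by rw [qD]; ring⟩

lemma sq_le_qA (v : Fin 4 → ℤ) (i : Fin 4) : v i * v i ≤ qA v := by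
  rw [qA]
  fin_cases i <;> simp only [Fin.reduceFinMk, Fin.zero_eta, Fin.mk_one] <;>
    nlinarith [mul_self_nonneg (v 0), mul_self_nonneg (v 1), mul_self_nonneg (v 2),
      mul_self_nonneg (v 3), mul_self_nonneg (v 0 + v 1 + v 2 + v 3)]

lemma sq_le_qD (v : Fin 4 → ℤ) (i : Fin 4) : v i * v i ≤ qD v := by
  rw [qD]
  fin_cases i <;> simp only [Fin.reduceFinMk, Fin.zero_eta, Fin.mk_one]
  · nlinarith [mul_self_nonneg (v 0 + v 2 + v 3), mul_self_nonneg (v 1 + v 2),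
      mul_self_nonneg (v 1 + v 3)]
  · nlinarith [mul_self_nonneg (v 1 + v 2 + v 3), mul_self_nonneg (v 0 + v 2),
      mul_self_nonneg (v 0 + v 3)]
  · nlinarith [mul_self_nonneg (v 0 - v 1), mul_self_nonneg (v 3),
      mul_self_nonneg (v 0 + v 1 + v 2 + v 3)]
  · nlinarith [mul_self_nonneg (v 0 - v 1), mul_self_nonneg (v 2),
      mul_self_nonneg (v 0 + v 1 + v 2 + v 3)]

lemma two_le_of_even {q : (Fin 4 → ℤ) → ℤ} (he : ∀ v, ∃ k, q v = 2 * k)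
    (hs : ∀ v i, v i * v i ≤ q v) {v : Fin 4 → ℤ} (hv : v ≠ 0) : 2 ≤ q v := by
  obtain ⟨i, hi⟩ := Function.ne_iff.1 hv
  have h1 : 0 < v i * v i := lt_of_le_of_ne (mul_self_nonneg _) fun h =>
    hi (by simpa using h.symm)
  have := hs v i
  obtain ⟨k, hk⟩ := he v
  omega

lemma abs_le_of_sq_le {a B : ℤ} (h : a * a ≤ B) : -B ≤ a ∧ a ≤ B :=
  ⟨by nlinarith [Int.le_self_sq (-a)], by nlinarith [Int.le_self_sq a]⟩

lemma finite_of_sq_le {q : (Fin 4 → ℤ) → ℤ} (hs : ∀ v i, v i * v i ≤ q v) (B : ℤ) :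
    {v | q v ≤ B}.Finite :=
  (Set.Finite.pi fun _ : Fin 4 => Set.finite_Icc (-B) B).subset fun v hv i _ =>
    abs_le_of_sq_le ((hs v i).trans hv)

/-- The vector with entries `c - 1`. -/
def shift (c : Fin 4 → Fin 3) : Fin 4 → ℤ := fun i => (c i : ℕ) - 1

lemma exists_shift {v : Fin 4 → ℤ} (h : ∀ i, v i * v i ≤ 2) : ∃ c, v = shift c := by
  have h1 : ∀ i, ∃ c : Fin 3, v i = (c : ℕ) - 1 := fun i => by
    have := h i
    have h2 : -1 ≤ v i := by nlinarith
    have h3 : v i ≤ 1 := by nlinarith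
    refine ⟨⟨(v i + 1).toNat, by omega⟩, ?_⟩
    simp only
    omega
  choose c hc using h1
  exact ⟨c, funext hc⟩

lemma sq_neg (v : Fin 4 → ℤ) : sq (-v) = sq v := by
  rw [sq, sq, neg_vecMulVec, vecMulVec_neg, neg_neg]

/-- The entries of a matrix packed into a number, three bits each. -/
def ent (n i j : ℕ) : ℤ := (n / 8 ^ (4 * i + j) % 8 : ℕ) - 3

/-- The matrix packed into a number. -/
def mat (n : ℕ) : S := of fun i j => ent n i j

/-- The determinant of a four by four matrix, expanded. -/
def det4 (M : Fin 4 → Fin 4 → ℤ) : ℤ :=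
  (M 0 0 * M 1 1 - M 0 1 * M 1 0) * (M 2 2 * M 3 3 - M 2 3 * M 3 2) -
  (M 0 0 * M 1 2 - M 0 2 * M 1 0) * (M 2 1 * M 3 3 - M 2 3 * M 3 1) +
  (M 0 0 * M 1 3 - M 0 3 * M 1 0) * (M 2 1 * M 3 2 - M 2 2 * M 3 1) +
  (M 0 1 * M 1 2 - M 0 2 * M 1 1) * (M 2 0 * M 3 3 - M 2 3 * M 3 0) -
  (M 0 1 * M 1 3 - M 0 3 * M 1 1) * (M 2 0 * M 3 2 - M 2 2 * M 3 0) +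
  (M 0 2 * M 1 3 - M 0 3 * M 1 2) * (M 2 0 * M 3 1 - M 2 1 * M 3 0)

lemma det_eq_det4 (M : S) : M.det = det4 M := by
  rw [det_succ_row_zero]
  simp only [Fin.sum_univ_four, det_fin_three, submatrix_apply, det4]
  simp [Fin.succAbove]
  ring

/-- The minimal vectors of `QA`. -/
def vA : Fin 10 → Fin 4 → ℤ :=
  ![![1, 0, 0, 0], ![0, 1, 0, 0], ![0, 0, 1, 0], ![0, 0, 0, 1], ![1, -1, 0, 0], ![1, 0, -1, 0],
    ![1, 0, 0, -1], ![0, 1, -1, 0], ![0, 1, 0, -1], ![0, 0, 1, -1]]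

/-- The minimal vectors of `QD`, in three orthogonal frames. -/
def vD : Fin 3 → Fin 4 → Fin 4 → ℤ :=
  ![![![0, 0, 0, 1], ![0, 1, -1, 0], ![1, 0, -1, 0], ![1, 1, 0, -1]],
    ![![0, 0, 1, -1], ![0, 1, 0, 0], ![1, 0, 0, 0], ![1, 1, -1, -1]],
    ![![0, 0, 1, 0], ![0, 1, 0, -1], ![1, 0, 0, -1], ![1, 1, -1, 0]]]

/-- The minimal squares of `QA`. -/
def IA : Finset S := Finset.univ.image fun k => sq (vA k)

/-- The frames of `QD`. -/
def FD (i : Fin 3) : Finset S := Finset.univ.image fun j => sq (vD i j)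

/-- The minimal squares of `QD`. -/
def ID : Finset S := Finset.univ.biUnion FD

/-- The frames of `QA`, two of which are degenerate. -/
def FA : Fin 3 → Finset S := ![IA, {∑ x ∈ IA, x}, {∑ x ∈ IA, x}]

/-- The forms equivalent to `QA` or `QD`. -/
def IsV (Q : S) : Prop := ∃ M : S, M.det = 1 ∧ (Q = Mᵀ * QA * M ∨ Q = Mᵀ * QD * M)

lemma isV_dual (g : G4) (Q : S) (h : IsV Q) : IsV (dual g Q) := by
  obtain ⟨M, hM, h⟩ := h
  refine ⟨M * (g⁻¹).1, by rw [det_mul, hM, (g⁻¹).2, one_mul], h.imp ?_ ?_⟩ <;>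
  · rintro rfl
    simp only [dual, transpose_mul, Matrix.mul_assoc]

lemma pr_conj (M Q : S) (v : Fin 4 → ℤ) : pr (Mᵀ * Q * M) (sq v) = pr Q (sq (M *ᵥ v)) := by
  rw [pr_sq, pr_sq, Matrix.mul_assoc, ← mulVec_mulVec, ← mulVec_mulVec, dotProduct_mulVec,
    vecMul_transpose]

lemma isSymm_conj_transpose (M : S) {Q : S} (h : Q.IsSymm) : (Mᵀ * Q * M).IsSymm := by
  rw [IsSymm, transpose_mul, transpose_mul, transpose_transpose, h.eq, Matrix.mul_assoc]

/-- Multiplication of a vector by a packed matrix. -/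
def lmul (n : ℕ) (v : Fin 4 → ℤ) (i : Fin 4) : ℤ :=
  ent n i 0 * v 0 + ent n i 1 * v 1 + ent n i 2 * v 2 + ent n i 3 * v 3

lemma mat_mulVec (n : ℕ) (v : Fin 4 → ℤ) : mat n *ᵥ v = lmul n v := by
  funext i
  simp [mulVec, dotProduct, Fin.sum_univ_four, mat, lmul]

/-- For each minimal vector of `QA`, a matrix carrying a standard form to the neighbour. -/
def tabA : List ℕ :=
  [84819607144667, 121251816093915, 160831819068635, 160824302352603, 125089103100123,
   156433772557531, 125639930263771, 156434846299355, 125648520198363, 125639932360923]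

/-- For each transversal of `QD`, a matrix carrying a standard form to the neighbour. -/
def tabD : List ℕ :=
  [196016189060315, 155886430271707, 125089103100123, 160824302352603, 160284481041555,
   155345266554075, 120160896562395, 155895022367955, 85377953186963, 80431358788827,
   45246986438875, 120553735341267, 160823230969627, 160273473091803, 120710648117467,
   160824302352603, 160274547095195, 120151231019227, 120159818594075, 125107622983323,
   124550353139355, 160282060863203, 125098762254563, 120159820723995, 80431356692123,
   116156760147683, 120553732917475, 84829402941083, 160283402778395, 120151231019227,
   84966861027547, 160274546833051, 155886430009115, 120152306595483, 120160894170331,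
   155876500584091, 120152306890395, 155875426514723, 120692127906083, 120152306628251,
   80432430171803, 80980977993507, 85377950763299, 80431358527259, 160273473353371,
   155345264162011, 120160894170331, 155885356267291, 160831819068635, 125097690937563,
   120702058182875, 125639932360923, 125099035473555, 120151231051995, 120160894465243,
   120709576799955, 80980980418195, 80422768593115, 80431356430555, 116156762572499,
   160831819068635, 120702060280027, 125089101002971, 160832890451611]

lemma tabA_spec : ∀ k : Fin 10, det4 (mat (tabA.getD k 0)) = 1 ∧
    ((∀ j, qA (lmul (tabA.getD k 0) (vA j)) = 2 + if j = k then 2 else 0) ∨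
      ∀ j, qD (lmul (tabA.getD k 0) (vA j)) = 2 + if j = k then 2 else 0) := by
  decide +kernel

/-- The entry of the table attached to a transversal. -/
def rowD (τ : Fin 3 → Fin 4) : ℕ := tabD.getD (16 * (τ 0).1 + 4 * (τ 1).1 + (τ 2).1) 0

lemma tabD_spec : ∀ τ : Fin 3 → Fin 4, det4 (mat (rowD τ)) = 1 ∧
    ((∀ i j, qA (lmul (rowD τ) (vD i j)) = 2 + if j = τ i then 2 else 0) ∨
      ∀ i j, qD (lmul (rowD τ) (vD i j)) = 2 + if j = τ i then 2 else 0) := by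
  decide +kernel

lemma mem_IA (x : S) : x ∈ IA ↔ (∃ v, x = sq v) ∧ pr QA x = 2 := by
  constructor
  · intro hx
    obtain ⟨k, -, rfl⟩ := Finset.mem_image.1 hx
    refine ⟨⟨_, rfl⟩, ?_⟩
    rw [pr_QA]
    revert k
    decide +kernel
  · rintro ⟨⟨v, rfl⟩, h⟩
    rw [pr_QA] at h
    obtain ⟨c, rfl⟩ := exists_shift fun i => (sq_le_qA v i).trans h.le
    have : ∀ c, qA (shift c) = 2 → ∃ k, shift c = vA k ∨ shift c = -vA k := by decide +kernel
    obtain ⟨k, hk | hk⟩ := this c h <;> rw [hk]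
    · exact Finset.mem_image_of_mem _ (Finset.mem_univ k)
    · rw [sq_neg]
      exact Finset.mem_image_of_mem _ (Finset.mem_univ k)

lemma mem_FD {i : Fin 3} {x : S} : x ∈ FD i ↔ ∃ j, sq (vD i j) = x := by simp [FD]

lemma mem_ID {x : S} : x ∈ ID ↔ ∃ i j, sq (vD i j) = x := by simp [ID, mem_FD]

lemma qD_vD : ∀ i j, qD (vD i j) = 2 := by decide +kernel

lemma qA_vA : ∀ j, qA (vA j) = 2 := by decide +kernel

lemma mem_ID_iff (x : S) : x ∈ ID ↔ (∃ v, x = sq v) ∧ pr QD x = 2 := by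
  rw [mem_ID]
  constructor
  · rintro ⟨i, j, rfl⟩
    exact ⟨⟨_, rfl⟩, by rw [pr_QD, qD_vD]⟩
  · rintro ⟨⟨v, rfl⟩, h⟩
    rw [pr_QD] at h
    obtain ⟨c, rfl⟩ := exists_shift fun i => (sq_le_qD v i).trans h.le
    have : ∀ c, qD (shift c) = 2 → ∃ i j, shift c = vD i j ∨ shift c = -vD i j := by
      decide +kernel
    obtain ⟨i, j, hk | hk⟩ := this c h <;> rw [hk]
    · exact ⟨i, j, rfl⟩
    · exact ⟨i, j, (sq_neg _).symm⟩

lemma vD_inj : ∀ i j i' j', sq (vD i j) = sq (vD i' j') → i = i' ∧ j = j' := by decide +kernel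

lemma vA_inj : ∀ j j', sq (vA j) = sq (vA j') → j = j' := by decide +kernel

lemma sum_IA_notMem : ∑ x ∈ IA, x ∉ IA := by decide +kernel

lemma pr_sq_expand (E : S) (v : Fin 4 → ℤ) : pr E (sq v) =
    ∑ i, ∑ j, v i * E i j * v j := by
  rw [pr_sq]
  simp only [dotProduct, mulVec, Finset.mul_sum, mul_assoc]

lemma perfect_QA (E : S) (hE : E.IsSymm) (h : ∀ x ∈ IA, pr E x = 0) : E = 0 := by
  have h1 : ∀ k, pr E (sq (vA k)) = 0 := fun k =>
    h _ (Finset.mem_image_of_mem _ (Finset.mem_univ k))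
  simp only [pr_sq_expand, Fin.forall_fin_succ, vA, Fin.sum_univ_four] at h1
  simp at h1
  ext i j
  have h01 := hE.apply 0 1
  have h02 := hE.apply 0 2
  have h03 := hE.apply 0 3
  have h12 := hE.apply 1 2
  have h13 := hE.apply 1 3
  have h23 := hE.apply 2 3
  fin_cases i <;> fin_cases j <;>
    simp only [Fin.reduceFinMk, Fin.zero_eta, Fin.mk_one, Matrix.zero_apply] <;> omega

lemma perfect_QD (E : S) (hE : E.IsSymm) (h : ∀ x ∈ ID, pr E x = 0) : E = 0 := by
  have h1 : ∀ i j, pr E (sq (vD i j)) = 0 := fun i j => h _ (mem_ID.2 ⟨i, j, rfl⟩)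
  simp only [pr_sq_expand, Fin.forall_fin_succ, vD, Fin.sum_univ_four] at h1
  simp at h1
  ext i j
  have h01 := hE.apply 0 1
  have h02 := hE.apply 0 2
  have h03 := hE.apply 0 3
  have h12 := hE.apply 1 2
  have h13 := hE.apply 1 3
  have h23 := hE.apply 2 3
  fin_cases i <;> fin_cases j <;>
    simp only [Fin.reduceFinMk, Fin.zero_eta, Fin.mk_one, Matrix.zero_apply] <;> omega

lemma perf_QA : Perf IsV QA IA FA where
  symm := isSymm_QA
  two_le v hv := by rw [pr_QA]; exact two_le_of_even even_qA sq_le_qA hv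
  mem_I := mem_IA
  mem_F x hx := ⟨0, hx⟩
  mem_inc i x hx := by
    fin_cases i
    · exact Or.inl hx
    all_goals
      right
      rw [Finset.mem_singleton.1 hx]
      rfl
  disj i j x hx hx' := by
    fin_cases i <;> fin_cases j <;> first | exact Or.inl rfl | skip
    · exact (sum_IA_notMem (Finset.mem_singleton.1 hx' ▸ hx)).elim
    · exact (sum_IA_notMem (Finset.mem_singleton.1 hx' ▸ hx)).elim
    all_goals
      right
      rw [Finset.mem_singleton.1 hx]
      rfl
  card t ht := by
    have h0 : t 0 ∈ IA := ht 0
    have h1 : t 1 = ∑ x ∈ IA, x := Finset.mem_singleton.1 (ht 1)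
    have h2 : t 2 = ∑ x ∈ IA, x := Finset.mem_singleton.1 (ht 2)
    have h3 : (IA.filter fun x => ∀ i, x ≠ t i) = IA.erase (t 0) := by
      ext x
      rw [Finset.mem_filter, Finset.mem_erase, and_comm]
      refine and_congr_left fun hx => ⟨fun h => h 0, fun h i => ?_⟩
      fin_cases i
      · exact h
      · rintro rfl; exact sum_IA_notMem (h1 ▸ hx)
      · rintro rfl; exact sum_IA_notMem (h2 ▸ hx)
    rw [h3, Finset.card_erase_of_mem h0]
    decide +kernel
  sum := ⟨1, one_pos, fun i => by
    fin_cases i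
    · exact one_smul _ _
    all_goals
      rw [one_smul]
      exact Finset.sum_singleton _ _⟩
  ne i := by
    fin_cases i
    · exact ⟨_, Finset.mem_image_of_mem _ (Finset.mem_univ 0)⟩
    all_goals exact Finset.singleton_nonempty _
  perfect := perfect_QA
  edge t ht := by
    obtain ⟨k, -, hk⟩ := Finset.mem_image.1 (show t 0 ∈ IA from ht 0)
    have key : ∀ e : S, e.IsSymm → (∀ j, pr e (sq (vA j)) = if j = k then 2 else 0) →
        IsEdge FA t e := by
      intro e hs he
      have h0 : ∀ w ∈ IA, pr e w = if w = t 0 then 2 else 0 := by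
        intro w hw
        obtain ⟨j, -, rfl⟩ := Finset.mem_image.1 hw
        rw [he, ← hk]
        exact if_congr ⟨fun h => by rw [h], vA_inj j k⟩ rfl rfl
      have h1 : pr e (∑ x ∈ IA, x) = 2 := by
        rw [pr_sum_right, Finset.sum_congr rfl h0, Finset.sum_ite_eq' IA,
          if_pos (show t 0 ∈ IA from ht 0)]
      refine ⟨hs, fun i w hw => ?_⟩
      fin_cases i
      · exact h0 w hw
      · exact (congrArg (pr e) (Finset.mem_singleton.1 hw)).trans (h1.trans (if_pos
          ((Finset.mem_singleton.1 hw).trans (Finset.mem_singleton.1 (ht 1)).symm)).symm)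
      · exact (congrArg (pr e) (Finset.mem_singleton.1 hw)).trans (h1.trans (if_pos
          ((Finset.mem_singleton.1 hw).trans (Finset.mem_singleton.1 (ht 2)).symm)).symm)
    obtain ⟨hd, hq | hq⟩ := tabA_spec k
    · refine ⟨_, key ((mat (tabA.getD k 0))ᵀ * QA * mat (tabA.getD k 0) - QA)
        ((isSymm_conj_transpose _ isSymm_QA).sub isSymm_QA) fun j => ?_,
        mat (tabA.getD k 0), by rw [det_eq_det4, hd], Or.inl (add_sub_cancel _ _)⟩
      rw [pr_sub_left, pr_conj, pr_QA, pr_QA, mat_mulVec, hq, qA_vA]; ring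
    · refine ⟨_, key ((mat (tabA.getD k 0))ᵀ * QD * mat (tabA.getD k 0) - QA)
        ((isSymm_conj_transpose _ isSymm_QD).sub isSymm_QA) fun j => ?_,
        mat (tabA.getD k 0), by rw [det_eq_det4, hd], Or.inr (add_sub_cancel _ _)⟩
      rw [pr_sub_left, pr_conj, pr_QD, pr_QA, mat_mulVec, hq, qA_vA]; ring
  fin B := by simp only [pr_QA]; exact finite_of_sq_le sq_le_qA B

lemma card_ID : ∀ τ : Fin 3 → Fin 4,
    (ID.filter fun x => ∀ i, x ≠ sq (vD i (τ i))).card = 9 := by decide +kernel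

lemma sum_FD : ∀ i, (3 : ℤ) • ∑ x ∈ FD i, x = ∑ x ∈ ID, x := by decide +kernel

lemma perf_QD : Perf IsV QD ID FD where
  symm := isSymm_QD
  two_le v hv := by rw [pr_QD]; exact two_le_of_even even_qD sq_le_qD hv
  mem_I := mem_ID_iff
  mem_F x hx := by simpa only [mem_ID, mem_FD] using hx
  mem_inc i x hx := Or.inl (mem_ID.2 ⟨i, mem_FD.1 hx⟩)
  disj i j x hx hx' := by
    obtain ⟨a, rfl⟩ := mem_FD.1 hx
    obtain ⟨b, hb⟩ := mem_FD.1 hx'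
    exact Or.inl (vD_inj _ _ _ _ hb).1.symm
  card t ht := by
    choose τ hτ using fun i => mem_FD.1 (ht i)
    rw [← card_ID τ]
    simp only [hτ]
  sum := ⟨3, by norm_num, sum_FD⟩
  ne i := ⟨_, mem_FD.2 ⟨0, rfl⟩⟩
  perfect := perfect_QD
  edge t ht := by
    choose τ hτ using fun i => mem_FD.1 (ht i)
    have key : ∀ e : S, e.IsSymm →
        (∀ i j, pr e (sq (vD i j)) = if j = τ i then 2 else 0) → IsEdge FD t e := by
      refine fun e hs he => ⟨hs, fun i w hw => ?_⟩
      obtain ⟨j, rfl⟩ := mem_FD.1 hw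
      rw [he, ← hτ]
      exact if_congr ⟨fun h => by rw [h], fun h => (vD_inj _ _ _ _ h).2⟩ rfl rfl
    obtain ⟨hd, hq | hq⟩ := tabD_spec τ
    · refine ⟨_, key ((mat (rowD τ))ᵀ * QA * mat (rowD τ) - QD)
        ((isSymm_conj_transpose _ isSymm_QA).sub isSymm_QD) fun i j => ?_,
        mat (rowD τ), by rw [det_eq_det4, hd], Or.inl (add_sub_cancel _ _)⟩
      rw [pr_sub_left, pr_conj, pr_QA, pr_QD, mat_mulVec, hq, qD_vD]; ring
    · refine ⟨_, key ((mat (rowD τ))ᵀ * QD * mat (rowD τ) - QD)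
        ((isSymm_conj_transpose _ isSymm_QD).sub isSymm_QD) fun i j => ?_,
        mat (rowD τ), by rw [det_eq_det4, hd], Or.inr (add_sub_cancel _ _)⟩
      rw [pr_sub_left, pr_conj, pr_QD, pr_QD, mat_mulVec, hq, qD_vD]; ring
  fin B := by simp only [pr_QD]; exact finite_of_sq_le sq_le_qD B

end SymForm

/-! ### The symmetric complex of perfect forms in rank four -/

namespace SymForm

open Matrix

/-- A matrix of determinant one as an element of the group. -/
def toG (M : S) (hM : M.det = 1) : G4 := ⟨M, hM⟩

lemma dual_toG_inv (M : S) (hM : M.det = 1) (Q : S) : dual (toG M hM)⁻¹ Q = Mᵀ * Q * M := by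
  rw [dual, inv_inv]; rfl

lemma exists_perf (Q : S) (h : IsV Q) : ∃ I F, Perf IsV Q I F := by
  classical
  obtain ⟨M, hM, rfl | rfl⟩ := h
  · have := perf_QA.smul (toG M hM)⁻¹ (isV_dual _)
    rw [dual_toG_inv] at this
    exact ⟨_, _, this⟩
  · have := perf_QD.smul (toG M hM)⁻¹ (isV_dual _)
    rw [dual_toG_inv] at this
    exact ⟨_, _, this⟩

/-- The perfect forms of rank four and minimum two. -/
abbrev V := {Q // IsV Q}

open Classical in
/-- The framed perfect forms of rank four. -/
noncomputable def std : Sys IsV where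
  I Q := (exists_perf Q.1 Q.2).choose
  F Q := (exists_perf Q.1 Q.2).choose_spec.choose
  e Q t := if h : Trans (exists_perf Q.1 Q.2).choose_spec.choose t then
    ((exists_perf Q.1 Q.2).choose_spec.choose_spec.edge t h).choose else 0
  perf Q := (exists_perf Q.1 Q.2).choose_spec.choose_spec
  isEdge Q t h := by
    rw [dif_pos h]
    exact ((exists_perf Q.1 Q.2).choose_spec.choose_spec.edge t h).choose_spec.1
  prop Q t h := by
    rw [dif_pos h]
    exact ((exists_perf Q.1 Q.2).choose_spec.choose_spec.edge t h).choose_spec.2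

/-- The trace of a form followed by its entries. -/
def ord : S →+ ℤ ×ₗ Lex (Fin 4 → Lex (Fin 4 → ℤ)) where
  toFun x := toLex (x.trace, toLex fun i => toLex fun j => x i j)
  map_zero' := by rw [trace_zero]; rfl
  map_add' x y := by rw [trace_add]; rfl

lemma ord_injective : Function.Injective ord := by
  intro x y h
  ext i j
  exact congrFun (congrArg ofLex (congrFun (congrArg (fun z => ofLex (ofLex z).2) h) i)) j

lemma ord_sq_pos (u : Fin 4 → ℤ) (hu : u ≠ 0) : 0 < ord (sq u) := by
  refine Prod.Lex.toLex_lt_toLex.2 (Or.inl ?_)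
  change 0 < (sq u).trace
  rw [sq, trace_vecMulVec]
  exact lt_of_le_of_ne (Finset.sum_nonneg fun i _ => mul_self_nonneg _)
    fun h => hu (dotProduct_self_eq_zero.1 h.symm)

noncomputable instance : LinearOrder V :=
  LinearOrder.lift' (fun Q => ord Q.1) fun _ _ h => Subtype.ext (ord_injective h)

lemma le_iff_ord (Q T : V) : Q ≤ T ↔ ord Q.1 ≤ ord T.1 := Iff.rfl

lemma trace_le {Q T : V} (h : Q ≤ T) : Q.1.trace ≤ T.1.trace := by
  rcases Prod.Lex.toLex_le_toLex.1 ((le_iff_ord Q T).1 h) with h | h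
  · exact h.le
  · exact h.1.le

lemma pr_sq_basis (Q : S) (i j : Fin 4) (c : ℤ) (hQ : Q.IsSymm) :
    pr Q (sq (Pi.single i 1 + c • Pi.single j 1)) = Q i i + 2 * c * Q i j + c * c * Q j j := by
  rw [pr_sq, mulVec_add, mulVec_smul, dotProduct_add, add_dotProduct, add_dotProduct,
    dotProduct_smul, dotProduct_smul, smul_dotProduct, smul_dotProduct]
  simp only [mulVec_single_one, single_one_dotProduct, smul_eq_mul, col_apply, hQ.apply i j]
  ring

lemma abs_entry_le (Q : V) (B : ℤ) (h : Q.1.trace ≤ B) (i j : Fin 4) : |Q.1 i j| ≤ B := by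
  have hp := std.perf Q
  have hd : ∀ k, 0 ≤ Q.1 k k := fun k => by
    have h1 := hp.two_le (Pi.single k 1) (by simp)
    have h2 := pr_sq_basis Q.1 k k 0 hp.symm
    simp only [zero_smul, add_zero] at h2
    linarith
  have ht : ∀ k, Q.1 k k ≤ B := fun k =>
    (Finset.single_le_sum (fun k _ => hd k) (Finset.mem_univ k)).trans h
  by_cases hij : i = j
  · subst hij
    rw [abs_of_nonneg (hd i)]
    exact ht i
  have hne : ∀ c : ℤ, (Pi.single i 1 + c • Pi.single j 1 : Fin 4 → ℤ) ≠ 0 := fun c h0 => by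
    have := congrFun h0 i
    simp [Pi.single_apply, hij] at this
  have h1 := hp.two_le _ (hne 1)
  have h2 := hp.two_le _ (hne (-1))
  rw [pr_sq_basis _ _ _ _ hp.symm] at h1 h2
  rw [abs_le]
  constructor <;> linarith [ht i, ht j]

lemma finite_trace_le (B : ℤ) : {Q : V | Q.1.trace ≤ B}.Finite := by
  have h1 : {M : S | ∀ i j, M i j ∈ Set.Icc (-B) B}.Finite :=
    Set.Finite.pi' fun _ => Set.Finite.pi' fun _ => Set.finite_Icc _ _
  refine (h1.preimage (f := Subtype.val) Subtype.val_injective.injOn).subset fun Q hQ i j => ?_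
  exact abs_le.1 (abs_entry_le Q B hQ i j)

lemma finite_Iio (Q : V) : (Set.Iio Q).Finite :=
  (finite_trace_le Q.1.trace).subset fun _ hT => trace_le (le_of_lt hT)

instance : WellFoundedLT V where
  wf := Subrelation.wf (r := InvImage (· < ·) fun Q : V => (Set.Iio Q).ncard)
    (fun {Q T} h => Set.ncard_lt_ncard ⟨Set.Iio_subset_Iio h.le, fun h' =>
      lt_irrefl Q (h' h)⟩ (finite_Iio T)) (InvImage.wf _ wellFounded_lt)

instance : Nonempty V := ⟨⟨QA, 1, det_one, Or.inl (by simp)⟩⟩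

instance : MulAction G4 V := formAction IsV isV_dual

lemma act_val (g : G4) (Q : V) : (g • Q).1 = dual g Q.1 := rfl

lemma pr_sq_left (u : Fin 4 → ℤ) (x : S) : pr (sq u) x = pr x (sq u) := trace_mul_comm _ _

lemma span_smul (g : G4) {l : List S} (h : Sys.Span l) : Sys.Span (l.map (g • ·)) := by
  intro u hu
  have h1 : g.1ᵀ *ᵥ u = 0 := by
    refine h _ fun x hx => ?_
    have h2 := hu _ (List.mem_map_of_mem hx)
    rw [pr_sq_left, smul_def] at h2
    have h3 := pr_conj g.1ᵀ x u
    rw [transpose_transpose, h2] at h3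
    rw [pr_sq_left, ← h3]
  have h2 := congrArg (fun v => (g⁻¹).1ᵀ *ᵥ v) h1
  simpa only [mulVec_mulVec, ← transpose_mul, val_mul_inv, transpose_one, one_mulVec,
    mulVec_zero] using h2

/-- The frame data of perfect forms of rank four. -/
noncomputable abbrev dat : FrameData S V := std.data ord

lemma dat_laws : dat.Laws := std.laws ord le_iff_ord ord_injective ord_sq_pos

lemma dat_cell_iff {l : List S} : dat.Cell l ↔ (∃ Q, std.Face Q l) ∧ Sys.Span l :=
  Sys.cell_iff ord le_iff_ord ord_injective ord_sq_pos

/-- The last row of a matrix modulo `N`. -/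
def row (N : ℕ) (g : G4) (j : Fin 4) : ZMod N := (g.1 3 j : ℤ)

lemma mem_Gamma0_iff {N : ℕ} {g : G4} : g ∈ Gamma0 N ↔ ∀ j : Fin 4, j ≠ 3 → row N g j = 0 :=
  forall₂_congr fun _ _ => (ZMod.intCast_zmod_eq_zero_iff_dvd _ _).symm

lemma row_mul (N : ℕ) (g h : G4) (j : Fin 4) :
    row N (g * h) j = ∑ k, row N g k * (h.1 k j : ℤ) := by
  simp [row, val_mul, mul_apply]

lemma mul_inv_mem_Gamma0 {N : ℕ} {g h : G4} (H : row N g = row N h) : g * h⁻¹ ∈ Gamma0 N := by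
  rw [mem_Gamma0_iff]
  intro j hj
  rw [row_mul, H, ← row_mul, mul_inv_cancel]
  simp [row, hj.symm]

lemma exists_symmetry (N : ℕ) [NeZero N] : ∃ U : Finset V, dat.Symmetry (Gamma0 N) U := by
  classical
  let c : Bool → V := fun b => ⟨bif b then QA else QD, 1, det_one, by cases b <;> simp⟩
  refine ⟨Finset.univ.image fun p : (Fin 4 → ZMod N) × Bool =>
    Function.invFun (row N) p.1 • c p.2, ⟨?_, ?_, ?_, ?_, ?_⟩⟩
  · intro g l h
    rw [dat_cell_iff] at h ⊢
    obtain ⟨⟨Q, hQ⟩, hs⟩ := h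
    exact ⟨⟨g.1 • Q, std.face_smul act_val g.1 Q hQ⟩, span_smul g.1 hs⟩
  · exact fun g Q x hx => (std.mem_I_smul act_val g.1 Q x).2 hx
  · exact fun g Q l => std.o_smul act_val ord g.1 Q l
  · intro Q Q'
    exact (std.finite_smul_eq act_val Q Q').preimage Subtype.val_injective.injOn
  · intro Q
    obtain ⟨g, b, hg⟩ : ∃ g : G4, ∃ b, Q = g • c b := by
      obtain ⟨M, hM, h | h⟩ := Q.2
      · exact ⟨(toG M hM)⁻¹, true, Subtype.ext (h.trans (dual_toG_inv M hM _).symm)⟩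
      · exact ⟨(toG M hM)⁻¹, false, Subtype.ext (h.trans (dual_toG_inv M hM _).symm)⟩
    refine ⟨⟨_, mul_inv_mem_Gamma0 (Function.invFun_eq (f := row N) ⟨g, rfl⟩)⟩, ?_⟩
    refine Finset.mem_image.2 ⟨(row N g, b), Finset.mem_univ _, ?_⟩
    rw [hg, Subgroup.smul_def]
    simp [smul_smul]

end SymForm

namespace ModEleven

/-- The relations satisfied by the values of an invariant cocycle on triangle cells, as a function
of the last coordinates of a basis. -/
structure Rel (F : ZMod 11 → ZMod 11 → ZMod 11 → ZMod 11 → ℂ) : Prop where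
  neg : ∀ a b c d, F (-a) (-b) c d = F a b c d
  flip : ∀ a b c d, F a b d (-c) = -F a b c d
  swap : ∀ a b c d, F b a (-c) d = -F a b c d
  rot : ∀ a b c d, F a (-a - b) (-c) d = -F a b c d
  dbl : ∀ a b c d, F (2 * a) (2 * b) (2 * c) (2 * d) = F a b c d
  two : ∀ a b c d, F c d (-b) (a + b) - F c d a (a + b) - F a b (-d) (c + d) + F a b c (c + d)
    + F c d a b - F a b c d = 0
  four : ∀ a b c d, -F (a + b) c (-b) d + F (a + b) c a d + F a b (-d) (a + b + c) + F a b c d =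
    -F (b + c) a (-c) d + F (b + c) a b d + F b c (-d) (b + c + a) + F b c a d

/-- Base-11 code of a row. -/
def key (a b c d : ℕ) : ℕ := ((a % 11 * 11 + b % 11) * 11 + c % 11) * 11 + d % 11

/-- Candidate representatives of a row; the parity records a sign. -/
def cands (s a b c d : ℕ) : ℕ :=
  let t := 10 * (a + b)
  min (2 * key a b c d + s % 2) <| min (2 * key b t c d + s % 2) <|
  min (2 * key t a c d + s % 2) <| min (2 * key (10 * a) (10 * b) c d + s % 2) <|
  min (2 * key (10 * b) (10 * t) c d + s % 2) (2 * key (10 * t) (10 * a) c d + s % 2)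

def sortCD (s a b c d : ℕ) : ℕ := if d < c then cands s b a d c else cands s a b c d

def absD (s a b c d : ℕ) : ℕ :=
  if 5 < d then sortCD (s + 1) b a c (10 * d % 11) else sortCD s a b c d

def absC (s a b c d : ℕ) : ℕ :=
  if 5 < c then absD (s + 1) b a (10 * c % 11) d else absD s a b c d

def scaled (l a b c d : ℕ) : ℕ := absC 0 (l * a) (l * b) (l * c % 11) (l * d % 11)

/-- A signed representative of the orbit of a row. -/
def norm (a b c d : ℕ) : ℕ :=
  min (scaled 1 a b c d) <| min (scaled 2 a b c d) <| min (scaled 3 a b c d) <|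
  min (scaled 4 a b c d) (scaled 5 a b c d)

section
variable (F : ZMod 11 → ZMod 11 → ZMod 11 → ZMod 11 → ℂ)

/-- The value at a coded row. -/
def valK (k : ℕ) : ℂ := F (k / 1331 : ℕ) (k / 121 % 11 : ℕ) (k / 11 % 11 : ℕ) (k % 11 : ℕ)

/-- The value at a signed coded row. -/
def valS (n : ℕ) : ℂ := (-1) ^ n * valK F (n / 2)

lemma valK_key (a b c d : ℕ) : valK F (key a b c d) = F a b c d := by
  have h1 : key a b c d / 1331 = a % 11 := by unfold key; omega
  have h2 : key a b c d / 121 % 11 = b % 11 := by unfold key; omega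
  have h3 : key a b c d / 11 % 11 = c % 11 := by unfold key; omega
  have h4 : key a b c d % 11 = d % 11 := by unfold key; omega
  rw [valK, h1, h2, h3, h4]
  simp only [ZMod.natCast_mod]

lemma valS_key (s a b c d : ℕ) : valS F (2 * key a b c d + s % 2) = (-1) ^ s * F a b c d := by
  have h : (2 * key a b c d + s % 2) / 2 = key a b c d := by omega
  rw [valS, h, valK_key, pow_add, pow_mul, neg_one_sq, one_pow, one_mul,
    ← neg_one_pow_eq_pow_mod_two]

lemma valS_min {m n : ℕ} {z : ℂ} (hm : valS F m = z) (hn : valS F n = z) :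
    valS F (min m n) = z := by
  rcases min_choice m n with h | h <;> rw [h] <;> assumption

end

lemma cast_ten_mul (a : ℕ) : ((10 * a : ℕ) : ZMod 11) = -(a : ZMod 11) := by
  rw [Nat.cast_mul, show ((10 : ℕ) : ZMod 11) = -1 from by decide, neg_one_mul]

namespace Rel

variable {F : ZMod 11 → ZMod 11 → ZMod 11 → ZMod 11 → ℂ} (hF : Rel F)

include hF

lemma swap_both (a b c d : ZMod 11) : F b a d c = F a b c d := by
  have h1 := hF.swap a b (-d) c
  have h2 := hF.flip a b (-c) (-d)
  have h3 := hF.flip a b d (-c)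
  have h4 := hF.flip a b c d
  rw [neg_neg] at h1 h2
  rw [h1, h2, h3, h4, neg_neg, neg_neg]

lemma swap_neg (a b c d : ZMod 11) : F b a c (-d) = -F a b c d := by
  rw [← hF.swap_both, hF.swap, hF.swap_both]

lemma cycle (a b c d : ZMod 11) : F (-(a + b)) a c d = F a b c d := by
  have h1 := hF.rot a b c d
  have h2 := hF.swap a (-a - b) (-c) d
  rw [neg_neg, h1, neg_neg] at h2
  rw [← h2]
  congr 1
  ring

lemma cycle' (a b c d : ZMod 11) : F b (-(a + b)) c d = F a b c d := by
  have h := hF.cycle b (-(a + b)) c d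
  rw [show -(b + -(a + b)) = a by ring] at h
  exact h.symm

lemma unit_smul {u : ZMod 11} (hu : u ≠ 0) (a b c d : ZMod 11) :
    F (u * a) (u * b) (u * c) (u * d) = F a b c d := by
  have hp (k : ℕ) : F (2 ^ k * a) (2 ^ k * b) (2 ^ k * c) (2 ^ k * d) = F a b c d := by
    induction k with
    | zero => simp
    | succ k ih => rw [← ih, ← hF.dbl (2 ^ k * a)]; simp only [pow_succ', mul_assoc]
  have : ∀ u : ZMod 11, u ≠ 0 → ∃ k : Fin 10, u = 2 ^ (k : ℕ) := by decide
  obtain ⟨k, rfl⟩ := this u hu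
  exact hp k

lemma valS_cands (s a b c d : ℕ) : valS F (cands s a b c d) = (-1) ^ s * F a b c d := by
  unfold cands
  refine valS_min F ?_ <| valS_min F ?_ <| valS_min F ?_ <| valS_min F ?_ <| valS_min F ?_ ?_ <;>
    rw [valS_key] <;> simp only [cast_ten_mul, Nat.cast_add, hF.neg, hF.cycle, hF.cycle']

lemma valS_sortCD (s a b c d : ℕ) : valS F (sortCD s a b c d) = (-1) ^ s * F a b c d := by
  unfold sortCD
  split_ifs
  · rw [hF.valS_cands, hF.swap_both]
  · rw [hF.valS_cands]

lemma valS_absD (s a b c d : ℕ) : valS F (absD s a b c d) = (-1) ^ s * F a b c d := by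
  unfold absD
  split_ifs
  · rw [hF.valS_sortCD, ZMod.natCast_mod, cast_ten_mul, hF.swap_neg]; ring
  · rw [hF.valS_sortCD]

lemma valS_absC (s a b c d : ℕ) : valS F (absC s a b c d) = (-1) ^ s * F a b c d := by
  unfold absC
  split_ifs
  · rw [hF.valS_absD, ZMod.natCast_mod, cast_ten_mul, hF.swap]; ring
  · rw [hF.valS_absD]

lemma valS_scaled {l : ℕ} (hl : (l : ZMod 11) ≠ 0) (a b c d : ℕ) :
    valS F (scaled l a b c d) = F a b c d := by
  unfold scaled
  rw [hF.valS_absC, pow_zero, one_mul, ← hF.unit_smul hl a b c d]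
  simp only [ZMod.natCast_mod, Nat.cast_mul]

lemma valS_norm (a b c d : ℕ) : valS F (norm a b c d) = F a b c d := by
  unfold norm
  refine valS_min F ?_ <| valS_min F ?_ <| valS_min F ?_ <| valS_min F ?_ ?_ <;>
    exact hF.valS_scaled (by decide) a b c d

end Rel

/-- Defining relations, indexed by their kind and a coded row, as lists of weighted rows. -/
def relation (i k : ℕ) : List (ℤ × ℕ × ℕ × ℕ × ℕ) :=
  let a := k / 1331
  let b := k / 121 % 11
  let c := k / 11 % 11
  let d := k % 11
  match i with
  | 0 => [(1, a, b, c, d), (1, a, b, d, 10 * c)]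
  | 1 => [(1, c, d, 10 * b, a + b), (-1, c, d, a, a + b), (-1, a, b, 10 * d, c + d),
      (1, a, b, c, c + d), (1, c, d, a, b), (-1, a, b, c, d)]
  | 2 => [(-1, a + b, c, 10 * b, d), (1, a + b, c, a, d), (1, a, b, 10 * d, a + b + c),
      (1, a, b, c, d), (1, b + c, a, 10 * c, d), (-1, b + c, a, b, d),
      (-1, b, c, 10 * d, b + c + a), (-1, b, c, a, d)]
  | _ => [(1, 0, 1, 1, 3), (1, 1, 1, 1, 3), (-2, 0, 1, 2, 3)]

/-- Add a weighted key to a formal sum. -/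
def insertKey (c : ℤ) (k : ℕ) : List (ℤ × ℕ) → List (ℤ × ℕ)
  | [] => [(c, k)]
  | (c', k') :: l => if k = k' then (c + c', k') :: l else (c', k') :: insertKey c k l

/-- Add a weighted list of rows to a formal sum, modulo the keys in a bit mask. -/
def addRows (mask : ℕ) (w : ℤ) : List (ℤ × ℕ × ℕ × ℕ × ℕ) → List (ℤ × ℕ) → List (ℤ × ℕ)
  | [], acc => acc
  | (c, a, b, e, d) :: l, acc =>
    let n := norm a b e d
    let acc' := addRows mask w l acc
    if mask.testBit (n / 2) then acc' else
      insertKey (if n % 2 = 0 then w * c else -(w * c)) (n / 2) acc'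

def addRelations (mask : ℕ) : List (ℤ × ℕ × ℕ) → List (ℤ × ℕ)
  | [] => []
  | (w, i, k) :: l => addRows mask w (relation i k) (addRelations mask l)

/-- Whether a combination of relations reduces to a nonzero multiple of a single key. -/
def stepOK (mask t : ℕ) (L : List (ℤ × ℕ × ℕ)) : Bool :=
  ((addRelations mask L).filter fun p => p.1 ≠ 0).map Prod.snd = [t]

/-- Extend the mask along a list of deductions, failing if one of them is wrong. -/
def deduce : ℕ → List (ℕ × List (ℤ × ℕ × ℕ)) → Option ℕ
  | mask, [] => some mask
  | mask, (t, L) :: l => if stepOK mask t L then deduce (mask ||| 1 <<< t) l else none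

/-- Codes of the rows at which a cocycle can be normalised to vanish. -/
def pivots : List ℕ :=
  [2062, 1864, 181, 1585, 1598, 137, 134, 135, 158, 1597, 1754, 148, 1718, 1743, 1611,
    1464]

def startMask : ℕ := (14 :: pivots).foldl (fun m k => m ||| 1 <<< k) 0

def deductions : List (ℕ × List (ℤ × ℕ × ℕ)) := [
  (121, [(1, 0, 121)]), (122, [(1, 1, 1441)]), (1455, [(1, 0, 1455)]), (126, [(1, 0, 126)]),
  (1457, [(1, 0, 1457)]), (1456, [(1, 0, 1456)]), (1454, [(1, 0, 1454)]),
  (1452, [(1, 0, 1452)]), (1453, [(1, 0, 1453)]), (125, [(1, 0, 125)]), (1573, [(1, 0, 1573)]),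
  (124, [(1, 0, 124)]), (123, [(1, 0, 123)]), (1694, [(1, 0, 1694)]), (1, [(1, 0, 1)]),
  (0, [(1, 0, 0)]), (13, [(1, 1, 14)]), (12, [(1, 1, 1)]), (1574, [(1, 0, 3148)]),
  (1698, [(1, 2, 1540)]), (1575, [(1, 2, 1683)]), (1816, [(1, 2, 1738)]),
  (1697, [(1, 2, 2596)]), (1695, [(1, 2, 2574)]), (1576, [(1, 2, 1661)]), (1819, [(1, 2, 187)]),
  (1820, [(1, 2, 1881)]), (2061, [(1, 0, 3151)]), (2058, [(1, 0, 3030)]),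
  (1587, [(1, 2, 2223)]), (145, [(1, 1, 123)]), (1742, [(1, 0, 1585)]), (1708, [(1, 2, 1783)]),
  (1476, [(1, 1, 137)]), (1465, [(1, 2, 134)]), (146, [(1, 1, 140)]), (1466, [(1, 3, 0)]),
  (169, [(1, 2, 161)]), (157, [(1, 1, 124)]), (1488, [(1, 1, 158)]), (1731, [(1, 2, 145)]),
  (170, [(1, 2, 210)]), (1477, [(1, 2, 2423)]), (1586, [(1, 2, 219)]), (1730, [(1, 0, 1597)]),
  (136, [(1, 1, 138)]), (1706, [(1, 1, 139)]), (1609, [(1, 2, 151)]), (1621, [(1, 0, 1621)]),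
  (159, [(1, 1, 146)]), (1500, [(1, 1, 157)]), (1633, [(1, 0, 1633)]), (147, [(1, 1, 147)]),
  (1512, [(1, 1, 1355)]), (2070, [(1, 2, 167)]), (1610, [(1, 2, 147)]), (1720, [(1, 2, 148)]),
  (1829, [(1, 2, 190)]), (133, [(1, 1, 133)]),
  (1468, [(1, 1, 1468), (2, 2, 2424), (-2, 2, 1851)]), (1478, [(1, 1, 1468)]),
  (1467, [(1, 2, 136)]), (1479, [(1, 2, 137)]), (1710, [(1, 2, 1487)]), (1852, [(1, 2, 1475)]),
  (1588, [(1, 2, 1478)]), (1589, [(1, 2, 1481)]), (1599, [(1, 2, 1483)]),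
  (1600, [(1, 2, 1621)]), (1490, [(1, 2, 1488)]), (1501, [(1, 2, 1500)]),
  (1489, [(1, 2, 1607)]), (1622, [(1, 2, 1629)]), (1721, [(1, 2, 1630)]),
  (1699, [(1, 2, 2035), (2, 2, 1823), (3, 2, 1760)]), (1577, [(1, 0, 1577)]),
  (2059, [(1, 0, 1817)]), (1817, [(1, 0, 3149)]), (1578, [(1, 2, 1485)]),
  (2060, [(1, 2, 1606)]), (1696, [(1, 2, 1617)]), (1818, [(1, 2, 2475)])]

section
variable (F : ZMod 11 → ZMod 11 → ZMod 11 → ZMod 11 → ℂ)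

def sumRows (L : List (ℤ × ℕ × ℕ × ℕ × ℕ)) : ℂ :=
  (L.map fun p => (p.1 : ℂ) * F p.2.1 p.2.2.1 p.2.2.2.1 p.2.2.2.2).sum

def sumKeys (L : List (ℤ × ℕ)) : ℂ := (L.map fun p => (p.1 : ℂ) * valK F p.2).sum

lemma sumKeys_insertKey (c : ℤ) (k : ℕ) (L : List (ℤ × ℕ)) :
    sumKeys F (insertKey c k L) = c * valK F k + sumKeys F L := by
  induction L with
  | nil => simp [insertKey, sumKeys]
  | cons p L ih =>
    obtain ⟨c', k'⟩ := p
    unfold insertKey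
    split_ifs with h
    · subst h; simp only [sumKeys, List.map_cons, List.sum_cons]; push_cast; ring
    · simp only [sumKeys, List.map_cons, List.sum_cons] at ih ⊢; rw [ih]; ring

end

variable {F : ZMod 11 → ZMod 11 → ZMod 11 → ZMod 11 → ℂ}

/-- All keys of the mask are zeros. -/
def Zeros (F : ZMod 11 → ZMod 11 → ZMod 11 → ZMod 11 → ℂ) (mask : ℕ) : Prop :=
  ∀ k, mask.testBit k → valK F k = 0

lemma zeros_or {mask t : ℕ} (h : Zeros F mask) (ht : valK F t = 0) :
    Zeros F (mask ||| 1 <<< t) := by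
  intro k hk
  rw [Nat.testBit_or, Bool.or_eq_true] at hk
  rcases hk with hk | hk
  · exact h k hk
  · rw [Nat.testBit_shiftLeft, Bool.and_eq_true, decide_eq_true_eq] at hk
    have : k - t = 0 := by
      by_contra h0
      have := hk.2
      rw [Nat.testBit_one_eq_true_iff_self_eq_zero] at this
      exact h0 this
    have : k = t := by omega
    rw [this, ht]

lemma sumKeys_addRows (hF : Rel F) {mask : ℕ} (h : Zeros F mask) (w : ℤ)
    (L : List (ℤ × ℕ × ℕ × ℕ × ℕ)) (acc : List (ℤ × ℕ)) :
    sumKeys F (addRows mask w L acc) = w * sumRows F L + sumKeys F acc := by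
  induction L with
  | nil => simp [addRows, sumRows]
  | cons p L ih =>
    obtain ⟨c, a, b, e, d⟩ := p
    have hn := hF.valS_norm a b e d
    have hs : sumRows F ((c, a, b, e, d) :: L) = c * F a b e d + sumRows F L := by
      simp [sumRows]
    rw [hs, ← hn]
    simp only [addRows]
    split_ifs with h1 h2
    · rw [ih, valS, h _ h1]; ring
    · rw [sumKeys_insertKey, ih, valS, (Nat.even_iff.2 h2).neg_one_pow]; push_cast; ring
    · rw [sumKeys_insertKey, ih, valS, (Nat.odd_iff.2 (by omega)).neg_one_pow]; push_cast; ring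

lemma sumRows_relation (hF : Rel F)
    (h3 : F 0 1 1 3 + F 1 1 1 3 - 2 * F 0 1 2 3 = 0) (i k : ℕ) :
    sumRows F (relation i k) = 0 := by
  unfold relation
  split
  · simp only [sumRows, List.map_cons, List.map_nil, List.sum_cons, List.sum_nil, cast_ten_mul,
      hF.flip]
    push_cast; ring
  · have := hF.two (k / 1331 : ℕ) (k / 121 % 11 : ℕ) (k / 11 % 11 : ℕ) (k % 11 : ℕ)
    simp only [sumRows, List.map_cons, List.map_nil, List.sum_cons, List.sum_nil, cast_ten_mul,
      Nat.cast_add]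
    push_cast at this ⊢; linear_combination this
  · have := hF.four (k / 1331 : ℕ) (k / 121 % 11 : ℕ) (k / 11 % 11 : ℕ) (k % 11 : ℕ)
    simp only [sumRows, List.map_cons, List.map_nil, List.sum_cons, List.sum_nil, cast_ten_mul,
      Nat.cast_add]
    push_cast at this ⊢; linear_combination this
  · simp only [sumRows, List.map_cons, List.map_nil, List.sum_cons, List.sum_nil]
    push_cast; linear_combination h3

lemma sumKeys_addRelations (hF : Rel F) (h3 : F 0 1 1 3 + F 1 1 1 3 - 2 * F 0 1 2 3 = 0)
    {mask : ℕ} (h : Zeros F mask) (L : List (ℤ × ℕ × ℕ)) :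
    sumKeys F (addRelations mask L) = 0 := by
  induction L with
  | nil => simp [addRelations, sumKeys]
  | cons p L ih =>
    obtain ⟨w, i, k⟩ := p
    rw [addRelations, sumKeys_addRows hF h, sumRows_relation hF h3, ih, mul_zero, add_zero]

lemma sumKeys_filter (L : List (ℤ × ℕ)) :
    sumKeys F (L.filter fun p => p.1 ≠ 0) = sumKeys F L := by
  induction L with
  | nil => rfl
  | cons p L ih =>
    by_cases hp : p.1 = 0
    · rw [List.filter_cons_of_neg (by simpa using hp), ih]; simp [sumKeys, hp]
    · rw [List.filter_cons_of_pos (by simpa using hp)]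
      simp only [sumKeys, List.map_cons, List.sum_cons] at ih ⊢
      rw [ih]

lemma valK_of_stepOK (hF : Rel F) (h3 : F 0 1 1 3 + F 1 1 1 3 - 2 * F 0 1 2 3 = 0)
    {mask t : ℕ} (h : Zeros F mask) {L : List (ℤ × ℕ × ℕ)} (hs : stepOK mask t L) :
    valK F t = 0 := by
  have hsum := sumKeys_addRelations hF h3 h L
  rw [← sumKeys_filter] at hsum
  simp only [stepOK, decide_eq_true_eq] at hs
  obtain ⟨p, hp, rfl⟩ := List.map_eq_singleton_iff.1 hs
  rw [hp] at hsum
  have hmem : p ∈ (addRelations mask L).filter fun p => p.1 ≠ 0 := by rw [hp]; simp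
  have hp0 : p.1 ≠ 0 := by simpa using (List.mem_filter.1 hmem).2
  simpa [sumKeys, hp0] using hsum

lemma zeros_deduce (hF : Rel F) (h3 : F 0 1 1 3 + F 1 1 1 3 - 2 * F 0 1 2 3 = 0)
    (l : List (ℕ × List (ℤ × ℕ × ℕ))) {mask m : ℕ} (h : Zeros F mask)
    (hm : deduce mask l = some m) : Zeros F m := by
  induction l generalizing mask with
  | nil => cases hm; exact h
  | cons p l ih =>
    obtain ⟨t, L⟩ := p
    rw [deduce] at hm
    split_ifs at hm with hs
    exact ih (zeros_or h (valK_of_stepOK hF h3 h hs)) hm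

lemma zeros_foldl (l : List ℕ) {mask : ℕ} (h : Zeros F mask) (hl : ∀ k ∈ l, valK F k = 0) :
    Zeros F (l.foldl (fun m k => m ||| 1 <<< k) mask) := by
  induction l generalizing mask with
  | nil => exact h
  | cons t l ih =>
    exact ih (zeros_or h (hl t (by simp))) fun k hk => hl k (by simp [hk])

/-- Every row whose last entry is one has a representative in the mask. -/
def coversAll (m : ℕ) : Bool :=
  (List.range 1331).all fun k => m.testBit (norm (k / 121) (k / 11 % 11) (k % 11) 1 / 2)

lemma deduce_covers : (deduce startMask deductions).any coversAll = true := by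
  decide +kernel

theorem Rel.eq_zero (hF : Rel F) (hp : ∀ k ∈ pivots, valK F k = 0) (h1 : F 0 0 1 3 = 0)
    (h3 : F 0 1 1 3 + F 1 1 1 3 - 2 * F 0 1 2 3 = 0) (a b c d : ZMod 11) : F a b c d = 0 := by
  have hz : Zeros F startMask := by
    refine zeros_foldl _ (fun k hk => by simp at hk) fun k hk => ?_
    rcases List.mem_cons.1 hk with rfl | hk
    · exact h1
    · exact hp k hk
  obtain ⟨m, hm, hc⟩ : ∃ m, deduce startMask deductions = some m ∧ coversAll m = true := by
    have h := deduce_covers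
    generalize deduce startMask deductions = o at h
    cases o with
    | none => simp at h
    | some m => exact ⟨m, rfl, by simpa using h⟩
  have hm := zeros_deduce hF h3 _ hz hm
  have hone (a b c : ZMod 11) : F a b c 1 = 0 := by
    have ha := a.val_lt
    have hb := b.val_lt
    have hcl := c.val_lt
    have h := List.all_eq_true.1 hc ((a.val * 11 + b.val) * 11 + c.val)
      (List.mem_range.2 (by omega))
    rw [show ((a.val * 11 + b.val) * 11 + c.val) / 121 = a.val by omega,
      show ((a.val * 11 + b.val) * 11 + c.val) / 11 % 11 = b.val by omega,
      show ((a.val * 11 + b.val) * 11 + c.val) % 11 = c.val by omega] at h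
    have h' := hF.valS_norm a.val b.val c.val 1
    rw [valS, hm _ h, mul_zero] at h'
    simpa using h'.symm
  have hne (a b c d : ZMod 11) (hd : d ≠ 0) : F a b c d = 0 := by
    have : ∀ d : ZMod 11, d ≠ 0 → ∃ u, u ≠ 0 ∧ u * d = 1 := by decide
    obtain ⟨u, hu, hud⟩ := this d hd
    rw [← hF.unit_smul hu, hud]
    exact hone _ _ _
  by_cases hd : d = 0
  · by_cases hc0 : c = 0
    · subst hd hc0
      have h := hF.flip a b 0 0
      rw [neg_zero] at h
      linear_combination h / 2
    · rw [← neg_eq_zero, ← hF.flip]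
      exact hne _ _ _ _ (neg_ne_zero.2 hc0)
  · exact hne a b c d hd

end ModEleven

/-! ### Cells in terms of vectors -/

namespace SymForm

open Matrix

/-- The determinant of four vectors. -/
def D (a b c d : Fin 4 → ℤ) : ℤ := det4 ![a, b, c, d]

section
variable (a b c d e : Fin 4 → ℤ)

lemma D_eq : D a b c d =
    (a 0 * b 1 - a 1 * b 0) * (c 2 * d 3 - c 3 * d 2) -
    (a 0 * b 2 - a 2 * b 0) * (c 1 * d 3 - c 3 * d 1) +
    (a 0 * b 3 - a 3 * b 0) * (c 1 * d 2 - c 2 * d 1) +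
    (a 1 * b 2 - a 2 * b 1) * (c 0 * d 3 - c 3 * d 0) -
    (a 1 * b 3 - a 3 * b 1) * (c 0 * d 2 - c 2 * d 0) +
    (a 2 * b 3 - a 3 * b 2) * (c 0 * d 1 - c 1 * d 0) := rfl

lemma D_swap₁ : D b a c d = -D a b c d := by simp only [D_eq]; ring
lemma D_swap₂ : D a c b d = -D a b c d := by simp only [D_eq]; ring
lemma D_swap₃ : D a b d c = -D a b c d := by simp only [D_eq]; ring
lemma D_pair : D c d a b = D a b c d := by simp only [D_eq]; ring
lemma D_smul₁ (k : ℤ) : D (k • a) b c d = k * D a b c d := by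
  simp only [D_eq, Pi.smul_apply, smul_eq_mul]; ring
lemma D_self₁ : D a a c d = 0 := by simp only [D_eq]; ring
lemma D_self₂ : D a b b d = 0 := by simp only [D_eq]; ring
lemma D_self₃ : D a b c c = 0 := by simp only [D_eq]; ring
lemma D_self₄ : D a b a d = 0 := by simp only [D_eq]; ring
lemma D_self₅ : D a b c b = 0 := by simp only [D_eq]; ring
lemma D_self₆ : D a b c a = 0 := by simp only [D_eq]; ring

/-- Cramer's rule. -/
lemma cramer : D a b c d • e = D e b c d • a + D a e c d • b + D a b e d • c + D a b c e • d := by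
  funext i
  fin_cases i <;> simp [D_eq] <;> ring

lemma D_mulVec (M : S) : D (M *ᵥ a) (M *ᵥ b) (M *ᵥ c) (M *ᵥ d) = M.det * D a b c d := by
  have h (x y z w : Fin 4 → ℤ) : D x y z w = (of ![x, y, z, w] : S).det := (det_eq_det4 _).symm
  rw [h, h, mul_comm, ← det_transpose M, ← det_mul]
  congr 1
  ext i j
  fin_cases i <;> simp [mul_apply, mulVec, dotProduct, mul_comm]

end

lemma pr_sq_sq (u v : Fin 4 → ℤ) : pr (sq u) (sq v) = (u ⬝ᵥ v) ^ 2 := by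
  rw [pr_sq, sq, vecMulVec_mulVec, dotProduct_smul, dotProduct_comm v u, pow_two]
  simp

lemma span_of_D {l : List S} {a b c d : Fin 4 → ℤ} (h : D a b c d ≠ 0) (ha : sq a ∈ l)
    (hb : sq b ∈ l) (hc : sq c ∈ l) (hd : sq d ∈ l) : Sys.Span l := by
  intro u hu
  have h0 (x : Fin 4 → ℤ) (hx : sq x ∈ l) : u ⬝ᵥ x = 0 := by
    have := hu _ hx
    rwa [pr_sq_sq, pow_eq_zero_iff two_ne_zero] at this
  funext i
  have h1 := congrArg (u ⬝ᵥ ·) (cramer a b c d (Pi.single i 1))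
  simp only [dotProduct_add, dotProduct_smul, h0 a ha, h0 b hb, h0 c hc, h0 d hd,
    dotProduct_single_one, smul_eq_mul, mul_zero, add_zero] at h1
  simpa [h] using h1

lemma not_span {l : List S} {p q r t : Fin 4 → ℤ} (h : D p q r t ≠ 0)
    (hl : ∀ x ∈ l, ∃ w, x = sq w ∧ D p q r w = 0) : ¬Sys.Span l := by
  intro hs
  have hu (w : Fin 4 → ℤ) : (fun i => D p q r (Pi.single i 1)) ⬝ᵥ w = D p q r w := by
    simp [dotProduct, Fin.sum_univ_four, D_eq, Pi.single_apply]
    ring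
  have h0 := hs (fun i => D p q r (Pi.single i 1)) fun x hx => by
    obtain ⟨w, rfl, hw⟩ := hl x hx
    rw [pr_sq_sq, hu, hw]
    rfl
  rw [← hu, h0, zero_dotProduct] at h
  exact h rfl

/-! #### Total unimodularity -/

/-- The minimal vectors of `QD` in a single list. -/
def wD (k : Fin 12) : Fin 4 → ℤ := vD ⟨k / 4, by omega⟩ ⟨k % 4, by omega⟩

lemma det_vA_sorted : ∀ i j, i < j → ∀ k, i < k → ∀ m, k < m →
    (det4 ![vA i, vA j, vA k, vA m]).natAbs ≤ 1 := by
  decide +kernel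

lemma det_wD_sorted : ∀ i j, i < j → ∀ k, i < k → ∀ m, k < m →
    2 ≤ (det4 ![wD i, wD j, wD k, wD m]).natAbs →
      i.1 / 4 = j.1 / 4 ∧ i.1 / 4 = k.1 / 4 ∧ i.1 / 4 = m.1 / 4 := by
  decide +kernel

lemma forall_of_sorted {n : ℕ} (w : Fin n → Fin 4 → ℤ) (R : Fin n → Fin n → Fin n → Fin n → Prop)
    (h₁ : ∀ i j k m, R i j k m → R j i k m) (h₂ : ∀ i j k m, R i j k m → R i j m k)
    (h₃ : ∀ i j k m, R i j k m → R k m i j)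
    (h : ∀ i j, i < j → ∀ k, i < k → ∀ m, k < m →
      2 ≤ (det4 ![w i, w j, w k, w m]).natAbs → R i j k m)
    (i j k m : Fin n) (hD : 2 ≤ (D (w i) (w j) (w k) (w m)).natAbs) : R i j k m := by
  wlog hij : i < j generalizing i j
  · rcases (not_lt.1 hij).eq_or_lt with rfl | hji
    · rw [D_self₁] at hD; simp at hD
    · exact h₁ _ _ _ _ (this j i (by rwa [D_swap₁, Int.natAbs_neg]) hji)
  wlog hkm : k < m generalizing k m
  · rcases (not_lt.1 hkm).eq_or_lt with rfl | hji
    · rw [← D_pair, D_self₁] at hD; simp at hD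
    · exact h₂ _ _ _ _ (this m k (by rwa [D_swap₃, Int.natAbs_neg]) hji)
  wlog hik : i < k generalizing i j k m
  · rcases (not_lt.1 hik).eq_or_lt with rfl | hji
    · rw [D_swap₂, D_self₁] at hD; simp at hD
    · exact h₃ _ _ _ _ (this k m hkm i j (by rwa [D_pair]) hij hji)
  exact h _ _ hij _ hik _ hkm hD

lemma det_vA (i j k m : Fin 10) : (D (vA i) (vA j) (vA k) (vA m)).natAbs ≤ 1 := by
  by_contra! hD
  exact forall_of_sorted vA (fun _ _ _ _ => False) (fun _ _ _ _ => id) (fun _ _ _ _ => id)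
    (fun _ _ _ _ => id) (fun i j hij k hik m hkm h2 => by
      have := det_vA_sorted i j hij k hik m hkm
      omega) i j k m hD

lemma det_wD (i j k m : Fin 12) (h : 2 ≤ (D (wD i) (wD j) (wD k) (wD m)).natAbs) :
    i.1 / 4 = j.1 / 4 ∧ i.1 / 4 = k.1 / 4 ∧ i.1 / 4 = m.1 / 4 :=
  forall_of_sorted wD (fun i j k m => i.1 / 4 = j.1 / 4 ∧ i.1 / 4 = k.1 / 4 ∧ i.1 / 4 = m.1 / 4)
    (fun _ _ _ _ _ => by omega) (fun _ _ _ _ _ => by omega) (fun _ _ _ _ _ => by omega)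
    det_wD_sorted i j k m h

end SymForm

namespace SymForm

open Matrix

lemma sq_eq_sq {v w : Fin 4 → ℤ} (h : sq v = sq w) : v = w ∨ v = -w := by
  have h1 (i j) : v i * v j = w i * w j := congrFun (congrFun h i) j
  by_cases hw : w = 0
  · left
    funext i
    have := h1 i i
    simpa [hw] using this
  obtain ⟨i, hi⟩ := Function.ne_iff.1 hw
  refine (mul_self_eq_mul_self_iff.1 (h1 i i)).imp (fun h2 => ?_) fun h2 => ?_
  · funext j
    have := h1 i j
    rw [h2] at this
    exact mul_left_cancel₀ hi this
  · funext j
    have := h1 i j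
    rw [h2, neg_mul, ← mul_neg] at this
    exact mul_left_cancel₀ (a := w i) hi (by rw [Pi.neg_apply]; linarith)

/-- The vertex given by the root lattice `A₄`. -/
def vertA : V := ⟨QA, 1, det_one, Or.inl (by simp)⟩

/-- The vertex given by the root lattice `D₄`. -/
def vertD : V := ⟨QD, 1, det_one, Or.inr (by simp)⟩

lemma exists_smul_eq (Q : V) : ∃ g : G4, g • Q = vertA ∨ g • Q = vertD := by
  obtain ⟨M, hM, h | h⟩ := Q.2
  · have hQ : Q = (toG M hM)⁻¹ • vertA := Subtype.ext (h.trans (dual_toG_inv M hM _).symm)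
    exact ⟨toG M hM, Or.inl (by rw [hQ, smul_inv_smul])⟩
  · have hQ : Q = (toG M hM)⁻¹ • vertD := Subtype.ext (h.trans (dual_toG_inv M hM _).symm)
    exact ⟨toG M hM, Or.inr (by rw [hQ, smul_inv_smul])⟩

lemma mem_I_vertA {x : S} : x ∈ std.I vertA ↔ ∃ k, sq (vA k) = x := by
  rw [(std.perf vertA).mem_I, show vertA.1 = QA from rfl, ← mem_IA]
  simp [IA]

lemma mem_I_vertD {x : S} : x ∈ std.I vertD ↔ ∃ i j, sq (vD i j) = x := by
  rw [(std.perf vertD).mem_I, show vertD.1 = QD from rfl, ← mem_ID_iff, mem_ID]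

lemma D_natAbs_congr {a b c d a' b' c' d' : Fin 4 → ℤ} (ha : sq a = sq a') (hb : sq b = sq b')
    (hc : sq c = sq c') (hd : sq d = sq d') : (D a b c d).natAbs = (D a' b' c' d').natAbs := by
  have key (a a' b c d : Fin 4 → ℤ) (h : sq a = sq a') :
      (D a b c d).natAbs = (D a' b c d).natAbs := by
    rcases sq_eq_sq h with rfl | rfl
    · rfl
    · rw [show -a' = (-1 : ℤ) • a' by simp, D_smul₁, neg_one_mul, Int.natAbs_neg]
  rw [key a a' b c d ha, ← Int.natAbs_neg, ← D_swap₁, key b b' _ _ _ hb, ← D_pair,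
    key c c' _ _ _ hc, ← Int.natAbs_neg, ← D_swap₁, key d d' _ _ _ hd, ← Int.natAbs_neg, ← D_swap₁,
    D_pair, ← Int.natAbs_neg, ← D_swap₁]

lemma D_smul_vec (g : G4) (a b c d : Fin 4 → ℤ) :
    D (g.1 *ᵥ a) (g.1 *ᵥ b) (g.1 *ᵥ c) (g.1 *ᵥ d) = D a b c d := by
  rw [D_mulVec, g.2, one_mul]

theorem face_unimodular {Q : V} {l : List S} (h : std.Face Q l) {a b c d : Fin 4 → ℤ}
    (ha : sq a ∈ l) (hb : sq b ∈ l) (hc : sq c ∈ l) (hd : sq d ∈ l) : (D a b c d).natAbs ≤ 1 := by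
  obtain ⟨g, hg⟩ := exists_smul_eq Q
  replace h := std.face_smul act_val g Q h
  replace ha := List.mem_map_of_mem (f := (g • · : S → S)) ha
  replace hb := List.mem_map_of_mem (f := (g • · : S → S)) hb
  replace hc := List.mem_map_of_mem (f := (g • · : S → S)) hc
  replace hd := List.mem_map_of_mem (f := (g • · : S → S)) hd
  rw [← D_smul_vec g]
  simp only [smul_sq] at ha hb hc hd
  generalize g.1 *ᵥ a = a at *
  generalize g.1 *ᵥ b = b at *
  generalize g.1 *ᵥ c = c at *
  generalize g.1 *ᵥ d = d at *
  generalize l.map (g • · : S → S) = l at *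
  rcases hg with hg | hg <;> rw [hg] at h
  · obtain ⟨i, hi⟩ := mem_I_vertA.1 (h.2.1 _ ha)
    obtain ⟨j, hj⟩ := mem_I_vertA.1 (h.2.1 _ hb)
    obtain ⟨k, hk⟩ := mem_I_vertA.1 (h.2.1 _ hc)
    obtain ⟨m, hm⟩ := mem_I_vertA.1 (h.2.1 _ hd)
    rw [← D_natAbs_congr hi hj hk hm]
    exact det_vA i j k m
  · have key {x : S} (hx : x ∈ l) : ∃ i, sq (wD i) = x := by
      obtain ⟨i, j, hij⟩ := mem_I_vertD.1 (h.2.1 _ hx)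
      refine ⟨⟨4 * i + j, by omega⟩, ?_⟩
      rw [← hij, wD]
      congr 2
      all_goals ext; simp <;> omega
    obtain ⟨i, hi⟩ := key ha
    obtain ⟨j, hj⟩ := key hb
    obtain ⟨k, hk⟩ := key hc
    obtain ⟨m, hm⟩ := key hd
    by_contra! hD
    rw [← D_natAbs_congr hi hj hk hm] at hD
    have hf := det_wD i j k m hD
    have hij : i ≠ j := by rintro rfl; simp [D_self₁] at hD
    have hik : i ≠ k := by rintro rfl; simp [D_self₄] at hD
    have him : i ≠ m := by rintro rfl; simp [D_self₆] at hD
    have hjk : j ≠ k := by rintro rfl; simp [D_self₂] at hD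
    have hjm : j ≠ m := by rintro rfl; simp [D_self₅] at hD
    have hkm : k ≠ m := by rintro rfl; simp [D_self₃] at hD
    obtain ⟨-, -, E, h0, hs, hl, hE⟩ := std.face_iff.1 h
    obtain ⟨x, hx, hpos⟩ := perf_QD.exists_pos hs h0
      (fun x hx => hE x (mem_I_vertD.2 (mem_ID.1 hx))) ⟨i.1 / 4, by omega⟩
    obtain ⟨r, rfl⟩ := mem_FD.1 hx
    have hr : sq (vD ⟨i.1 / 4, by omega⟩ r) ∈ l := by
      have hw (n : Fin 12) (h1 : n.1 / 4 = i.1 / 4) (h2 : n.1 % 4 = r.1) :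
          vD ⟨i.1 / 4, by omega⟩ r = wD n := by
        rw [wD]
        congr 1
        · simp only [h1]
        · exact Fin.ext h2.symm
      have : i.1 % 4 = r.1 ∨ j.1 % 4 = r.1 ∨ k.1 % 4 = r.1 ∨ m.1 % 4 = r.1 := by
        have := Fin.val_ne_of_ne hij
        have := Fin.val_ne_of_ne hik
        have := Fin.val_ne_of_ne him
        have := Fin.val_ne_of_ne hjk
        have := Fin.val_ne_of_ne hjm
        have := Fin.val_ne_of_ne hkm
        omega
      rcases this with h2 | h2 | h2 | h2
      · rwa [hw i rfl h2, hi]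
      · rwa [hw j hf.1.symm h2, hj]
      · rwa [hw k hf.2.1.symm h2, hk]
      · rwa [hw m hf.2.2.symm h2, hm]
    exact hpos.ne' (hl _ hr)

lemma face_ne_zero {Q : V} {l : List S} (h : std.Face Q l) {a : Fin 4 → ℤ} (ha : sq a ∈ l) :
    a ≠ 0 := by
  rintro rfl
  have := (((std.perf Q).mem_I _).1 (h.2.1 _ ha)).2
  rw [pr_sq, zero_dotProduct] at this
  norm_num at this

lemma face_exists_sq {Q : V} {l : List S} (h : std.Face Q l) {x : S} (hx : x ∈ l) :
    ∃ v, sq v = x := by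
  obtain ⟨v, hv⟩ := (((std.perf Q).mem_I _).1 (h.2.1 _ hx)).1
  exact ⟨v, hv.symm⟩

/-! #### Cells of consecutive sums -/

/-- The sums of consecutive vectors. -/
def arc (a b c d : Fin 4 → ℤ) : Fin 10 → Fin 4 → ℤ :=
  ![a + b + c + d, b + c + d, c + d, d, a, a + b, a + b + c, b, b + c, c]

lemma exists_arc {a b c d : Fin 4 → ℤ} (h : D a b c d = 1) :
    ∃ g : G4, ∀ k, g.1 *ᵥ arc a b c d k = vA k := by
  have hB : (of ![a, b, c, d] : S)ᵀ.det = 1 := by rw [det_transpose, det_eq_det4]; exact h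
  have hA : (of ![vA 4, vA 7, vA 9, vA 3] : S)ᵀ.det = 1 := by
    rw [det_transpose, det_eq_det4]; decide +kernel
  let B := toG _ hB
  let A := toG _ hA
  have key (i : Fin 4) : (A * B⁻¹).1 *ᵥ ![a, b, c, d] i = ![vA 4, vA 7, vA 9, vA 3] i := by
    have h1 : ![a, b, c, d] i = B.1 *ᵥ Pi.single i 1 := by
      rw [mulVec_single_one]; rfl
    rw [h1, mulVec_mulVec, ← val_mul, inv_mul_cancel_right, mulVec_single_one]
    rfl
  refine ⟨A * B⁻¹, ?_⟩
  have h0 := key 0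
  have h1 := key 1
  have h2 := key 2
  have h3 := key 3
  simp only [cons_val] at h0 h1 h2 h3
  intro k
  fin_cases k <;> simp only [arc, Fin.reduceFinMk, Fin.zero_eta, Fin.mk_one, cons_val,
    mulVec_add, h0, h1, h2, h3] <;> decide +kernel

lemma D_arc {a b c d : Fin 4 → ℤ} (h : D a b c d = 1) (i j k m : Fin 10) :
    D (arc a b c d i) (arc a b c d j) (arc a b c d k) (arc a b c d m) =
      D (vA i) (vA j) (vA k) (vA m) := by
  obtain ⟨g, hg⟩ := exists_arc h
  rw [← D_smul_vec g, hg, hg, hg, hg]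

lemma face_vertA {l : List (Fin 10)} (hn : l.Nodup) (hl : l.length < 10) :
    std.Face vertA (l.map fun k => sq (vA k)) := by
  obtain ⟨k, hk⟩ : ∃ k, k ∉ l := by
    by_contra! hc
    have := hn.length_le_card
    have h1 : l.toFinset = Finset.univ := by ext; simp [hc]
    have h2 := List.toFinset_card_of_nodup hn
    rw [h1] at h2
    simp at h2
    omega
  obtain ⟨E, ⟨hs, hE⟩, -⟩ := perf_QA.edge (![sq (vA k), ∑ x ∈ IA, x, ∑ x ∈ IA, x]) (by
    intro i
    fin_cases i <;> simp [FA, IA])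
  have hEk (j : Fin 10) : pr E (sq (vA j)) = if j = k then 2 else 0 := by
    rw [hE 0 _ (by simp [FA, IA])]
    simp only [cons_val_zero]
    congr 1
    exact propext ⟨vA_inj _ _, by rintro rfl; rfl⟩
  refine std.face_iff.2 ⟨hn.map fun i j h => vA_inj _ _ h, ?_, E, ?_, hs, ?_, ?_⟩
  · simp only [List.forall_mem_map]
    exact fun j _ => mem_I_vertA.2 ⟨j, rfl⟩
  · rintro rfl
    have := hEk k
    simp [pr] at this
  · simp only [List.forall_mem_map]
    intro j hj
    rw [hEk, if_neg]
    rintro rfl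
    exact hk hj
  · intro x hx
    obtain ⟨j, rfl⟩ := mem_I_vertA.1 hx
    rw [hEk]
    split_ifs <;> norm_num

lemma face_arc {a b c d : Fin 4 → ℤ} (h : D a b c d = 1) {l : List (Fin 10)} (hn : l.Nodup)
    (hl : l.length < 10) : ∃ Q, std.Face Q (l.map fun k => sq (arc a b c d k)) := by
  obtain ⟨g, hg⟩ := exists_arc h
  refine ⟨g⁻¹ • vertA, ?_⟩
  rw [← std.face_smul_iff act_val g, smul_inv_smul]
  convert face_vertA hn hl using 1
  simp only [List.map_map, Function.comp_def, smul_sq, hg]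

lemma cell_arc {a b c d : Fin 4 → ℤ} (h : D a b c d = 1) {l : List (Fin 10)} (hn : l.Nodup)
    (hl : l.length < 10)
    (hs : ∃ i ∈ l, ∃ j ∈ l, ∃ k ∈ l, ∃ m ∈ l, D (vA i) (vA j) (vA k) (vA m) ≠ 0) :
    dat.Cell (l.map fun k => sq (arc a b c d k)) := by
  rw [dat_cell_iff]
  obtain ⟨i, hi, j, hj, k, hk, m, hm, hD⟩ := hs
  refine ⟨face_arc h hn hl, span_of_D (by rwa [D_arc h i j k m]) ?_ ?_ ?_ ?_⟩ <;>
    exact List.mem_map_of_mem (f := fun k => sq (arc a b c d k)) ‹_›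

end SymForm

/-! ### Classification of cells with five elements -/

namespace SymForm

open Matrix

lemma exists_D_ne_zero {l : List S} (hs : Sys.Span l) (hl : ∀ x ∈ l, ∃ v, sq v = x) :
    ∃ p q r s, sq p ∈ l ∧ sq q ∈ l ∧ sq r ∈ l ∧ sq s ∈ l ∧ D p q r s ≠ 0 := by
  have step {a b c d : Fin 4 → ℤ} (h : D a b c d ≠ 0) : ∃ w, sq w ∈ l ∧ D w a b c ≠ 0 := by
    by_contra! hc
    refine not_span h (fun x hx => ?_) hs
    obtain ⟨w, rfl⟩ := hl x hx
    refine ⟨w, rfl, ?_⟩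
    rw [← neg_eq_zero, ← D_swap₃, ← neg_eq_zero, ← D_swap₂, ← neg_eq_zero, ← D_swap₁]
    exact hc w hx
  obtain ⟨s, hs, h⟩ := step (a := Pi.single 0 1) (b := Pi.single 1 1) (c := Pi.single 2 1)
    (d := Pi.single 3 1) (by decide +kernel)
  obtain ⟨r, hr, h⟩ := step h
  obtain ⟨q, hq, h⟩ := step h
  obtain ⟨p, hp, h⟩ := step h
  exact ⟨p, q, r, s, hp, hq, hr, hs, h⟩

lemma nodup_of_D {p q r s : Fin 4 → ℤ} (h : D p q r s ≠ 0) : [sq p, sq q, sq r, sq s].Nodup := by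
  have key {p' q' r' s' : Fin 4 → ℤ} (hp : sq p = sq p') (hq : sq q = sq q') (hr : sq r = sq r')
      (hs : sq s = sq s') (h0 : D p' q' r' s' = 0) : False := by
    have := D_natAbs_congr hp hq hr hs
    rw [h0, Int.natAbs_zero, Int.natAbs_eq_zero] at this
    exact h this
  have h1 : sq p ≠ sq q := fun e => key e rfl rfl rfl (D_self₁ _ _ _)
  have h2 : sq p ≠ sq r := fun e => key e rfl rfl rfl (D_self₄ _ _ _)
  have h3 : sq p ≠ sq s := fun e => key e rfl rfl rfl (D_self₆ _ _ _)
  have h4 : sq q ≠ sq r := fun e => key rfl e rfl rfl (D_self₂ _ _ _)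
  have h5 : sq q ≠ sq s := fun e => key rfl e rfl rfl (D_self₅ _ _ _)
  have h6 : sq r ≠ sq s := fun e => key rfl rfl e rfl (D_self₃ _ _ _)
  simp [h1, h2, h3, h4, h5, h6]

/-- The possible shapes of a cell with five elements. -/
def Shape (l : List S) : Prop :=
  ∃ a b c d, D a b c d = 1 ∧ (l.Perm [sq a, sq b, sq c, sq d, sq (a + b)] ∨
    l.Perm [sq a, sq b, sq c, sq d, sq (a + b + c)] ∨
    l.Perm [sq a, sq b, sq c, sq d, sq (a + b + c + d)])

lemma shape_of_perm {l : List S} {a b c d e : Fin 4 → ℤ} (h : (D a b c d).natAbs = 1)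
    (hl : l.Perm [sq a, sq b, sq c, sq d, sq e])
    (he : e = a + b ∨ e = a + b + c ∨ e = a + b + c + d) : Shape l := by
  rcases Int.natAbs_eq_iff.1 h with h | h
  · refine ⟨a, b, c, d, h, ?_⟩
    rcases he with rfl | rfl | rfl
    · exact Or.inl hl
    · exact Or.inr (Or.inl hl)
    · exact Or.inr (Or.inr hl)
  · refine ⟨b, a, c, d, by rw [D_swap₁, h]; rfl, ?_⟩
    replace hl := hl.trans (List.Perm.swap _ _ _)
    rw [add_comm b a]
    rcases he with rfl | rfl | rfl
    · exact Or.inl hl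
    · exact Or.inr (Or.inl hl)
    · exact Or.inr (Or.inr hl)

lemma exists_sign (c : ℤ) (hc : c.natAbs ≤ 1) (v : Fin 4 → ℤ) :
    ∃ w, sq w = sq v ∧ (c • v = 0 ∨ c • v = w) := by
  have : c = 0 ∨ c = 1 ∨ c = -1 := by omega
  rcases this with rfl | rfl | rfl
  · exact ⟨v, rfl, Or.inl (zero_smul _ _)⟩
  · exact ⟨v, rfl, Or.inr (one_smul _ _)⟩
  · exact ⟨-v, sq_neg v, Or.inr (by simp)⟩

theorem shape_of_cell {l : List S} (h : dat.Cell l) (h5 : l.length = 5) : Shape l := by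
  obtain ⟨⟨Q, hQ⟩, hs⟩ := dat_cell_iff.1 h
  obtain ⟨p, q, r, s, hp, hq, hr, hs, hD⟩ := exists_D_ne_zero hs fun x hx => face_exists_sq hQ hx
  have hsub : [sq p, sq q, sq r, sq s].Subperm l :=
    List.subperm_of_subset (nodup_of_D hD) (by simp [hp, hq, hr, hs])
  obtain ⟨x, hx⟩ := hsub.exists_of_length_lt (by simp [h5])
  replace hx := hx.perm_of_length_le (by simp [h5])
  obtain ⟨e, rfl⟩ := face_exists_sq hQ (hx.subset (List.mem_cons_self))
  have he : sq e ∈ l := hx.subset (List.mem_cons_self)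
  have hnd := (hx.nodup_iff.2 hQ.1)
  have hcr := cramer p q r s e
  have hD1 : (D p q r s).natAbs = 1 := by
    have := face_unimodular hQ hp hq hr hs
    omega
  have h1 := face_unimodular hQ he hq hr hs
  have h2 := face_unimodular hQ hp he hr hs
  have h3 := face_unimodular hQ hp hq he hs
  have h4 := face_unimodular hQ hp hq hr he
  obtain ⟨e', he', hee⟩ := exists_sign _ hD1.le e
  have hee : D p q r s • e = e' := hee.resolve_left fun h0 =>
    (smul_eq_zero.1 h0).elim hD (face_ne_zero hQ he)
  obtain ⟨p', hp', hpp⟩ := exists_sign _ h1 p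
  obtain ⟨q', hq', hqq⟩ := exists_sign _ h2 q
  obtain ⟨r', hr', hrr⟩ := exists_sign _ h3 r
  obtain ⟨s', hs', hss⟩ := exists_sign _ h4 s
  rw [hee] at hcr
  rw [← D_natAbs_congr hp' hq' hr' hs'] at hD1
  rw [← hp', ← hq', ← hr', ← hs', ← he'] at hnd
  rw [← hp', ← hq', ← hr', ← hs', ← he'] at hx
  simp only [List.nodup_cons, List.mem_cons, not_or] at hnd
  have hperm {a b c d : Fin 4 → ℤ} (h : ∀ x, List.count x [sq e', sq p', sq q', sq r', sq s'] =
    List.count x [sq a, sq b, sq c, sq d, sq e']) : l.Perm [sq a, sq b, sq c, sq d, sq e'] :=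
    hx.symm.trans (List.perm_iff_count.2 h)
  have hdet {a b c d : Fin 4 → ℤ} (h : D a b c d = D p' q' r' s' ∨ D a b c d = -D p' q' r' s') :
      (D a b c d).natAbs = 1 := by
    rcases h with h | h <;> simp [h, hD1]
  rcases hpp with h1 | h1 <;> rcases hqq with h2 | h2 <;> rcases hrr with h3 | h3 <;>
    rcases hss with h4 | h4 <;> rw [h1, h2, h3, h4] at hcr <;>
    try simp only [add_zero, zero_add] at hcr
  · exact (face_ne_zero hQ (he' ▸ he) hcr).elim
  · exact (hnd.1.2.2.2.1 (congrArg sq hcr)).elim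
  · exact (hnd.1.2.2.1 (congrArg sq hcr)).elim
  · exact shape_of_perm (a := r') (b := s') (c := p') (d := q') (hdet
      (by simp only [D_eq]; left; ring1))
      (hperm fun x => by simp only [List.count_cons]; ring) (Or.inl hcr)
  · exact (hnd.1.2.1 (congrArg sq hcr)).elim
  · exact shape_of_perm (a := q') (b := s') (c := p') (d := r') (hdet
      (by simp only [D_eq]; right; ring1))
      (hperm fun x => by simp only [List.count_cons]; ring) (Or.inl hcr)
  · exact shape_of_perm (a := q') (b := r') (c := p') (d := s') (hdet
      (by simp only [D_eq]; left; ring1))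
      (hperm fun x => by simp only [List.count_cons]; ring) (Or.inl hcr)
  · exact shape_of_perm (a := q') (b := r') (c := s') (d := p') (hdet
      (by simp only [D_eq]; right; ring1))
      (hperm fun x => by simp only [List.count_cons]; ring) (Or.inr (Or.inl hcr))
  · exact (hnd.1.1 (congrArg sq hcr)).elim
  · exact shape_of_perm (a := p') (b := s') (c := q') (d := r') (hdet
      (by simp only [D_eq]; left; ring1))
      (hperm fun x => by simp only [List.count_cons]; ring) (Or.inl hcr)
  · exact shape_of_perm (a := p') (b := r') (c := q') (d := s') (hdet
      (by simp only [D_eq]; right; ring1))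
      (hperm fun x => by simp only [List.count_cons]; ring) (Or.inl hcr)
  · exact shape_of_perm (a := p') (b := r') (c := s') (d := q') (hdet
      (by simp only [D_eq]; left; ring1))
      (hperm fun x => by simp only [List.count_cons]; ring) (Or.inr (Or.inl hcr))
  · exact shape_of_perm (a := p') (b := q') (c := r') (d := s') (hdet (Or.inl rfl))
      (hperm fun x => by simp only [List.count_cons]; ring) (Or.inl hcr)
  · exact shape_of_perm (a := p') (b := q') (c := s') (d := r') (hdet
      (by simp only [D_eq]; right; ring1))
      (hperm fun x => by simp only [List.count_cons]; ring) (Or.inr (Or.inl hcr))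
  · exact shape_of_perm (a := p') (b := q') (c := r') (d := s') (hdet (Or.inl rfl))
      (hperm fun x => by simp only [List.count_cons]; ring) (Or.inr (Or.inl hcr))
  · exact shape_of_perm (a := p') (b := q') (c := r') (d := s') (hdet (Or.inl rfl))
      (hperm fun x => by simp only [List.count_cons]; ring) (Or.inr (Or.inr hcr))

end SymForm

/-! ### Functions of bases invariant under the congruence subgroup -/

namespace SymForm

open Matrix

/-- The last coordinate modulo eleven. -/
def ell (v : Fin 4 → ℤ) : ZMod 11 := (v 3 : ℤ)

@[simp] lemma ell_add (v w : Fin 4 → ℤ) : ell (v + w) = ell v + ell w := by simp [ell]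
@[simp] lemma ell_sub (v w : Fin 4 → ℤ) : ell (v - w) = ell v - ell w := by simp [ell]
@[simp] lemma ell_neg (v : Fin 4 → ℤ) : ell (-v) = -ell v := by simp [ell]
@[simp] lemma ell_smul (n : ℤ) (v : Fin 4 → ℤ) : ell (n • v) = n * ell v := by simp [ell]

lemma ell_gamma {g : G4} (hg : g ∈ Gamma0 11) (v : Fin 4 → ℤ) :
    ell (g.1 *ᵥ v) = (g.1 3 3 : ℤ) * ell v := by
  rw [mem_Gamma0_iff] at hg
  have h0 : ((g.1 3 0 : ℤ) : ZMod 11) = 0 := hg 0 (by decide)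
  have h1 : ((g.1 3 1 : ℤ) : ZMod 11) = 0 := hg 1 (by decide)
  have h2 : ((g.1 3 2 : ℤ) : ZMod 11) = 0 := hg 2 (by decide)
  simp [ell, mulVec, dotProduct, Fin.sum_univ_four, h0, h1, h2]

lemma gamma_unit {g : G4} (hg : g ∈ Gamma0 11) : ((g.1 3 3 : ℤ) : ZMod 11) ≠ 0 := by
  intro h
  have h1 := row_mul 11 g g⁻¹ 3
  rw [mul_inv_cancel, Fin.sum_univ_four] at h1
  rw [mem_Gamma0_iff] at hg
  simp only [hg 0 (by decide), hg 1 (by decide), hg 2 (by decide)] at h1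
  simp [row, h] at h1
  exact absurd h1 (by decide)

/-- Whether four vectors form an oriented basis with given last coordinates. -/
def IsBase (v : Fin 4 → Fin 4 → ℤ) (a b c d : ZMod 11) : Prop :=
  D (v 0) (v 1) (v 2) (v 3) = 1 ∧ ell (v 0) = a ∧ ell (v 1) = b ∧ ell (v 2) = c ∧ ell (v 3) = d

lemma exists_gamma {v w : Fin 4 → Fin 4 → ℤ} {a b c d : ZMod 11} (hv : IsBase v a b c d)
    (hw : IsBase w a b c d) : ∃ g ∈ Gamma0 11, ∀ i, g.1 *ᵥ v i = w i := by
  have hB {v : Fin 4 → Fin 4 → ℤ} (h : D (v 0) (v 1) (v 2) (v 3) = 1) : (of v : S)ᵀ.det = 1 := by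
    rw [det_transpose, det_eq_det4]; exact h
  refine ⟨toG _ (hB hw.1) * (toG _ (hB hv.1))⁻¹, mul_inv_mem_Gamma0 ?_, fun i => ?_⟩
  · obtain ⟨-, h0, h1, h2, h3⟩ := hv
    obtain ⟨-, k0, k1, k2, k3⟩ := hw
    funext j
    fin_cases j
    exacts [k0.trans h0.symm, k1.trans h1.symm, k2.trans h2.symm, k3.trans h3.symm]
  · have h1 : v i = (toG _ (hB hv.1)).1 *ᵥ Pi.single i 1 := by
      rw [mulVec_single_one]; rfl
    rw [h1, mulVec_mulVec, ← val_mul, inv_mul_cancel_right, mulVec_single_one]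
    rfl

lemma exists_base_of_ne {a : ZMod 11} (ha : a ≠ 0) (b c d : ZMod 11) :
    ∃ v, IsBase v a b c d := by
  have h1 : ∀ a : ZMod 11, a ≠ 0 → ∃ u p q : Fin 12, (u.1 : ZMod 11) = a ∧
      11 * p.1 = 1 + u.1 * q.1 := by decide +kernel
  have h2 : ∀ a : ZMod 11, a ≠ 0 → ∀ b, ∃ n : Fin 12, (n.1 : ZMod 11) * a = b := by decide +kernel
  obtain ⟨u, p, q, hu, hpq⟩ := h1 a ha
  obtain ⟨n, hn⟩ := h2 a ha b
  obtain ⟨m, hm⟩ := h2 a ha c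
  obtain ⟨k, hk⟩ := h2 a ha d
  have hpq' : (11 : ℤ) * p.1 = 1 + u.1 * q.1 := by exact_mod_cast hpq
  have h11 : (11 : ZMod 11) = 0 := by decide
  refine ⟨![![p.1, 0, 0, u.1], ![n.1 * p.1, 1, 0, n.1 * u.1], ![m.1 * p.1, 0, 1, m.1 * u.1],
    ![q.1 + k.1 * p.1, 0, 0, 11 + k.1 * u.1]], ?_, ?_, ?_, ?_, ?_⟩
  · simp [D_eq]
    linear_combination hpq'
  all_goals simp [ell, hu, hn, hm, hk, h11]

lemma exists_base {a b c d : ZMod 11} (h : a ≠ 0 ∨ b ≠ 0 ∨ c ≠ 0 ∨ d ≠ 0) :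
    ∃ v, IsBase v a b c d := by
  rcases h with h | h | h | h
  · exact exists_base_of_ne h b c d
  · obtain ⟨v, h, h0, h1, h2, h3⟩ := exists_base_of_ne h (-a) c d
    refine ⟨![-v 1, v 0, v 2, v 3], ?_, ?_, h0, h2, h3⟩
    · simp [D_eq] at h ⊢
      linear_combination h
    · simp [h1]
  · obtain ⟨v, h, h0, h1, h2, h3⟩ := exists_base_of_ne h b (-a) d
    refine ⟨![-v 2, v 1, v 0, v 3], ?_, ?_, h1, h0, h3⟩
    · simp [D_eq] at h ⊢
      linear_combination h
    · simp [h2]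
  · obtain ⟨v, h, h0, h1, h2, h3⟩ := exists_base_of_ne h b c (-a)
    refine ⟨![-v 3, v 1, v 2, v 0], ?_, ?_, h1, h2, h0⟩
    · simp [D_eq] at h ⊢
      linear_combination h
    · simp [h3]

lemma not_isBase_zero (v : Fin 4 → Fin 4 → ℤ) : ¬IsBase v 0 0 0 0 := by
  rintro ⟨h, h0, h1, h2, h3⟩
  have := congrArg (Int.cast : ℤ → ZMod 11) h
  simp only [ell] at h0 h1 h2 h3
  simp [D_eq, h0, h1, h2, h3] at this
  exact absurd this (by decide)

open Classical in
/-- The function of rows induced by a function of bases. -/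
noncomputable def onRows (φ : (Fin 4 → ℤ) → (Fin 4 → ℤ) → (Fin 4 → ℤ) → (Fin 4 → ℤ) → ℂ)
    (a b c d : ZMod 11) : ℂ :=
  if h : ∃ v, IsBase v a b c d then φ (h.choose 0) (h.choose 1) (h.choose 2) (h.choose 3) else 0

section
variable {φ : (Fin 4 → ℤ) → (Fin 4 → ℤ) → (Fin 4 → ℤ) → (Fin 4 → ℤ) → ℂ}

lemma onRows_zero : onRows φ 0 0 0 0 = 0 := dif_neg fun ⟨v, hv⟩ => not_isBase_zero v hv

variable (hφ : ∀ g ∈ Gamma0 11, ∀ a b c d,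
  φ (g.1 *ᵥ a) (g.1 *ᵥ b) (g.1 *ᵥ c) (g.1 *ᵥ d) = φ a b c d)
include hφ

lemma onRows_eq {p q r s : Fin 4 → ℤ} {a b c d : ZMod 11} (h : D p q r s = 1) (ha : ell p = a)
    (hb : ell q = b) (hc : ell r = c) (hd : ell s = d) : onRows φ a b c d = φ p q r s := by
  have hB : IsBase ![p, q, r, s] a b c d := ⟨h, ha, hb, hc, hd⟩
  have he : ∃ v, IsBase v a b c d := ⟨_, hB⟩
  obtain ⟨g, hg, h⟩ := exists_gamma he.choose_spec hB
  rw [onRows, dif_pos he, ← hφ g hg, h, h, h, h]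
  rfl

lemma onRows_dbl (a b c d : ZMod 11) :
    onRows φ (2 * a) (2 * b) (2 * c) (2 * d) = onRows φ a b c d := by
  by_cases h0 : a ≠ 0 ∨ b ≠ 0 ∨ c ≠ 0 ∨ d ≠ 0
  · obtain ⟨v, h, h1, h2, h3, h4⟩ := exists_base h0
    let g : G4 := ⟨!![6, 0, 0, 1; 0, 1, 0, 0; 0, 0, 1, 0; 11, 0, 0, 2], by
      rw [det_eq_det4]; decide +kernel⟩
    have hg : g ∈ Gamma0 11 := by rw [mem_Gamma0_iff]; decide +kernel
    have hl (x : Fin 4 → ℤ) : ell (g.1 *ᵥ x) = 2 * ell x := by rw [ell_gamma hg]; rfl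
    rw [onRows_eq hφ h h1 h2 h3 h4, ← hφ g hg]
    exact onRows_eq hφ (by rw [D_smul_vec, h]) (by rw [hl, h1]) (by rw [hl, h2]) (by rw [hl, h3])
      (by rw [hl, h4])
  · simp only [not_or, not_not] at h0
    obtain ⟨rfl, rfl, rfl, rfl⟩ := h0
    rw [mul_zero]

end

end SymForm

/-! ### The relations among the values of a cocycle -/

namespace SymForm

open Matrix ListCochain FrameData

/-- Invariant cochains on cells with `k` elements. -/
noncomputable abbrev cochains (k : ℕ) : Submodule ℂ (List S → ℂ) :=
  FrameData.Symmetry.inv (Gamma0 11) dat k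

section
variable {x : List S → ℂ} (hx : Alt x)

include hx in
lemma alt_perm_zero {l l' : List S} (h : l.Perm l') (h0 : x l' = 0) : x l = 0 := by
  by_contra hl
  exact hx.ne_zero_of_perm h hl h0

/-- The value of a cochain on a triangle cell. -/
def tri (x : List S → ℂ) (a b c d : Fin 4 → ℤ) : ℂ := x [sq a, sq b, sq c, sq d, sq (a + b)]

lemma tri_gamma {k : ℕ} {x : List S → ℂ} (hx : x ∈ cochains k) :
    ∀ g ∈ Gamma0 11, ∀ a b c d,
      tri x (g.1 *ᵥ a) (g.1 *ᵥ b) (g.1 *ᵥ c) (g.1 *ᵥ d) = tri x a b c d := by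
  intro g hg a b c d
  rw [tri, tri, ← mulVec_add]
  simp only [← smul_sq]
  exact hx.2.2 ⟨g, hg⟩ [sq a, sq b, sq c, sq d, sq (a + b)]

end

lemma cob_five {x : List S → ℂ} (h : dat.d x = 0) {a b c d e f : S}
    (hc : dat.Cell [a, b, c, d, e, f]) :
    x [b, c, d, e, f] - x [a, c, d, e, f] + x [a, b, d, e, f] - x [a, b, c, e, f] +
      x [a, b, c, d, f] - x [a, b, c, d, e] = 0 := by
  have := congrFun h [a, b, c, d, e, f]
  rw [d_of_cell hc] at this
  simp only [cob, Pi.zero_apply] at this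
  linear_combination this

section
variable {p q r s : Fin 4 → ℤ} (h : D p q r s = 1)
include h

lemma cell_two : dat.Cell [sq p, sq q, sq r, sq s, sq (p + q), sq (r + s)] :=
  cell_arc h (l := [4, 7, 9, 3, 5, 2]) (by decide) (by decide) (by decide +kernel)

lemma cell_three :
    dat.Cell [sq (p + q), sq p, sq q, sq r, sq s, sq (p + q + r)] :=
  cell_arc h (l := [5, 4, 7, 9, 3, 6]) (by decide) (by decide) (by decide +kernel)

lemma cell_four :
    dat.Cell [sq (p + q), sq p, sq q, sq r, sq s, sq (p + q + r + s)] :=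
  cell_arc h (l := [5, 4, 7, 9, 3, 0]) (by decide) (by decide) (by decide +kernel)

lemma not_span_three : ¬Sys.Span [sq (p + q), sq p, sq q, sq r, sq (p + q + r)] := by
  refine not_span (p := p) (q := q) (r := r) (t := s) (by rw [h]; decide) ?_
  simp only [List.forall_mem_cons, List.not_mem_nil, false_imp_iff, implies_true, and_true]
  refine ⟨⟨_, rfl, ?_⟩, ⟨_, rfl, ?_⟩, ⟨_, rfl, ?_⟩, ⟨_, rfl, ?_⟩, ⟨_, rfl, ?_⟩⟩ <;>
    simp [D_eq] <;> ring

end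

section
variable {x : List S → ℂ} (hx : x ∈ cochains 5) (hd : dat.d x = 0)
include hx

lemma tri_neg (a b c d) : tri x (-a) (-b) c d = tri x a b c d := by
  rw [tri, ← neg_add, sq_neg, sq_neg, sq_neg, tri]

lemma tri_flip (a b c d) : tri x a b d (-c) = -tri x a b c d := by
  rw [tri, sq_neg]
  exact hx.1 [_, _] _ _ [_]

lemma tri_swap (a b c d) : tri x b a (-c) d = -tri x a b c d := by
  rw [tri, sq_neg, add_comm]
  exact hx.1 [] _ _ [_, _, _]

lemma tri_rot (a b c d) : tri x a (-a - b) (-c) d = -tri x a b c d := by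
  rw [tri, sq_neg, show -a - b = -(a + b) by abel, show a + -(a + b) = -b by abel, sq_neg, sq_neg,
    tri]
  have h1 := hx.1 [sq a] (sq (a + b)) (sq c) [sq d, sq b]
  have h2 := hx.1 [sq a, sq c] (sq (a + b)) (sq d) [sq b]
  have h3 := hx.1 [sq a, sq c, sq d] (sq (a + b)) (sq b) []
  have h4 := hx.1 [sq a, sq c] (sq b) (sq d) [sq (a + b)]
  have h5 := hx.1 [sq a] (sq b) (sq c) [sq d, sq (a + b)]
  simp only [List.cons_append, List.nil_append] at h1 h2 h3 h4 h5
  linear_combination h1 - h2 + h3 - h4 + h5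

lemma onRows_tri {p q r s : Fin 4 → ℤ} {a b c d : ZMod 11} (h : D p q r s = 1) (ha : ell p = a)
    (hb : ell q = b) (hc : ell r = c) (hd : ell s = d) :
    onRows (tri x) a b c d = tri x p q r s :=
  onRows_eq (tri_gamma hx) h ha hb hc hd

include hd

lemma tri_two {a b c d} (h : D a b c d = 1) :
    tri x c d (-b) (a + b) - tri x c d a (a + b) - tri x a b (-d) (c + d) + tri x a b c (c + d)
      + tri x c d a b - tri x a b c d = 0 := by
  have hc := cob_five hd (cell_two h)
  simp only [tri, sq_neg]
  have s0 (a b c d e) : x [b, a, c, d, e] = -x [a, b, c, d, e] := hx.1 [] b a [c, d, e]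
  have s1 (a b c d e) : x [a, c, b, d, e] = -x [a, b, c, d, e] := hx.1 [a] c b [d, e]
  have s2 (a b c d e) : x [a, b, d, c, e] = -x [a, b, c, d, e] := hx.1 [a, b] d c [e]
  have s3 (a b c d e) : x [a, b, c, e, d] = -x [a, b, c, d, e] := hx.1 [a, b, c] e d []
  have r (a b c d e) : x [b, c, a, d, e] = x [a, b, c, d, e] := by rw [s1, s0, neg_neg]
  have r' (a b c d e) : x [c, d, a, b, e] = x [a, b, c, d, e] := by
    rw [r, s2, s1, s2, s1, s1, s2]
    ring
  rw [r (sq b), r (sq a), s3 (sq a) (sq b) (sq d), s3 (sq a) (sq b) (sq c), r' (sq a)]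
  linear_combination hc

lemma tri_four {a b c d} (h : D a b c d = 1) : x [sq a, sq b, sq c, sq d, sq (a + b + c)] =
    -tri x (a + b) c (-b) d + tri x (a + b) c a d + tri x a b (-d) (a + b + c) + tri x a b c d := by
  have hc := cob_five hd (cell_three h)
  have h0 : x [sq (a + b), sq a, sq b, sq c, sq (a + b + c)] = 0 := by
    by_contra h0
    exact not_span_three h (dat_cell_iff.1 (hx.2.1 _ h0).1).2
  simp only [tri, sq_neg]
  have s1 (a b c d e) : x [a, c, b, d, e] = -x [a, b, c, d, e] := hx.1 [a] c b [d, e]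
  have r (a b c d e) : x [b, c, d, e, a] = x [a, b, c, d, e] := by
    rw [show x [b, c, d, e, a] = -x [b, c, d, a, e] from hx.1 [b, c, d] e a [],
      show x [b, c, d, a, e] = -x [b, c, a, d, e] from hx.1 [b, c] d a [e],
      show x [b, c, a, d, e] = -x [b, a, c, d, e] from hx.1 [b] c a [d, e],
      show x [b, a, c, d, e] = -x [a, b, c, d, e] from hx.1 [] b a [c, d, e]]
    ring
  rw [s1 _ (sq b), s1 _ (sq a), r (sq (a + b)) (sq a) (sq b) (sq d),
    r (sq (a + b)) (sq a) (sq b) (sq c)]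
  linear_combination hc - h0

theorem rel_tri : ModEleven.Rel (onRows (tri x)) := by
  have h0 : onRows (tri x) 0 0 0 0 = 0 := onRows_zero
  have key (P : ZMod 11 → ZMod 11 → ZMod 11 → ZMod 11 → Prop) (hz : P 0 0 0 0)
      (hP : ∀ p q r s, D p q r s = 1 → P (ell p) (ell q) (ell r) (ell s)) (a b c d) :
      P a b c d := by
    by_cases hn : a ≠ 0 ∨ b ≠ 0 ∨ c ≠ 0 ∨ d ≠ 0
    · obtain ⟨v, h, rfl, rfl, rfl, rfl⟩ := exists_base hn
      exact hP _ _ _ _ h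
    · simp only [not_or, not_not] at hn
      obtain ⟨rfl, rfl, rfl, rfl⟩ := hn
      exact hz
  have E {p q r s : Fin 4 → ℤ} (h : D p q r s = 1) (p' q' r' s' : Fin 4 → ℤ)
      (h' : D p' q' r' s' = D p q r s) :
      onRows (tri x) (ell p') (ell q') (ell r') (ell s') = tri x p' q' r' s' :=
    onRows_tri hx (h'.trans h) rfl rfl rfl rfl
  refine ⟨key _ ?_ ?_, key _ ?_ ?_, key _ ?_ ?_, key _ ?_ ?_, onRows_dbl (tri_gamma hx), key _ ?_ ?_,
    key _ ?_ ?_⟩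
  all_goals first
    | (intro p q r s h
       have e0 := E h p q r s rfl)
    | (simp [h0]; done)
  · have e1 := E h (-p) (-q) r s
      (by simp only [D_eq, Pi.add_apply, Pi.neg_apply, Pi.sub_apply]; ring1)
    simp only [ell_add, ell_neg, ell_sub] at e1
    rw [e1, e0, tri_neg hx]
  · have e1 := E h p q s (-r)
      (by simp only [D_eq, Pi.add_apply, Pi.neg_apply, Pi.sub_apply]; ring1)
    simp only [ell_add, ell_neg, ell_sub] at e1
    rw [e1, e0, tri_flip hx]
  · have e1 := E h q p (-r) s
      (by simp only [D_eq, Pi.add_apply, Pi.neg_apply, Pi.sub_apply]; ring1)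
    simp only [ell_add, ell_neg, ell_sub] at e1
    rw [e1, e0, tri_swap hx]
  · have e1 := E h p (-p - q) (-r) s
      (by simp only [D_eq, Pi.add_apply, Pi.neg_apply, Pi.sub_apply]; ring1)
    simp only [ell_add, ell_neg, ell_sub] at e1
    rw [e1, e0, tri_rot hx]
  · have e1 := E h r s (-q) (p + q)
      (by simp only [D_eq, Pi.add_apply, Pi.neg_apply, Pi.sub_apply]; ring1)
    have e2 := E h r s p (p + q)
      (by simp only [D_eq, Pi.add_apply, Pi.neg_apply, Pi.sub_apply]; ring1)
    have e3 := E h p q (-s) (r + s)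
      (by simp only [D_eq, Pi.add_apply, Pi.neg_apply, Pi.sub_apply]; ring1)
    have e4 := E h p q r (r + s)
      (by simp only [D_eq, Pi.add_apply, Pi.neg_apply, Pi.sub_apply]; ring1)
    have e5 := E h r s p q
      (by simp only [D_eq, Pi.add_apply, Pi.neg_apply, Pi.sub_apply]; ring1)
    simp only [ell_add, ell_neg, ell_sub] at e1 e2 e3 e4 e5
    rw [e1, e2, e3, e4, e5, e0, tri_two hx hd h]
  · have e1 := E h (p + q) r (-q) s
      (by simp only [D_eq, Pi.add_apply, Pi.neg_apply, Pi.sub_apply]; ring1)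
    have e2 := E h (p + q) r p s
      (by simp only [D_eq, Pi.add_apply, Pi.neg_apply, Pi.sub_apply]; ring1)
    have e3 := E h p q (-s) (p + q + r)
      (by simp only [D_eq, Pi.add_apply, Pi.neg_apply, Pi.sub_apply]; ring1)
    have e4 := E h (q + r) p (-r) s
      (by simp only [D_eq, Pi.add_apply, Pi.neg_apply, Pi.sub_apply]; ring1)
    have e5 := E h (q + r) p q s
      (by simp only [D_eq, Pi.add_apply, Pi.neg_apply, Pi.sub_apply]; ring1)
    have e6 := E h q r (-s) (q + r + p)
      (by simp only [D_eq, Pi.add_apply, Pi.neg_apply, Pi.sub_apply]; ring1)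
    have e7 := E h q r p s
      (by simp only [D_eq, Pi.add_apply, Pi.neg_apply, Pi.sub_apply]; ring1)
    simp only [ell_add, ell_neg, ell_sub] at e1 e2 e3 e4 e5 e6 e7
    have hc : D q r p s = 1 := by rw [← h]; simp only [D_eq]; ring1
    rw [e1, e2, e3, e4, e5, e6, e7, e0, ← tri_four hx hd h, ← tri_four hx hd hc,
      show q + r + p = p + q + r by abel,
      show x [sq q, sq r, sq p, sq s, sq (p + q + r)] =
        -x [sq q, sq p, sq r, sq s, sq (p + q + r)] from hx.1 [sq q] _ _ [_, _],
      show x [sq q, sq p, sq r, sq s, sq (p + q + r)] =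
        -x [sq p, sq q, sq r, sq s, sq (p + q + r)] from hx.1 [] _ _ [_, _, _], neg_neg]

theorem eq_zero_of_onRows (hz : ∀ a b c d, onRows (tri x) a b c d = 0) : x = 0 := by
  have h3 {a b c d} (h : D a b c d = 1) : tri x a b c d = 0 := by
    rw [← onRows_tri hx h rfl rfl rfl rfl, hz]
  have h4 {a b c d} (h : D a b c d = 1) : x [sq a, sq b, sq c, sq d, sq (a + b + c)] = 0 := by
    rw [tri_four hx hd h, h3, h3, h3, h3 h]
    · ring
    all_goals rw [← h]; simp [D_eq]; ring1
  have hP {l l' : List S} (h : l.Perm l') (h0 : x l' = 0) : x l = 0 := alt_perm_zero hx.1 h h0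
  funext l
  by_contra hl
  obtain ⟨hc, h5⟩ := hx.2.1 l hl
  obtain ⟨a, b, c, d, h, hp⟩ := shape_of_cell hc h5
  apply hl
  rcases hp with hp | hp | hp
  · exact hP hp (h3 h)
  · exact hP hp (h4 h)
  · refine hP hp ?_
    have hc := cob_five hd (cell_four h)
    have e1 : x [sq (a + b), sq b, sq c, sq d, sq (a + b + c + d)] = 0 := by
      refine hP (.cons _ ((List.perm_append_comm (l₁ := [sq b]) (l₂ := [sq c, sq d])).append_right
        [_])) (h4 (a := a + b) (b := c) (c := d) (d := b) ?_)
      rw [← h]; simp only [D_eq, Pi.add_apply]; ring1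
    have e2 : x [sq (a + b), sq a, sq c, sq d, sq (a + b + c + d)] = 0 := by
      have h' : D c (a + b) d a = 1 := by rw [← h]; simp only [D_eq, Pi.add_apply]; ring1
      rw [show a + b + c + d = c + (a + b) + d by abel]
      refine hP ?_ (h4 h')
      exact (List.Perm.cons _ ((List.perm_append_comm (l₁ := [sq a]) (l₂ := [sq c, sq d])).append_right
        [_])).trans (.swap _ _ _)
    have e3 : x [sq (a + b), sq a, sq b, sq d, sq (a + b + c + d)] = 0 := by
      have h' : D a b (-d) (a + b + c + d) = 1 := by
        rw [← h]; simp only [D_eq, Pi.add_apply, Pi.neg_apply]; ring1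
      have := h3 h'
      rw [tri, sq_neg] at this
      exact hP (List.perm_append_comm (l₁ := [_]) (l₂ := [_, _, _, _])) this
    have e4 : x [sq (a + b), sq a, sq b, sq c, sq (a + b + c + d)] = 0 := by
      have h' : D a b c (a + b + c + d) = 1 := by
        rw [← h]; simp only [D_eq, Pi.add_apply]; ring1
      exact hP (List.perm_append_comm (l₁ := [_]) (l₂ := [_, _, _, _])) (h3 h')
    have e5 : x [sq (a + b), sq a, sq b, sq c, sq d] = 0 :=
      hP (List.perm_append_comm (l₁ := [_]) (l₂ := [_, _, _, _])) (h3 h)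
    linear_combination hc + e1 - e2 + e3 - e4 + e5

end

end SymForm

/-! ### Cochains from functions of vectors -/

namespace SymForm

open Matrix ListCochain FrameData

/-- A choice of a square root. -/
noncomputable def root (x : S) : Fin 4 → ℤ := Function.invFun sq x

lemma root_sq (v : Fin 4 → ℤ) : root (sq v) = v ∨ root (sq v) = -v :=
  sq_eq_sq (Function.invFun_eq ⟨v, rfl⟩)

lemma exists_map_sq {l : List S} (h : dat.Cell l) : ∃ L : List (Fin 4 → ℤ), l = L.map sq := by
  obtain ⟨⟨Q, hQ⟩, -⟩ := dat_cell_iff.1 h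
  have hl : ∀ x ∈ l, ∃ v, sq v = x := fun x hx => face_exists_sq hQ hx
  clear h hQ
  induction l with
  | nil => exact ⟨[], rfl⟩
  | cons x l ih =>
    obtain ⟨L, rfl⟩ := ih fun y hy => hl y (List.mem_cons_of_mem _ hy)
    obtain ⟨v, rfl⟩ := hl x List.mem_cons_self
    exact ⟨v :: L, rfl⟩

/-- Functions of lists of vectors inducing invariant cochains. -/
structure Liftable (Φ : List (Fin 4 → ℤ) → ℂ) : Prop where
  alt : Alt Φ
  even : ∀ p a s, Φ (p ++ (-a) :: s) = Φ (p ++ a :: s)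
  gamma : ∀ g ∈ Gamma0 11, ∀ l, Φ (l.map (g.1 *ᵥ ·)) = Φ l

open Classical in
/-- The cochain induced by a function of lists of vectors. -/
noncomputable def lift (n : ℕ) (Φ : List (Fin 4 → ℤ) → ℂ) (l : List S) : ℂ :=
  if dat.Cell l ∧ l.length = n then Φ (l.map root) else 0

attribute [local instance] FrameData.listAction

section
variable {Φ : List (Fin 4 → ℤ) → ℂ} (hΦ : Liftable Φ)
include hΦ

lemma Liftable.map_root (l : List (Fin 4 → ℤ)) : Φ ((l.map sq).map root) = Φ l := by
  suffices h : ∀ p, Φ (p ++ (l.map sq).map root) = Φ (p ++ l) from h []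
  induction l with
  | nil => simp
  | cons a l ih =>
    intro p
    have h1 := ih (p ++ [root (sq a)])
    simp only [List.append_assoc, List.cons_append, List.nil_append] at h1
    rw [List.map_cons, List.map_cons, h1]
    rcases root_sq a with h | h
    · rw [h]
    · rw [h, hΦ.even]

lemma lift_apply {n : ℕ} {l : List (Fin 4 → ℤ)} (hc : dat.Cell (l.map sq)) (hn : l.length = n) :
    lift n Φ (l.map sq) = Φ l := by
  rw [lift, if_pos ⟨hc, by simpa⟩, hΦ.map_root]

lemma lift_mem (n : ℕ) : lift n Φ ∈ cochains n := by
  obtain ⟨U, hU⟩ := exists_symmetry 11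
  refine ⟨?_, fun l hl => ?_, fun g l => ?_⟩
  · classical
    exact (hΦ.alt.map root).ite fun l l' hp h => ⟨h.1.perm hp, hp.length_eq ▸ h.2⟩
  · by_contra hc
    exact hl (if_neg hc)
  · have hg : dat.Cell (g • l) ↔ dat.Cell l := by
      refine ⟨fun h => ?_, fun h => hU.cell g l h⟩
      have := hU.cell g⁻¹ _ h
      rwa [inv_smul_smul] at this
    by_cases hc : dat.Cell l
    · have hc' := hg.2 hc
      obtain ⟨L, rfl⟩ := exists_map_sq hc
      have hL : g • L.map sq = (L.map (g.1.1 *ᵥ ·)).map sq := by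
        rw [smul_list, List.map_map, List.map_map]
        exact List.map_congr_left fun v _ => smul_sq g.1 v
      rw [hL] at hc' ⊢
      by_cases hn : L.length = n
      · rw [lift_apply hΦ hc' (by simpa), lift_apply hΦ hc hn, hΦ.gamma g.1 g.2]
      · rw [lift, if_neg (by simp [hn]), lift, if_neg (by simp [hn])]
    · rw [lift, if_neg fun h => hc (hg.1 h.1), lift, if_neg fun h => hc h.1]

end

/-- A function of four vectors as a function of lists. -/
def ofFour (f : (Fin 4 → ℤ) → (Fin 4 → ℤ) → (Fin 4 → ℤ) → (Fin 4 → ℤ) → ℂ) :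
    List (Fin 4 → ℤ) → ℂ
  | [a, b, c, d] => f a b c d
  | _ => 0

lemma liftable_ofFour {f : (Fin 4 → ℤ) → (Fin 4 → ℤ) → (Fin 4 → ℤ) → (Fin 4 → ℤ) → ℂ}
    (h₁ : ∀ a b c d, f a b c d = -f b a c d) (h₂ : ∀ a b c d, f a b c d = -f a c b d)
    (h₃ : ∀ a b c d, f a b c d = -f a b d c) (hn : ∀ a b c d, f (-a) b c d = f a b c d)
    (hg : ∀ g ∈ Gamma0 11, ∀ a b c d,
      f (g.1 *ᵥ a) (g.1 *ᵥ b) (g.1 *ᵥ c) (g.1 *ᵥ d) = f a b c d) : Liftable (ofFour f) := by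
  have n₂ (a b c d) : f a (-b) c d = f a b c d := by rw [h₁, hn, h₁, neg_neg]
  have n₃ (a b c d) : f a b (-c) d = f a b c d := by rw [h₂, n₂, h₂, neg_neg]
  have n₄ (a b c d) : f a b c (-d) = f a b c d := by rw [h₃, n₃, h₃, neg_neg]
  refine ⟨fun p a b s => ?_, fun p a s => ?_, fun g hg' l => ?_⟩
  · rcases p with - | ⟨p, - | ⟨q, - | ⟨r, p'⟩⟩⟩ <;> rcases s with - | ⟨s, - | ⟨t, - | ⟨u, s'⟩⟩⟩
    all_goals first
      | exact h₁ _ _ _ _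
      | exact h₂ _ _ _ _
      | exact h₃ _ _ _ _
      | exact (neg_zero (G := ℂ)).symm
      | (rcases p' with - | ⟨_, - | ⟨_, p'⟩⟩ <;> exact (neg_zero (G := ℂ)).symm)
  · rcases p with - | ⟨p, - | ⟨q, - | ⟨r, - | ⟨_, p'⟩⟩⟩⟩ <;>
      rcases s with - | ⟨s, - | ⟨t, - | ⟨u, - | ⟨_, s'⟩⟩⟩⟩
    all_goals first
      | exact hn _ _ _ _
      | exact n₂ _ _ _ _
      | exact n₃ _ _ _ _
      | exact n₄ _ _ _ _
      | rfl
      | (rcases p' with - | ⟨_, - | ⟨_, p'⟩⟩ <;> rfl)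
  · rcases l with - | ⟨a, - | ⟨b, - | ⟨c, - | ⟨d, - | ⟨e, l⟩⟩⟩⟩⟩
    all_goals first
      | rfl
      | exact hg g hg' _ _ _ _

/-- A function of five vectors as a function of lists. -/
def ofFive (f : (Fin 4 → ℤ) → (Fin 4 → ℤ) → (Fin 4 → ℤ) → (Fin 4 → ℤ) → (Fin 4 → ℤ) → ℂ) :
    List (Fin 4 → ℤ) → ℂ
  | [a, b, c, d, e] => f a b c d e
  | _ => 0

lemma liftable_ofFive
    {f : (Fin 4 → ℤ) → (Fin 4 → ℤ) → (Fin 4 → ℤ) → (Fin 4 → ℤ) → (Fin 4 → ℤ) → ℂ}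
    (h₁ : ∀ a b c d e, f a b c d e = -f b a c d e) (h₂ : ∀ a b c d e, f a b c d e = -f a c b d e)
    (h₃ : ∀ a b c d e, f a b c d e = -f a b d c e) (h₄ : ∀ a b c d e, f a b c d e = -f a b c e d)
    (hn : ∀ a b c d e, f (-a) b c d e = f a b c d e)
    (hg : ∀ g ∈ Gamma0 11, ∀ a b c d e,
      f (g.1 *ᵥ a) (g.1 *ᵥ b) (g.1 *ᵥ c) (g.1 *ᵥ d) (g.1 *ᵥ e) = f a b c d e) :
    Liftable (ofFive f) := by
  have n₂ (a b c d e) : f a (-b) c d e = f a b c d e := by rw [h₁, hn, h₁, neg_neg]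
  have n₃ (a b c d e) : f a b (-c) d e = f a b c d e := by rw [h₂, n₂, h₂, neg_neg]
  have n₄ (a b c d e) : f a b c (-d) e = f a b c d e := by rw [h₃, n₃, h₃, neg_neg]
  have n₅ (a b c d e) : f a b c d (-e) = f a b c d e := by rw [h₄, n₄, h₄, neg_neg]
  refine ⟨fun p a b s => ?_, fun p a s => ?_, fun g hg' l => ?_⟩
  · rcases p with - | ⟨p, - | ⟨q, - | ⟨r, - | ⟨_, p'⟩⟩⟩⟩ <;>
      rcases s with - | ⟨s, - | ⟨t, - | ⟨u, - | ⟨_, s'⟩⟩⟩⟩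
    all_goals first
      | exact h₁ _ _ _ _ _
      | exact h₂ _ _ _ _ _
      | exact h₃ _ _ _ _ _
      | exact h₄ _ _ _ _ _
      | exact (neg_zero (G := ℂ)).symm
      | (rcases p' with - | ⟨_, - | ⟨_, p'⟩⟩ <;> exact (neg_zero (G := ℂ)).symm)
  · rcases p with - | ⟨p, - | ⟨q, - | ⟨r, - | ⟨_, - | ⟨_, p'⟩⟩⟩⟩⟩ <;>
      rcases s with - | ⟨s, - | ⟨t, - | ⟨u, - | ⟨_, - | ⟨_, s'⟩⟩⟩⟩⟩
    all_goals first
      | exact hn _ _ _ _ _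
      | exact n₂ _ _ _ _ _
      | exact n₃ _ _ _ _ _
      | exact n₄ _ _ _ _ _
      | exact n₅ _ _ _ _ _
      | rfl
      | (rcases p' with - | ⟨_, - | ⟨_, p'⟩⟩ <;> rfl)
  · rcases l with - | ⟨a, - | ⟨b, - | ⟨c, - | ⟨d, - | ⟨e, - | ⟨_, l⟩⟩⟩⟩⟩⟩
    all_goals first
      | rfl
      | exact hg g hg' _ _ _ _ _

end SymForm

namespace ModEleven

/-- The symmetries of the values of an invariant cochain on frames. -/
structure Quad (H : ZMod 11 → ZMod 11 → ZMod 11 → ZMod 11 → ℂ) : Prop where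
  swap₁ : ∀ a b c d, H b (-a) c d = -H a b c d
  swap₂ : ∀ a b c d, H a c (-b) d = -H a b c d
  swap₃ : ∀ a b c d, H a b d (-c) = -H a b c d
  dbl : ∀ a b c d, H (2 * a) (2 * b) (2 * c) (2 * d) = H a b c d

/-- The values on triangles of the coboundary of a cochain. -/
def bdr (H : ZMod 11 → ZMod 11 → ZMod 11 → ZMod 11 → ℂ) (a b c d : ZMod 11) : ℂ :=
  H (-b) c d (a + b) - H a c d (a + b) + H a b c d

section
variable {H : ZMod 11 → ZMod 11 → ZMod 11 → ZMod 11 → ℂ} (hH : Quad H)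
include hH

lemma Quad.neg₁₂ (a b c d) : H (-a) (-b) c d = H a b c d := by
  rw [hH.swap₁, hH.swap₁, neg_neg]

lemma Quad.neg₂₃ (a b c d) : H a (-b) (-c) d = H a b c d := by
  rw [hH.swap₂, hH.swap₂, neg_neg]

lemma Quad.neg₃₄ (a b c d) : H a b (-c) (-d) = H a b c d := by
  rw [hH.swap₃, hH.swap₃, neg_neg]

lemma Quad.bdr_first : bdr H 0 0 1 3 = 0 := by
  have h := hH.swap₁ 0 0 1 3
  simp only [bdr, neg_zero, add_zero] at h ⊢
  linear_combination h / 2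

lemma Quad.neg₂ (a b c d) : H a (-b) c d = H (-a) b c d := by
  rw [← hH.neg₁₂ (-a) b, neg_neg]

lemma Quad.neg₃ (a b c d) : H a b (-c) d = H (-a) b c d := by
  rw [← hH.neg₂, ← hH.neg₂₃ a (-b) c d, neg_neg]

lemma Quad.neg₄ (a b c d) : H a b c (-d) = H (-a) b c d := by
  rw [← hH.neg₃, ← hH.neg₃₄ a b (-c) d, neg_neg]

lemma Quad.comm₁₂ (a b c d) : H b a c d = -H (-a) b c d := by
  rw [← hH.swap₁, neg_neg]

lemma Quad.comm₂₃ (a b c d) : H a c b d = -H (-a) b c d := by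
  rw [← hH.swap₂, hH.neg₃, neg_neg]

lemma Quad.comm₃₄ (a b c d) : H a b d c = -H (-a) b c d := by
  rw [← hH.swap₃, hH.neg₄, neg_neg]

lemma Quad.scale {u : ZMod 11} (hu : u ≠ 0) (a b c d) :
    H (u * a) (u * b) (u * c) (u * d) = H a b c d := by
  have h (k : ℕ) : H (2 ^ k * a) (2 ^ k * b) (2 ^ k * c) (2 ^ k * d) = H a b c d := by
    induction k with
    | zero => simp
    | succ k ih => simp only [pow_succ', mul_assoc, hH.dbl, ih]
  obtain ⟨k, rfl⟩ : ∃ k : Fin 10, u = 2 ^ k.1 := by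
    revert u
    decide +kernel
  exact h k

lemma Quad.bdr_second : bdr H 0 1 1 3 + bdr H 1 1 1 3 - 2 * bdr H 0 1 2 3 = 0 := by
  have e2 : (1 + 1 : ZMod 11) = 2 := by decide
  have h1 := hH.comm₂₃ 0 1 1 3
  have h2 := hH.comm₃₄ 0 1 1 3
  have h3 := hH.comm₃₄ (-1) 1 1 3
  have h4 := hH.comm₁₂ 1 1 3 2
  have h5 := hH.comm₃₄ (-1) 2 1 3
  have h6 := hH.comm₂₃ 1 1 2 3
  have h7 := hH.comm₃₄ (-1) 1 3 2
  have h8 := hH.comm₃₄ 0 2 1 3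
  have h9 := hH.comm₂₃ 0 1 2 3
  simp only [bdr, zero_add, e2, neg_neg, neg_zero] at *
  linear_combination -h2 + h1 + h3 + h4 - 2 * h5 + 2 * h6 - 2 * h7 + 2 * h8 - 2 * h9

end

end ModEleven

namespace SymForm

open Matrix ListCochain FrameData ModEleven

/-- The value of a cochain on a frame. -/
def quad (y : List S → ℂ) (a b c d : Fin 4 → ℤ) : ℂ := y [sq a, sq b, sq c, sq d]

section
variable {y : List S → ℂ} (hy : y ∈ cochains 4)
include hy

lemma quad_gamma : ∀ g ∈ Gamma0 11, ∀ a b c d,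
    quad y (g.1 *ᵥ a) (g.1 *ᵥ b) (g.1 *ᵥ c) (g.1 *ᵥ d) = quad y a b c d := by
  intro g hg a b c d
  rw [quad, quad]
  simp only [← smul_sq]
  exact hy.2.2 ⟨g, hg⟩ [sq a, sq b, sq c, sq d]

lemma onRows_quad {p q r s : Fin 4 → ℤ} (h : D p q r s = 1) :
    onRows (quad y) (ell p) (ell q) (ell r) (ell s) = quad y p q r s :=
  onRows_eq (quad_gamma hy) h rfl rfl rfl rfl

omit hy in
lemma forall_rows (P : ZMod 11 → ZMod 11 → ZMod 11 → ZMod 11 → Prop) (hz : P 0 0 0 0)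
    (hP : ∀ p q r s, D p q r s = 1 → P (ell p) (ell q) (ell r) (ell s)) (a b c d) :
    P a b c d := by
  by_cases hn : a ≠ 0 ∨ b ≠ 0 ∨ c ≠ 0 ∨ d ≠ 0
  · obtain ⟨v, h, rfl, rfl, rfl, rfl⟩ := exists_base hn
    exact hP _ _ _ _ h
  · simp only [not_or, not_not] at hn
    obtain ⟨rfl, rfl, rfl, rfl⟩ := hn
    exact hz

lemma quad_onRows : Quad (onRows (quad y)) := by
  have h0 : onRows (quad y) 0 0 0 0 = 0 := onRows_zero
  refine ⟨forall_rows _ (by simp [h0]) fun p q r s h => ?_,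
    forall_rows _ (by simp [h0]) fun p q r s h => ?_,
    forall_rows _ (by simp [h0]) fun p q r s h => ?_, onRows_dbl (quad_gamma hy)⟩
  · have h' : D q (-p) r s = 1 := by rw [← h]; simp only [D_eq, Pi.neg_apply]; ring1
    rw [← ell_neg, onRows_quad hy h', onRows_quad hy h, quad, sq_neg]
    exact hy.1 [] _ _ [_, _]
  · have h' : D p r (-q) s = 1 := by rw [← h]; simp only [D_eq, Pi.neg_apply]; ring1
    rw [← ell_neg, onRows_quad hy h', onRows_quad hy h, quad, sq_neg]
    exact hy.1 [_] _ _ [_]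
  · have h' : D p q s (-r) = 1 := by rw [← h]; simp only [D_eq, Pi.neg_apply]; ring1
    rw [← ell_neg, onRows_quad hy h', onRows_quad hy h, quad, sq_neg]
    exact hy.1 [_, _] _ _ []

lemma onRows_d (hx : dat.d y ∈ cochains 5) (a b c d) :
    onRows (tri (dat.d y)) a b c d = bdr (onRows (quad y)) a b c d := by
  revert a b c d
  refine forall_rows _ (by simp [bdr, onRows_zero]) fun p q r s h => ?_
  have h1 : D (-q) r s (p + q) = 1 := by
    rw [← h]; simp only [D_eq, Pi.neg_apply, Pi.add_apply]; ring1
  have h2 : D p r s (p + q) = 1 := by rw [← h]; simp only [D_eq, Pi.add_apply]; ring1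
  rw [onRows_tri hx h rfl rfl rfl rfl, bdr, ← ell_neg, ← ell_add, onRows_quad hy h1,
    onRows_quad hy h2, onRows_quad hy h]
  have hc : dat.Cell [sq p, sq q, sq r, sq s, sq (p + q)] :=
    cell_arc h (l := [4, 7, 9, 3, 5]) (by decide) (by decide) (by decide +kernel)
  have z (t : Fin 4 → ℤ) (ht : t = r ∨ t = s) : y [sq p, sq q, sq t, sq (p + q)] = 0 := by
    by_contra h0
    refine not_span (p := p) (q := q) (r := t) (t := if t = r then s else r) ?_ ?_
      (dat_cell_iff.1 (hy.2.1 _ h0).1).2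
    · split_ifs with hr
      · rw [hr, h]; decide
      · rw [ht.resolve_left hr, D_swap₃, h]; decide
    · simp only [List.forall_mem_cons, List.not_mem_nil, false_imp_iff, implies_true, and_true]
      refine ⟨⟨_, rfl, ?_⟩, ⟨_, rfl, ?_⟩, ⟨_, rfl, ?_⟩, ⟨_, rfl, ?_⟩⟩ <;>
        simp [D_eq] <;> ring
  have zr := z r (.inl rfl)
  have zs := z s (.inr rfl)
  rw [tri, d_of_cell hc, quad, quad, quad, sq_neg]
  simp only [cob]
  linear_combination zs - zr

end

/-- Every symmetric function of rows comes from a cochain. -/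
theorem exists_cochain {H : ZMod 11 → ZMod 11 → ZMod 11 → ZMod 11 → ℂ} (hH : Quad H)
    (h0 : H 0 0 0 0 = 0) : ∃ y ∈ cochains 4, onRows (quad y) = H := by
  classical
  let f (a b c d : Fin 4 → ℤ) : ℂ := if D a b c d = 1 then H (ell a) (ell b) (ell c) (ell d) else
    if D a b c d = -1 then H (-ell a) (ell b) (ell c) (ell d) else 0
  have hf : Liftable (ofFour f) := by
    refine liftable_ofFour (fun a b c d => ?_) (fun a b c d => ?_) (fun a b c d => ?_)
      (fun a b c d => ?_) (fun g hg a b c d => ?_)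
    · simp only [f]
      rw [D_swap₁ b a]
      split_ifs <;> first | omega | simp [hH.comm₁₂ (ell a), hH.comm₁₂ (-ell a), hH.neg₁₂]
    · simp only [f]
      rw [D_swap₂ a c b]
      split_ifs <;> first | omega | simp [hH.comm₂₃ _ (ell b)]
    · simp only [f]
      rw [D_swap₃ a b d c]
      split_ifs <;> first | omega | simp [hH.comm₃₄ _ _ (ell c)]
    · simp only [f]
      rw [show D (-a) b c d = -D a b c d by simp only [D_eq, Pi.neg_apply]; ring1, ell_neg]
      split_ifs <;> first | omega | simp
    · simp only [f]
      rw [D_smul_vec, ell_gamma hg, ell_gamma hg, ell_gamma hg, ell_gamma hg, ← mul_neg,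
        hH.scale (gamma_unit hg), hH.scale (gamma_unit hg)]
  refine ⟨lift 4 (ofFour f), lift_mem hf 4, ?_⟩
  funext a b c d
  revert a b c d
  refine forall_rows _ (by rw [onRows_zero, h0]) fun p q r s h => ?_
  rw [onRows_quad (lift_mem hf 4) h, quad]
  have hc : dat.Cell ([p, q, r, s].map sq) :=
    cell_arc h (l := [4, 7, 9, 3]) (by decide) (by decide) (by decide +kernel)
  exact (lift_apply hf hc rfl).trans (if_pos h)

end SymForm

namespace ModEleven

/-- The distance to zero. -/
def ab (a : ZMod 11) : ℤ := if a.val ≤ 5 then a.val else 11 - a.val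

/-- An odd sign. -/
def sg (a : ZMod 11) : ℤ := if a = 0 then 0 else if a.val ≤ 5 then 1 else -1

lemma ab_neg : ∀ a, ab (-a) = ab a := by decide +kernel

lemma sg_neg : ∀ a, sg (-a) = -sg a := by decide +kernel

/-- The alternating (`e = 0`) or odd symmetric (`e ≠ 0`) function supported on the rows whose
distances to zero form a given multiset, coded in base ten. -/
def unitRow (e n : ℕ) (a b c d : ZMod 11) : ℤ :=
  if 10 ^ (ab a).toNat + 10 ^ (ab b).toNat + 10 ^ (ab c).toNat + 10 ^ (ab d).toNat = n then
    if e = 0 then (ab b - ab a) * (ab c - ab a) * (ab d - ab a) * (ab c - ab b) * (ab d - ab b) *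
      (ab d - ab c)
    else 12 * (sg a * sg b * sg c * sg d)
  else 0

lemma unitRow_swap₁ (e n a b c d) : unitRow e n b (-a) c d = -unitRow e n a b c d := by
  simp only [unitRow, ab_neg, sg_neg, add_comm (10 ^ (ab b).toNat)]
  split_ifs <;> ring1

lemma unitRow_swap₂ (e n a b c d) : unitRow e n a c (-b) d = -unitRow e n a b c d := by
  simp only [unitRow, ab_neg, sg_neg, add_right_comm _ (10 ^ (ab c).toNat)]
  split_ifs <;> ring1

lemma unitRow_swap₃ (e n a b c d) : unitRow e n a b d (-c) = -unitRow e n a b c d := by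
  simp only [unitRow, ab_neg, sg_neg, add_right_comm _ (10 ^ (ab d).toNat)]
  split_ifs <;> ring1

lemma unitRow_neg (e n a b c d) : unitRow e n (-a) (-b) (-c) (-d) = unitRow e n a b c d := by
  simp only [unitRow, ab_neg, sg_neg]
  split_ifs <;> ring1

/-- The symmetrisation of `unitRow` under scaling. -/
def orbitRow (e n : ℕ) (a b c d : ZMod 11) : ℤ :=
  unitRow e n a b c d + unitRow e n (2 * a) (2 * b) (2 * c) (2 * d) +
  unitRow e n (4 * a) (4 * b) (4 * c) (4 * d) + unitRow e n (8 * a) (8 * b) (8 * c) (8 * d) +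
  unitRow e n (5 * a) (5 * b) (5 * c) (5 * d)

lemma quad_orbitRow (e n : ℕ) : Quad fun a b c d => (orbitRow e n a b c d : ℂ) := by
  refine ⟨fun a b c d => ?_, fun a b c d => ?_, fun a b c d => ?_, fun a b c d => ?_⟩
  · simp only [orbitRow, mul_neg, unitRow_swap₁]; push_cast; ring
  · simp only [orbitRow, mul_neg, unitRow_swap₂]; push_cast; ring
  · simp only [orbitRow, mul_neg, unitRow_swap₃]; push_cast; ring
  · have e1 (x : ZMod 11) : 2 * (2 * x) = 4 * x := by ring
    have e2 (x : ZMod 11) : 4 * (2 * x) = 8 * x := by ring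
    have e3 : ∀ x : ZMod 11, 8 * (2 * x) = 5 * x := by decide +kernel
    have e4 : ∀ x : ZMod 11, 5 * (2 * x) = -x := by decide +kernel
    simp only [orbitRow, e1, e2, e3, e4, unitRow_neg]
    push_cast
    ring

lemma Quad.sum {ι : Type*} (s : Finset ι) (z : ι → ℂ)
    {h : ι → ZMod 11 → ZMod 11 → ZMod 11 → ZMod 11 → ℂ} (hh : ∀ i, Quad (h i)) :
    Quad fun a b c d => ∑ i ∈ s, z i * h i a b c d := by
  refine ⟨fun a b c d => ?_, fun a b c d => ?_, fun a b c d => ?_, fun a b c d => ?_⟩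
  · simp only [(hh _).swap₁, mul_neg, Finset.sum_neg_distrib]
  · simp only [(hh _).swap₂, mul_neg, Finset.sum_neg_distrib]
  · simp only [(hh _).swap₃, mul_neg, Finset.sum_neg_distrib]
  · simp only [(hh _).dbl]

/-- A combination of symmetrised functions. -/
def combine (l : List (ℤ × ℕ × ℕ)) (a b c d : ZMod 11) : ℤ :=
  (l.map fun p => p.1 * orbitRow p.2.1 p.2.2 a b c d).sum

lemma quad_combine (l : List (ℤ × ℕ × ℕ)) : Quad fun a b c d => (combine l a b c d : ℂ) := by
  have := Quad.sum Finset.univ (fun i : Fin l.length => (l[i].1 : ℂ))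
    fun i => quad_orbitRow l[i].2.1 l[i].2.2
  convert this using 5 with a b c d
  simp only [combine]
  rw [← List.ofFn_getElem_eq_map l (fun p => p.1 * orbitRow p.2.1 p.2.2 a b c d), List.sum_ofFn]
  push_cast
  rfl

/-- Combinations with prescribed boundaries. -/
def dual : ℕ → List (ℤ × ℕ × ℕ)
  | 2062 => [(-2, 0, 1111)]
  | 1864 => [(2, 0, 11110), (-2, 1, 10030), (2, 1, 10120), (-2, 1, 2020), (-2, 1, 110020)]
  | 181 => [(-2, 1, 220)]
  | 1585 => [(3, 0, 11110), (-2, 1, 10030), (-2, 1, 1120),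
      (2, 1, 10120), (-2, 1, 2020),
      (-2, 1, 101020), (-2, 1, 110020), (-1, 1, 11110)]
  | 1598 => [(-2, 0, 11110), (2, 1, 10030), (-2, 1, 10120), (2, 1, 110020)]
  | 137 => [(-2, 1, 10030), (-2, 1, 100030)]
  | 134 => [(3, 0, 11110), (-4, 1, 40), (-2, 1, 130), (-2, 1, 10030), (-2, 1, 1120),
      (2, 1, 10120), (-2, 1, 2020),
      (-2, 1, 101020), (-2, 1, 110020), (-1, 1, 11110)]
  | 135 => [(-3, 0, 11110), (-2, 1, 1030), (2, 1, 10030), (2, 1, 1120), (-2, 1, 10120),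
      (2, 1, 2020), (2, 1, 101020), (2, 1, 110020), (1, 1, 11110)]
  | 158 => [(1, 0, 11110), (-2, 1, 2020), (-2, 1, 11020), (1, 1, 11110)]
  | 1597 => [(2, 1, 10030)]
  | 1754 => [(-2, 1, 101020)]
  | 148 => [(2, 0, 11110), (2, 1, 10120), (-2, 1, 100120), (2, 1, 101020)]
  | 1718 => [(2, 0, 11110), (2, 1, 10120)]
  | 1743 => [(-1, 0, 11110), (-1, 1, 11110)]
  | 1611 => [(-1, 0, 11110), (1, 1, 11110)]
  | 1464 => [(2, 1, 40)]
  | _ => []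

lemma bdr_dual : ∀ k ∈ pivots, ∀ j ∈ pivots,
    let h (a b c d : ℕ) : ℤ := combine (dual j) a b c d
    let a := k / 1331
    let b := k / 121 % 11
    let c := k / 11 % 11
    let d := k % 11
    h (10 * b) c d (a + b) - h a c d (a + b) + h a b c d = if k = j then 24 else 0 := by
  decide +kernel

theorem exists_bdr (v : ℕ → ℂ) : ∃ H, Quad H ∧ H 0 0 0 0 = 0 ∧
    ∀ k ∈ pivots, valK (bdr H) k = v k := by
  refine ⟨_, Quad.sum pivots.toFinset (fun j => v j / 24) fun j => quad_combine (dual j),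
    ?_, fun k hk => ?_⟩
  · have h : ∀ j ∈ pivots, combine (dual j) 0 0 0 0 = 0 := by decide +kernel
    refine Finset.sum_eq_zero fun j hj => ?_
    rw [h j (List.mem_toFinset.1 hj), Int.cast_zero, mul_zero]
  · have h10 (b : ZMod 11) : ((10 : ℕ) : ZMod 11) * b = -b := by
      rw [show ((10 : ℕ) : ZMod 11) = -1 by decide, neg_one_mul]
    have h (j) (hj : j ∈ pivots.toFinset) := bdr_dual k hk j (List.mem_toFinset.1 hj)
    simp only [Nat.cast_add, Nat.cast_mul, h10] at h
    rw [valK, bdr, ← Finset.sum_sub_distrib, ← Finset.sum_add_distrib]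
    rw [Finset.sum_congr rfl (g := fun j => v j * if k = j then 1 else 0)]
    · simp [hk]
    · intro j hj
      have h := congrArg (Int.cast : ℤ → ℂ) (h j hj)
      push_cast at h
      rw [← mul_sub, ← mul_add, h]
      split_ifs <;> ring1

end ModEleven

/-! ### Cocycles with vanishing invariants are coboundaries -/

namespace FrameData.Symmetry

open ListCochain

attribute [local instance] FrameData.listAction

variable {X V G : Type} [Group G] [MulAction G X] [MulAction G V] {D : FrameData X V}
  {U : Finset V}

lemma d_mem (hG : D.Symmetry G U) {k : ℕ} {y : List X → ℂ} (hy : y ∈ inv G D k) :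
    D.d y ∈ inv G D (k + 1) := by
  refine ⟨alt_d hy.1, fun l hl => ?_, fun g l => ?_⟩
  · have hc := cell_of_d_ne_zero hl
    rw [d_of_cell hc] at hl
    obtain ⟨m, -, hm, h0⟩ := exists_of_cob_ne_zero hl
    exact ⟨hc, by rw [← hm, (hy.2.1 m h0).2]⟩
  · rw [hG.d_smul_list]
    simp only [hy.2.2]

end FrameData.Symmetry

namespace SymForm

open Matrix ListCochain FrameData ModEleven

lemma d_mem_cochains {k : ℕ} {y : List S → ℂ} (hy : y ∈ cochains k) : dat.d y ∈ cochains (k + 1) :=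
  (exists_symmetry 11).choose_spec.d_mem hy

lemma onRows_add (φ ψ : (Fin 4 → ℤ) → (Fin 4 → ℤ) → (Fin 4 → ℤ) → (Fin 4 → ℤ) → ℂ) (a b c d) :
    onRows (φ + ψ) a b c d = onRows φ a b c d + onRows ψ a b c d := by
  unfold onRows
  split_ifs
  · rfl
  · rw [add_zero]

lemma onRows_smul (t : ℂ) (φ : (Fin 4 → ℤ) → (Fin 4 → ℤ) → (Fin 4 → ℤ) → (Fin 4 → ℤ) → ℂ)
    (a b c d) : onRows (t • φ) a b c d = t * onRows φ a b c d := by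
  unfold onRows
  split_ifs
  · rfl
  · rw [mul_zero]

/-- The value of a cochain at the triangle cells with given rows. -/
noncomputable def rowValue (a b c d : ZMod 11) : cochains 5 →ₗ[ℂ] ℂ where
  toFun x := onRows (tri x.1) a b c d
  map_add' x y := onRows_add (tri x.1) (tri y.1) a b c d
  map_smul' t x := onRows_smul t (tri x.1) a b c d

/-- The two invariants of a cocycle. -/
noncomputable def invariants : cochains 5 →ₗ[ℂ] (Fin 2 → ℂ) :=
  LinearMap.pi ![rowValue 0 0 1 3, rowValue 0 1 1 3 + rowValue 1 1 1 3 - 2 • rowValue 0 1 2 3]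

lemma invariants_zero (x : cochains 5) : invariants x 0 = rowValue 0 0 1 3 x := rfl

lemma invariants_one (x : cochains 5) : invariants x 1 =
    rowValue 0 1 1 3 x + rowValue 1 1 1 3 x - 2 * rowValue 0 1 2 3 x := by
  change rowValue 0 1 1 3 x + rowValue 1 1 1 3 x - 2 • rowValue 0 1 2 3 x = _
  rw [nsmul_eq_mul, Nat.cast_ofNat]

theorem invariants_d {y : List S → ℂ} (hy : y ∈ cochains 4) (x : cochains 5)
    (hx : x.1 = dat.d y) : invariants x = 0 := by
  have hd := d_mem_cochains hy
  have h (a b c d) : rowValue a b c d x = bdr (onRows (quad y)) a b c d := by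
    rw [← onRows_d hy hd, ← hx]; rfl
  funext i
  fin_cases i
  · exact (invariants_zero x).trans ((h _ _ _ _).trans (quad_onRows hy).bdr_first)
  · refine (invariants_one x).trans ?_
    rw [h, h, h]
    exact (quad_onRows hy).bdr_second

theorem exists_d_eq (x : cochains 5) (hx : dat.d x.1 = 0) (h0 : invariants x = 0) :
    ∃ y ∈ cochains 4, dat.d y = x.1 := by
  obtain ⟨H, hH, hz, hv⟩ := exists_bdr (valK (onRows (tri x.1)))
  obtain ⟨y, hy, rfl⟩ := exists_cochain hH hz
  have hy' := d_mem_cochains hy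
  refine ⟨y, hy, ?_⟩
  let w : cochains 5 := x - ⟨dat.d y, hy'⟩
  have hw : dat.d w.1 = 0 := by
    change dat.d (x.1 - dat.d y) = 0
    rw [map_sub, hx, d_d dat_laws fun l hl => (hy.2.1 l hl).1, sub_zero]
  have hwr (a b c d) : onRows (tri w.1) a b c d =
      onRows (tri x.1) a b c d - bdr (onRows (quad y)) a b c d := by
    rw [← onRows_d hy hy']
    exact map_sub (rowValue a b c d) x ⟨dat.d y, hy'⟩
  have hi : invariants w = 0 := by
    rw [map_sub, h0, invariants_d hy _ rfl, sub_zero]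
  have h1 := congrFun hi 0
  have h2 := congrFun hi 1
  rw [invariants_zero] at h1
  rw [invariants_one] at h2
  have := eq_zero_of_onRows w.2 hw ((rel_tri w.2 hw).eq_zero (fun k hk => ?_) h1 h2)
  · exact (sub_eq_zero.1 this).symm
  · have := hv k hk
    simp only [valK] at this ⊢
    rw [hwr, this, sub_self]

end SymForm

/-! ### Two cocycles -/

namespace SymForm

open Matrix ListCochain FrameData

/-- A symmetric function satisfying a three term relation. -/
def sym (c d : ZMod 11) : ℤ :=
  if c = 0 then 0 else if d = 3 * c ∨ d = 4 * c then 1 else if d = 7 * c ∨ d = 8 * c then -1 else 0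

lemma sym_comm : ∀ c d, sym d c = sym c d := by decide +kernel

lemma sym_neg : ∀ c d, sym (-c) d = -sym c d := by decide +kernel

lemma sym_mul : ∀ u : ZMod 11, u ≠ 0 → ∀ c d, sym (u * c) (u * d) = sym c d := by decide +kernel

/-- The product of the determinants completing a pair by the edges of a triangle. -/
def cyc (i j a b c : Fin 4 → ℤ) : ℤ := D i j a b * D i j b c * D i j c a

lemma D_neg₁ (a b c d : Fin 4 → ℤ) : D (-a) b c d = -D a b c d := by
  simp only [D_eq, Pi.neg_apply]; ring1

lemma D_neg₃ (a b c d : Fin 4 → ℤ) : D a b (-c) d = -D a b c d := by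
  simp only [D_eq, Pi.neg_apply]; ring1

lemma D_neg₄ (a b c d : Fin 4 → ℤ) : D a b c (-d) = -D a b c d := by
  simp only [D_eq, Pi.neg_apply]; ring1

/-- Symmetric weights on triples of vectors. -/
structure TripleWeight (χ : (Fin 4 → ℤ) → (Fin 4 → ℤ) → (Fin 4 → ℤ) → ℤ) : Prop where
  swap₁ : ∀ a b c, χ b a c = χ a b c
  swap₂ : ∀ a b c, χ a c b = χ a b c
  neg : ∀ a b c, χ (-a) b c = χ a b c
  gamma : ∀ g ∈ Gamma0 11, ∀ a b c, χ (g.1 *ᵥ a) (g.1 *ᵥ b) (g.1 *ᵥ c) = χ a b c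

/-- The contribution of a splitting of five vectors. -/
def term (χ : (Fin 4 → ℤ) → (Fin 4 → ℤ) → (Fin 4 → ℤ) → ℤ) (i j a b c : Fin 4 → ℤ) : ℤ :=
  sym (ell i) (ell j) * χ a b c * cyc i j a b c

/-- The sum over all splittings of five vectors. -/
def split (χ : (Fin 4 → ℤ) → (Fin 4 → ℤ) → (Fin 4 → ℤ) → ℤ) (a b c d e : Fin 4 → ℤ) : ℤ :=
  term χ a b c d e - term χ a c b d e + term χ a d b c e - term χ a e b c d + term χ b c a d e -
    term χ b d a c e + term χ b e a c d + term χ c d a b e - term χ c e a b d + term χ d e a b c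

section
variable {χ : (Fin 4 → ℤ) → (Fin 4 → ℤ) → (Fin 4 → ℤ) → ℤ} (hχ : TripleWeight χ)

lemma term_swap₁ (i j a b c) : term χ j i a b c = -term χ i j a b c := by
  simp only [term, cyc]
  rw [sym_comm, D_swap₁ i j, D_swap₁ i j, D_swap₁ i j]
  ring

include hχ

lemma term_swap₂ (i j a b c) : term χ i j b a c = -term χ i j a b c := by
  simp only [term, cyc]
  rw [hχ.swap₁, D_swap₃ i j a b, D_swap₃ i j c a, D_swap₃ i j b c]
  ring

lemma term_swap₃ (i j a b c) : term χ i j a c b = -term χ i j a b c := by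
  simp only [term, cyc]
  rw [hχ.swap₂, D_swap₃ i j a b, D_swap₃ i j c a, D_swap₃ i j b c]
  ring

omit hχ in
lemma term_neg₁ (i j a b c) : term χ (-i) j a b c = term χ i j a b c := by
  simp only [term, cyc, ell_neg, sym_neg, D_neg₁]
  ring

lemma term_neg₂ (i j a b c) : term χ i j (-a) b c = term χ i j a b c := by
  simp only [term, cyc, hχ.neg, D_neg₃, D_neg₄]
  ring

lemma term_gamma {g : G4} (hg : g ∈ Gamma0 11) (i j a b c) :
    term χ (g.1 *ᵥ i) (g.1 *ᵥ j) (g.1 *ᵥ a) (g.1 *ᵥ b) (g.1 *ᵥ c) = term χ i j a b c := by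
  simp only [term, cyc, D_smul_vec, hχ.gamma g hg, ell_gamma hg, sym_mul _ (gamma_unit hg)]

lemma liftable_split : Liftable (ofFive fun a b c d e => (split χ a b c d e : ℂ)) := by
  refine liftable_ofFive (fun a b c d e => ?_) (fun a b c d e => ?_) (fun a b c d e => ?_)
    (fun a b c d e => ?_) (fun a b c d e => ?_) (fun g hg a b c d e => ?_)
  iterate 4
    · norm_cast
      simp only [split]
      first
        | linear_combination term_swap₁ a b c d e + term_swap₂ hχ c d a b e -
            term_swap₂ hχ c e a b d + term_swap₂ hχ d e a b c
        | linear_combination term_swap₁ b c a d e + term_swap₂ hχ a d b c e -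
            term_swap₂ hχ a e b c d + term_swap₃ hχ d e a b c
        | linear_combination term_swap₁ c d a b e + term_swap₂ hχ a b c d e -
            term_swap₃ hχ a e b c d + term_swap₃ hχ b e a c d
        | linear_combination term_swap₁ d e a b c + term_swap₃ hχ a b c d e -
            term_swap₃ hχ a c b d e + term_swap₃ hχ b c a d e
  · simp only [split, term_neg₁, term_neg₂ hχ]
  · simp only [split, term_gamma hχ hg]

/-- The value on triangle cells. -/
lemma split_tri {p q r s : Fin 4 → ℤ} (h : D p q r s = 1) :
    split χ p q r s (p + q) = sym (ell r) (ell s) * χ p q (p + q) := by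
  have e (i j : Fin 4 → ℤ) : D i j q (p + q) = D i j q p := by
    simp only [D_eq, Pi.add_apply]; ring1
  have e' (i j : Fin 4 → ℤ) : D i j (p + q) p = D i j q p := by
    simp only [D_eq, Pi.add_apply]; ring1
  have h' : D r s p q = 1 := by rw [D_pair, h]
  have z : term χ r s p q (p + q) = sym (ell r) (ell s) * χ p q (p + q) := by
    simp only [term, cyc, e, e', D_swap₃ r s p q, h']
    ring
  have z1 : D p q s (p + q) = 0 := by simp only [D_eq, Pi.add_apply]; ring1
  have z2 (i) : D p i (p + q) q = 0 := by simp only [D_eq, Pi.add_apply]; ring1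
  have z3 (i) : D q i (p + q) p = 0 := by simp only [D_eq, Pi.add_apply]; ring1
  have z4 (i) : D p (p + q) q i = 0 := by simp only [D_eq, Pi.add_apply]; ring1
  have z5 (i) : D q (p + q) p i = 0 := by simp only [D_eq, Pi.add_apply]; ring1
  have z6 : D r (p + q) p q = 0 := by simp only [D_eq, Pi.add_apply]; ring1
  have z7 : D s (p + q) p q = 0 := by simp only [D_eq, Pi.add_apply]; ring1
  rw [split, z]
  simp only [term, cyc, z1, z2, z3, z4, z5, z6, z7]
  ring

end

end SymForm

/-! ### The cocycle condition -/

namespace SymForm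

open Matrix ListCochain FrameData

lemma plucker (i j a b c d : Fin 4 → ℤ) :
    D i j a b * D i j c d - D i j a c * D i j b d + D i j a d * D i j b c = 0 := by
  simp only [D_eq]
  ring

lemma sym_line : ∀ α ∈ ([-1, 0, 1] : List ℤ), ∀ β ∈ ([-1, 0, 1] : List ℤ), α ≠ 0 ∨ β ≠ 0 →
    ∀ c d : ZMod 11, sym c d - β * sym c ((α : ZMod 11) * c + (β : ZMod 11) * d) -
      α * sym d ((α : ZMod 11) * c + (β : ZMod 11) * d) = 0 := by
  decide +kernel

lemma mem_of_natAbs_le_one {z : ℤ} (h : z.natAbs ≤ 1) : z ∈ ([-1, 0, 1] : List ℤ) := by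
  simp only [List.mem_cons, List.not_mem_nil, or_false]
  omega

/-- The alternating sum over the pairs in a triple of vectors. -/
def pairSum (i j d a b c : Fin 4 → ℤ) : ℤ :=
  sym (ell i) (ell j) * cyc i j a b c - sym (ell i) (ell d) * cyc i d a b c +
    sym (ell j) (ell d) * cyc j d a b c

lemma cyc_swap (i j a b c : Fin 4 → ℤ) : cyc j i a b c = -cyc i j a b c := by
  simp only [cyc]
  rw [D_swap₁ i j, D_swap₁ i j, D_swap₁ i j]
  ring

lemma pairSum_swap (i j d a b c : Fin 4 → ℤ) : pairSum i d j a b c = -pairSum i j d a b c := by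
  simp only [pairSum, cyc_swap j d, sym_comm (ell j) (ell d)]
  ring

lemma pairSum_rot (i j d a b c : Fin 4 → ℤ) : pairSum j d i a b c = pairSum i j d a b c := by
  simp only [pairSum, cyc_swap i j, cyc_swap i d, sym_comm (ell i) (ell j),
    sym_comm (ell i) (ell d)]
  ring

lemma pairSum_eq_zero {i j d a b c : Fin 4 → ℤ} {α β : ℤ} (hα : α ∈ [-1, 0, 1])
    (hβ : β ∈ [-1, 0, 1]) (h0 : α ≠ 0 ∨ β ≠ 0) (hl : ell d = α * ell i + β * ell j)
    (hi : ∀ p ∈ [(a, b), (b, c), (c, a)], D i d p.1 p.2 = β * D i j p.1 p.2)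
    (hj : ∀ p ∈ [(a, b), (b, c), (c, a)], D j d p.1 p.2 = -(α * D i j p.1 p.2)) :
    pairSum i j d a b c = 0 := by
  simp only [List.forall_mem_cons, List.not_mem_nil, false_imp_iff, implies_true, and_true]
    at hi hj
  have cube : ∀ x ∈ [-1, 0, 1], x * x * x = (x : ℤ) := by decide
  have e1 : cyc i d a b c = β * cyc i j a b c := by
    rw [cyc, hi.1, hi.2.1, hi.2.2, cyc]
    linear_combination D i j a b * D i j b c * D i j c a * cube β hβ
  have e2 : cyc j d a b c = -(α * cyc i j a b c) := by
    rw [cyc, hj.1, hj.2.1, hj.2.2, cyc]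
    linear_combination -(D i j a b * D i j b c * D i j c a * cube α hα)
  rw [pairSum, e1, e2, hl]
  linear_combination cyc i j a b c * sym_line α hα β hβ h0 (ell i) (ell j)

/-- A property of triples invariant under permutations of the first three vectors gives the
vanishing of the alternating sum once it does so for a nonzero first term. -/
lemma pairSum_of_ne {P : (Fin 4 → ℤ) → (Fin 4 → ℤ) → (Fin 4 → ℤ) → Prop} {a b c : Fin 4 → ℤ}
    (hs : ∀ i j d, P i j d → P i d j) (hr : ∀ i j d, P i j d → P j d i)
    (h : ∀ i j d, P i j d → cyc i j a b c ≠ 0 → pairSum i j d a b c = 0) {i j d : Fin 4 → ℤ}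
    (hP : P i j d) : pairSum i j d a b c = 0 := by
  by_cases h1 : cyc i j a b c = 0
  · by_cases h2 : cyc i d a b c = 0
    · by_cases h3 : cyc j d a b c = 0
      · rw [pairSum, h1, h2, h3]; ring
      · rw [← pairSum_rot]
        exact h _ _ _ (hr _ _ _ hP) h3
    · rw [← neg_neg (pairSum i j d a b c), ← pairSum_swap, h _ _ _ (hs _ _ _ hP) h2, neg_zero]
  · exact h _ _ _ hP h1

/-- Nonzero vectors with determinants at most one in absolute value. -/
structure Unimodular (P : Set (Fin 4 → ℤ)) : Prop where
  ne_zero : ∀ a ∈ P, a ≠ 0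
  le_one : ∀ a ∈ P, ∀ b ∈ P, ∀ c ∈ P, ∀ d ∈ P, (D a b c d).natAbs ≤ 1

section
variable {P : Set (Fin 4 → ℤ)} (hP : Unimodular P) {i j d a b c : Fin 4 → ℤ}
  (ha : a ∈ P) (hb : b ∈ P) (hc : c ∈ P)
include hP ha hb

omit ha in
lemma Unimodular.cramer (hi : i ∈ P) (hj : j ∈ P) (hd : d ∈ P) (ha : a ∈ P)
    (h : D i j a b ≠ 0) :
    ∃ α ∈ [-1, 0, 1], ∃ β ∈ [-1, 0, 1], ∃ γ ∈ [-1, 0, 1], ∃ δ ∈ [-1, 0, 1],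
      d = α • i + β • j + γ • a + δ • (b : Fin 4 → ℤ) ∧ D i j d b = D i j a b * γ ∧
        D i j a d = D i j a b * δ := by
  have hu : D i j a b * D i j a b = 1 := by
    have := hP.le_one i hi j hj a ha b hb
    have : D i j a b = 1 ∨ D i j a b = -1 := by omega
    rcases this with h | h <;> rw [h] <;> rfl
  have hm (z : ℤ) (hz : z.natAbs ≤ 1) : D i j a b * z ∈ [-1, 0, 1] := by
    refine mem_of_natAbs_le_one ?_
    rw [Int.natAbs_mul]
    exact Nat.mul_le_mul (hP.le_one i hi j hj a ha b hb) hz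
  refine ⟨_, hm _ (hP.le_one d hd j hj a ha b hb), _, hm _ (hP.le_one i hi d hd a ha b hb), _,
    hm _ (hP.le_one i hi j hj d hd b hb), _, hm _ (hP.le_one i hi j hj a ha d hd), ?_, ?_, ?_⟩
  · simp only [mul_smul]
    rw [← smul_add, ← smul_add, ← smul_add, ← SymForm.cramer, smul_smul, hu, one_smul]
  · rw [← mul_assoc, hu, one_mul]
  · rw [← mul_assoc, hu, one_mul]

omit ha in
lemma Unimodular.sq_mem_of_coplanar (hc : c ∈ P) (hi : i ∈ P) (hj : j ∈ P) (ha : a ∈ P)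
    (hab : D i j a b ≠ 0) (hbc : D i j b c ≠ 0) (hca : D i j c a ≠ 0) (h : ∀ x, D a b c x = 0)
    {γ δ : ℤ} (hγ : γ ∈ ([-1, 0, 1] : List ℤ)) (hδ : δ ∈ ([-1, 0, 1] : List ℤ)) (hd : d ∈ P)
    (e : d = γ • a + δ • b) : sq d ∈ [sq a, sq b, sq c] := by
  have hs (x y : Fin 4 → ℤ) {s : ℤ} (hs : s = 1 ∨ s = -1) (hx : x = s • y) : sq x = sq y := by
    rcases hs with rfl | rfl
    · rw [hx, one_smul]
    · rw [hx, neg_smul, one_smul, sq_neg]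
  have unit {z : ℤ} (hz : z.natAbs ≤ 1) (h0 : z ≠ 0) : z = 1 ∨ z = -1 := by omega
  have e1 := unit (hP.le_one i hi j hj a ha b hb) hab
  have e2 := unit (hP.le_one i hi j hj b hb c hc) hbc
  have e3 := unit (hP.le_one i hi j hj c hc a ha) hca
  have e4 : D i j a b • c = -D i j b c • a - D i j c a • b := by
    have z1 : D c j a b = 0 := by rw [← h j]; simp only [D_eq]; ring1
    have z2 : D i c a b = 0 := by rw [← neg_eq_zero, ← h i]; simp only [D_eq]; ring1
    rw [SymForm.cramer i j a b c, z1, z2, D_swap₃ i j b c, D_swap₃ i j c a]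
    module
  have hm : (D i j d c).natAbs ≤ 1 := hP.le_one i hi j hj d hd c hc
  have e5 : D i j d c = δ * D i j b c - γ * D i j c a := by
    rw [e]; simp only [D_eq, Pi.add_apply, Pi.smul_apply, smul_eq_mul]; ring1
  have h0 := hP.ne_zero d hd
  rw [e5] at hm
  generalize D i j a b = u at *
  generalize D i j b c = q at *
  generalize D i j c a = p at *
  simp only [List.mem_cons, List.not_mem_nil, or_false] at hγ hδ ⊢
  by_cases hγ0 : γ = 0
  · refine .inr (.inl (hs d b (s := δ) ?_ (by rw [e, hγ0, zero_smul, zero_add])))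
    rcases hδ with h | h | h
    · exact .inr h
    · exact absurd (by rw [e, hγ0, h, zero_smul, zero_smul, add_zero]) h0
    · exact .inl h
  by_cases hδ0 : δ = 0
  · exact .inl (hs d a (s := γ) (by tauto) (by rw [e, hδ0, zero_smul, add_zero]))
  have hγ' : γ = 1 ∨ γ = -1 := by tauto
  have hδ' : δ = 1 ∨ δ = -1 := by tauto
  refine .inr (.inr (hs d c (s := -(p * δ * u)) ?_ ?_))
  · rcases e1 with rfl | rfl <;> rcases e3 with rfl | rfl <;> rcases hδ' with rfl | rfl <;>
      decide
  · rw [neg_smul, mul_smul, e4, e]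
    have hp : δ * q = γ * p := by
      rcases e2 with rfl | rfl <;> rcases e3 with rfl | rfl <;> rcases hδ' with rfl | rfl <;>
        rcases hγ' with rfl | rfl <;> first | rfl | exact absurd hm (by decide)
    have hpp : p * p = 1 := by rcases e3 with rfl | rfl <;> rfl
    ext k
    simp only [Pi.add_apply, Pi.sub_apply, Pi.neg_apply, Pi.smul_apply, smul_eq_mul]
    linear_combination (-p * a k) * hp - (γ * a k + δ * b k) * hpp

theorem pairSum_of_dependent (hi : i ∈ P) (hj : j ∈ P) (hd : d ∈ P) (h1 : D i j d a = 0)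
    (h2 : D i j d b = 0) (h3 : D i j d c = 0) : pairSum i j d a b c = 0 := by
  refine pairSum_of_ne (P := fun i j d => (i ∈ P ∧ j ∈ P ∧ d ∈ P) ∧
    D i j d a = 0 ∧ D i j d b = 0 ∧ D i j d c = 0) ?_ ?_ ?_ ⟨⟨hi, hj, hd⟩, h1, h2, h3⟩
  · rintro i j d ⟨⟨hi, hj, hd⟩, h1, h2, h3⟩
    refine ⟨⟨hi, hd, hj⟩, ?_⟩
    simp only [D_swap₂ i j d, h1, h2, h3, neg_zero, and_self]
  · rintro i j d ⟨⟨hi, hj, hd⟩, h1, h2, h3⟩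
    refine ⟨⟨hj, hd, hi⟩, ?_⟩
    simp only [D_swap₂ j i d, D_swap₁ i j d, h1, h2, h3, neg_zero, and_self]
  · rintro i j d ⟨⟨hi, hj, hd⟩, h1, h2, h3⟩ h
    have h' : D i j a b ≠ 0 := fun h0 => h (by rw [cyc, h0, zero_mul, zero_mul])
    obtain ⟨α, hα, β, hβ, γ, -, δ, -, e, hγ, hδ⟩ := hP.cramer hb hi hj hd ha h'
    rw [h2, eq_comm, mul_eq_zero, or_iff_right h'] at hγ
    rw [D_swap₃ i j d a, h1, neg_zero, eq_comm, mul_eq_zero, or_iff_right h'] at hδ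
    rw [hγ, hδ, zero_smul, zero_smul, add_zero, add_zero] at e
    subst e
    refine pairSum_eq_zero hα hβ ?_ (by simp only [ell_add, ell_smul]) (fun p _ => ?_)
      (fun p _ => ?_)
    · by_contra! h0
      exact hP.ne_zero _ hd (by rw [h0.1, h0.2, zero_smul, zero_smul, add_zero])
    · simp only [D_eq, Pi.add_apply, Pi.smul_apply, smul_eq_mul]; ring1
    · simp only [D_eq, Pi.add_apply, Pi.smul_apply, smul_eq_mul]; ring1

include hc

theorem pairSum_of_coplanar (hi : i ∈ P) (hj : j ∈ P) (hd : d ∈ P)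
    (hn : ∀ x ∈ [i, j, d], sq x ∉ [sq a, sq b, sq c]) (h : ∀ x, D a b c x = 0)
    (hla : ell a = 0) (hlb : ell b = 0) : pairSum i j d a b c = 0 := by
  refine pairSum_of_ne (P := fun i j d => (i ∈ P ∧ j ∈ P ∧ d ∈ P) ∧
    ∀ x ∈ [i, j, d], sq x ∉ [sq a, sq b, sq c]) ?_ ?_ ?_ ⟨⟨hi, hj, hd⟩, hn⟩
  · rintro i j d ⟨⟨hi, hj, hd⟩, hn⟩
    exact ⟨⟨hi, hd, hj⟩, fun x hx => hn x (by simp at hx ⊢; tauto)⟩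
  · rintro i j d ⟨⟨hi, hj, hd⟩, hn⟩
    exact ⟨⟨hj, hd, hi⟩, fun x hx => hn x (by simp at hx ⊢; tauto)⟩
  · rintro i j d ⟨⟨hi, hj, hd⟩, hn⟩ h0
    simp only [cyc, ne_eq, mul_eq_zero, not_or] at h0
    obtain ⟨⟨hab, hbc⟩, hca⟩ := h0
    obtain ⟨α, hα, β, hβ, γ, hγ, δ, hδ, rfl, hγ', hδ'⟩ := hP.cramer hb hi hj hd ha hab
    have key (y : Fin 4 → ℤ) : ∀ p ∈ [(a, b), (b, c), (c, a)],
        D y (α • i + β • j + γ • a + δ • b) p.1 p.2 =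
          α * D y i p.1 p.2 + β * D y j p.1 p.2 := by
      simp only [List.forall_mem_cons, List.not_mem_nil, false_imp_iff, implies_true, and_true]
      have hy := h y
      refine ⟨?_, ?_, ?_⟩ <;> simp only [D_eq, Pi.add_apply, Pi.smul_apply, smul_eq_mul] at hy ⊢
      · ring1
      · linear_combination -γ * hy
      · linear_combination -δ * hy
    refine pairSum_eq_zero hα hβ ?_ (by simp only [ell_add, ell_smul, hla, hlb]; ring)
      (fun p hp => ?_) (fun p hp => ?_)
    · by_contra! h0
      refine hn _ (by simp) (hP.sq_mem_of_coplanar hb hc hi hj ha hab hbc hca h hγ hδ hd ?_)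
      rw [h0.1, h0.2, zero_smul, zero_smul, zero_add, zero_add]
    · rw [key i p hp, D_self₁]; ring1
    · rw [key j p hp, D_self₁, D_swap₁ i j]; ring1

end

end SymForm

namespace SymForm

open Matrix ListCochain FrameData

/-- The indicator of the vanishing of the determinants of a triple with the remaining vectors. -/
def ind (i j d a b c : Fin 4 → ℤ) : ℤ :=
  if D i j d a = 0 ∧ D i j d b = 0 ∧ D i j d c = 0 then 1 else 0

lemma ind_swap (i j d a b c : Fin 4 → ℤ) : ind i d j a b c = ind i j d a b c := by
  simp only [ind, D_swap₂ i j d, neg_eq_zero]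

lemma ind_rot (i j d a b c : Fin 4 → ℤ) : ind j d i a b c = ind i j d a b c := by
  simp only [ind, D_swap₂ j i d, D_swap₁ i j d, neg_eq_zero]

lemma cyc_sum_aux : ∀ p ∈ ([-1, 0, 1] : List ℤ), ∀ q ∈ ([-1, 0, 1] : List ℤ),
    ∀ r ∈ ([-1, 0, 1] : List ℤ), ∀ s ∈ ([-1, 0, 1] : List ℤ), ∀ t ∈ ([-1, 0, 1] : List ℤ),
    ∀ u ∈ ([-1, 0, 1] : List ℤ), p * u - q * t + r * s = 0 →
    -(s * u * t) + q * u * r - p * t * r + p * s * q =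
      -((if p = 0 ∧ q = 0 ∧ r = 0 then 1 else 0) * (s * u * t)) +
        (if p = 0 ∧ s = 0 ∧ t = 0 then 1 else 0) * (q * u * r) -
        (if q = 0 ∧ s = 0 ∧ u = 0 then 1 else 0) * (p * t * r) +
        (if r = 0 ∧ t = 0 ∧ u = 0 then 1 else 0) * (p * s * q) := by
  decide +kernel

section
variable {P : Set (Fin 4 → ℤ)} (hP : Unimodular P) {i j d w x y z : Fin 4 → ℤ}
include hP

lemma cyc_sum (hi : i ∈ P) (hj : j ∈ P) (hw : w ∈ P) (hx : x ∈ P) (hy : y ∈ P) (hz : z ∈ P) :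
    cyc i j x y z - cyc i j w y z + cyc i j w x z - cyc i j w x y =
      ind i j w x y z * cyc i j x y z - ind i j x w y z * cyc i j w y z +
        ind i j y w x z * cyc i j w x z - ind i j z w x y * cyc i j w x y := by
  have hm {a b} (ha : a ∈ P) (hb : b ∈ P) := mem_of_natAbs_le_one (hP.le_one i hi j hj a ha b hb)
  have := cyc_sum_aux _ (hm hw hx) _ (hm hw hy) _ (hm hw hz) _ (hm hx hy) _ (hm hx hz)
    _ (hm hy hz) (plucker i j w x y z)
  simp only [cyc, ind, D_swap₃ i j w x, D_swap₃ i j w y, D_swap₃ i j w z, D_swap₃ i j x y,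
    D_swap₃ i j x z, D_swap₃ i j y z, neg_eq_zero] at this ⊢
  linear_combination this

lemma ind_sum (hi : i ∈ P) (hj : j ∈ P) (hd : d ∈ P) (hx : x ∈ P) (hy : y ∈ P) :
    sym (ell i) (ell j) * (ind i j d x y z * cyc i j x y z) -
      sym (ell i) (ell d) * (ind i d j x y z * cyc i d x y z) +
      sym (ell j) (ell d) * (ind j d i x y z * cyc j d x y z) = 0 := by
  rw [ind_swap i j d, ind_rot i j d]
  have h : ind i j d x y z * pairSum i j d x y z = 0 := by
    by_cases h : D i j d x = 0 ∧ D i j d y = 0 ∧ D i j d z = 0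
    · rw [pairSum_of_dependent hP hx hy hi hj hd h.1 h.2.1 h.2.2, mul_zero]
    · rw [ind, if_neg h, zero_mul]
  rw [pairSum] at h
  linear_combination h

end

/-- The alternating sum of the splittings of the faces of six vectors. -/
def splitSum (χ : (Fin 4 → ℤ) → (Fin 4 → ℤ) → (Fin 4 → ℤ) → ℤ) (v : Fin 6 → Fin 4 → ℤ) : ℤ :=
  split χ (v 1) (v 2) (v 3) (v 4) (v 5) - split χ (v 0) (v 2) (v 3) (v 4) (v 5) +
    split χ (v 0) (v 1) (v 3) (v 4) (v 5) - split χ (v 0) (v 1) (v 2) (v 4) (v 5) +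
    split χ (v 0) (v 1) (v 2) (v 3) (v 5) - split χ (v 0) (v 1) (v 2) (v 3) (v 4)

theorem splitSum_one {P : Set (Fin 4 → ℤ)} (hP : Unimodular P) {v : Fin 6 → Fin 4 → ℤ}
    (hv : ∀ k, v k ∈ P) : splitSum (fun _ _ _ => 1) v = 0 := by
  have hA (i j w x y z : Fin 6) := cyc_sum hP (hv i) (hv j) (hv w) (hv x) (hv y) (hv z)
  have hB (i j d x y z : Fin 6) := ind_sum hP (hv i) (hv j) (hv d) (hv x) (hv y) (z := v z)
  simp only [splitSum, split, term]
  linear_combination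
    sym (ell (v 0)) (ell (v 1)) * hA 0 1 2 3 4 5 - sym (ell (v 0)) (ell (v 2)) * hA 0 2 1 3 4 5 +
    sym (ell (v 0)) (ell (v 3)) * hA 0 3 1 2 4 5 -
    sym (ell (v 0)) (ell (v 4)) * hA 0 4 1 2 3 5 +
    sym (ell (v 0)) (ell (v 5)) * hA 0 5 1 2 3 4 +
    sym (ell (v 1)) (ell (v 2)) * hA 1 2 0 3 4 5 -
    sym (ell (v 1)) (ell (v 3)) * hA 1 3 0 2 4 5 +
    sym (ell (v 1)) (ell (v 4)) * hA 1 4 0 2 3 5 -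
    sym (ell (v 1)) (ell (v 5)) * hA 1 5 0 2 3 4 +
    sym (ell (v 2)) (ell (v 3)) * hA 2 3 0 1 4 5 -
    sym (ell (v 2)) (ell (v 4)) * hA 2 4 0 1 3 5 +
    sym (ell (v 2)) (ell (v 5)) * hA 2 5 0 1 3 4 +
    sym (ell (v 3)) (ell (v 4)) * hA 3 4 0 1 2 5 -
    sym (ell (v 3)) (ell (v 5)) * hA 3 5 0 1 2 4 +
    sym (ell (v 4)) (ell (v 5)) * hA 4 5 0 1 2 3 + hB 0 1 2 3 4 5 - hB 0 1 3 2 4 5 +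
    hB 0 1 4 2 3 5 - hB 0 1 5 2 3 4 + hB 0 2 3 1 4 5 - hB 0 2 4 1 3 5 + hB 0 2 5 1 3 4 +
    hB 0 3 4 1 2 5 - hB 0 3 5 1 2 4 + hB 0 4 5 1 2 3 - hB 1 2 3 0 4 5 + hB 1 2 4 0 3 5 -
    hB 1 2 5 0 3 4 - hB 1 3 4 0 2 5 + hB 1 3 5 0 2 4 - hB 1 4 5 0 2 3 + hB 2 3 4 0 1 5 -
    hB 2 3 5 0 1 4 + hB 2 4 5 0 1 3 - hB 3 4 5 0 1 2

open Classical in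
/-- The indicator of coplanar triples on which `ell` vanishes. -/
noncomputable def flat (a b c : Fin 4 → ℤ) : ℤ :=
  if (∀ x, D a b c x = 0) ∧ ell a = 0 ∧ ell b = 0 ∧ ell c = 0 then 1 else 0

theorem splitSum_flat {P : Set (Fin 4 → ℤ)} (hP : Unimodular P) {v : Fin 6 → Fin 4 → ℤ}
    (hv : ∀ k, v k ∈ P) (hn : Function.Injective fun k => sq (v k)) : splitSum flat v = 0 := by
  have hB (i j d x y z : Fin 6) (h : ∀ k ∈ [i, j, d], k ∉ [x, y, z]) :
      term flat (v i) (v j) (v x) (v y) (v z) - term flat (v i) (v d) (v x) (v y) (v z) +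
        term flat (v j) (v d) (v x) (v y) (v z) = 0 := by
    have h0 : flat (v x) (v y) (v z) * pairSum (v i) (v j) (v d) (v x) (v y) (v z) = 0 := by
      by_cases hf : (∀ w, D (v x) (v y) (v z) w = 0) ∧
          ell (v x) = 0 ∧ ell (v y) = 0 ∧ ell (v z) = 0
      · rw [pairSum_of_coplanar hP (hv x) (hv y) (hv z) (hv i) (hv j) (hv d) ?_ hf.1 hf.2.1
          hf.2.2.1, mul_zero]
        have key (k : Fin 6) (hk : k ∉ [x, y, z]) :
            sq (v k) ∉ [sq (v x), sq (v y), sq (v z)] := by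
          simpa only [List.mem_cons, List.not_mem_nil, or_false, hn.eq_iff] using hk
        simp only [List.forall_mem_cons, List.not_mem_nil, false_imp_iff, implies_true, and_true]
          at h ⊢
        exact ⟨key i h.1, key j h.2.1, key d h.2.2⟩
      · rw [flat, if_neg hf, zero_mul]
    rw [pairSum] at h0
    simp only [term]
    linear_combination h0
  simp only [splitSum, split]
  linear_combination
    hB 0 1 2 3 4 5 (by decide) - hB 0 1 3 2 4 5 (by decide) + hB 0 1 4 2 3 5 (by decide) -
    hB 0 1 5 2 3 4 (by decide) + hB 0 2 3 1 4 5 (by decide) - hB 0 2 4 1 3 5 (by decide) +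
    hB 0 2 5 1 3 4 (by decide) + hB 0 3 4 1 2 5 (by decide) - hB 0 3 5 1 2 4 (by decide) +
    hB 0 4 5 1 2 3 (by decide) - hB 1 2 3 0 4 5 (by decide) + hB 1 2 4 0 3 5 (by decide) -
    hB 1 2 5 0 3 4 (by decide) - hB 1 3 4 0 2 5 (by decide) + hB 1 3 5 0 2 4 (by decide) -
    hB 1 4 5 0 2 3 (by decide) + hB 2 3 4 0 1 5 (by decide) - hB 2 3 5 0 1 4 (by decide) +
    hB 2 4 5 0 1 3 (by decide) - hB 3 4 5 0 1 2 (by decide)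

lemma tripleWeight_one : TripleWeight fun _ _ _ => 1 :=
  ⟨fun _ _ _ => rfl, fun _ _ _ => rfl, fun _ _ _ => rfl, fun _ _ _ _ _ => rfl⟩

lemma tripleWeight_flat : TripleWeight flat := by
  classical
  refine ⟨fun a b c => ?_, fun a b c => ?_, fun a b c => ?_, fun g hg a b c => ?_⟩
  · have h (x) : D b a c x = 0 ↔ D a b c x = 0 := by rw [D_swap₁ a b, neg_eq_zero]
    exact if_congr (by simp only [h, and_left_comm]) rfl rfl
  · have h (x) : D a c b x = 0 ↔ D a b c x = 0 := by rw [D_swap₂ a b, neg_eq_zero]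
    exact if_congr (by simp only [h, and_comm (b := ell b = 0)]) rfl rfl
  · exact if_congr (by simp only [D_neg₁, ell_neg, neg_eq_zero]) rfl rfl
  · have h : (∀ x, D (g.1 *ᵥ a) (g.1 *ᵥ b) (g.1 *ᵥ c) x = 0) ↔ ∀ x, D a b c x = 0 := by
      refine ⟨fun h x => ?_, fun h x => ?_⟩
      · rw [← D_smul_vec g, h]
      · have e : x = g.1 *ᵥ ((g⁻¹).1 *ᵥ x) := by
          rw [mulVec_mulVec, val_mul_inv, one_mulVec]
        rw [e, D_smul_vec, h]
    have : Fact (Nat.Prime 11) := ⟨by norm_num⟩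
    have h' (x : Fin 4 → ℤ) : ell (g.1 *ᵥ x) = 0 ↔ ell x = 0 := by
      rw [ell_gamma hg, mul_eq_zero, or_iff_right (gamma_unit hg)]
    exact if_congr (by simp only [h, h']) rfl rfl

end SymForm

namespace SymForm

open Matrix ListCochain FrameData

section
variable {χ : (Fin 4 → ℤ) → (Fin 4 → ℤ) → (Fin 4 → ℤ) → ℤ} (hχ : TripleWeight χ)
include hχ

lemma lift_split {Q : V} {a b c d e : Fin 4 → ℤ}
    (h : std.Face Q [sq a, sq b, sq c, sq d, sq e]) :
    lift 5 (ofFive fun a b c d e => (split χ a b c d e : ℂ)) [sq a, sq b, sq c, sq d, sq e] =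
      split χ a b c d e := by
  by_cases hs : Sys.Span [sq a, sq b, sq c, sq d, sq e]
  · exact lift_apply (liftable_split hχ) (l := [a, b, c, d, e]) (dat_cell_iff.2 ⟨⟨Q, h⟩, hs⟩) rfl
  · have ht : ∀ i ∈ [a, b, c, d, e], ∀ j ∈ [a, b, c, d, e], ∀ x ∈ [a, b, c, d, e],
        ∀ y ∈ [a, b, c, d, e], ∀ z, term χ i j x y z = 0 := by
      intro i hi j hj x hx y hy z
      have h0 : D i j x y = 0 := by
        by_contra h0
        have hm {u} (hu : u ∈ [a, b, c, d, e]) := List.mem_map_of_mem (f := sq) hu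
        exact hs (span_of_D h0 (hm hi) (hm hj) (hm hx) (hm hy))
      rw [term, cyc, h0, zero_mul, zero_mul, mul_zero]
    rw [lift, if_neg fun h => hs (dat_cell_iff.1 h.1).2]
    simp (disch := simp) only [split, ht]
    norm_num

theorem d_lift_split (h : ∀ (P : Set (Fin 4 → ℤ)) (v : Fin 6 → Fin 4 → ℤ), Unimodular P →
      (∀ k, v k ∈ P) → (Function.Injective fun k => sq (v k)) → splitSum χ v = 0) :
    dat.d (lift 5 (ofFive fun a b c d e => (split χ a b c d e : ℂ))) = 0 := by
  have hl := lift_mem (liftable_split hχ) 5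
  funext l
  by_contra h0
  have hc := cell_of_d_ne_zero h0
  have hn : l.Nodup := by
    by_contra hn
    exact h0 ((alt_d hl.1).eq_zero_of_not_nodup hn)
  rw [d_of_cell hc] at h0
  obtain ⟨m, -, hm, h1⟩ := exists_of_cob_ne_zero h0
  rw [(hl.2.1 m h1).2] at hm
  obtain ⟨L, rfl⟩ := exists_map_sq hc
  obtain ⟨⟨Q, hQ⟩, -⟩ := dat_cell_iff.1 hc
  rw [List.length_map] at hm
  obtain ⟨v, rfl⟩ : ∃ v : Fin 6 → Fin 4 → ℤ, L = [v 0, v 1, v 2, v 3, v 4, v 5] := by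
    match L, hm with
    | [a, b, c, d, e, f], _ => exact ⟨![a, b, c, d, e, f], rfl⟩
  have hv (k : Fin 6) : sq (v k) ∈ [v 0, v 1, v 2, v 3, v 4, v 5].map sq := by
    fin_cases k <;> simp
  have hs := h (Set.range v) v ⟨?_, ?_⟩ (fun k => ⟨k, rfl⟩) (List.nodup_ofFn.1 hn)
  · apply h0
    have sub {m : List S} (hm : m.Sublist ([v 0, v 1, v 2, v 3, v 4, v 5].map sq)) :
        std.Face Q m :=
      ⟨hQ.1.sublist hm, fun x hx => hQ.2.1 x (hm.subset hx), fun i =>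
        (hQ.2.2 i).imp fun a ha => ⟨ha.1, fun h => ha.2 (hm.subset h)⟩⟩
    have s {x : S} {l : List S} : l.Sublist (x :: l) := List.sublist_cons_self x l
    have t {x : S} {l l' : List S} (h : l.Sublist l') : (x :: l).Sublist (x :: l') := h.cons_cons x
    have k0 := lift_split hχ (sub s)
    have k1 := lift_split hχ (sub (t s))
    have k2 := lift_split hχ (sub (t (t s)))
    have k3 := lift_split hχ (sub (t (t (t s))))
    have k4 := lift_split hχ (sub (t (t (t (t s)))))
    have k5 := lift_split hχ (sub (t (t (t (t (t s))))))
    rw [splitSum] at hs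
    have hs' := congrArg (Int.cast : ℤ → ℂ) hs
    push_cast at hs'
    simp only [List.map_cons, List.map_nil, cob_cons, k0, k1, k2, k3, k4, k5, cob, Pi.zero_apply]
    linear_combination hs'
  · rintro _ ⟨k, rfl⟩
    exact face_ne_zero hQ (hv k)
  · rintro _ ⟨i, rfl⟩ _ ⟨j, rfl⟩ _ ⟨k, rfl⟩ _ ⟨m, rfl⟩
    exact face_unimodular hQ (hv i) (hv j) (hv k) (hv m)

/-- The cochain of a weight. -/
noncomputable def splitCochain : cochains 5 :=
  ⟨lift 5 (ofFive fun a b c d e => (split χ a b c d e : ℂ)), lift_mem (liftable_split hχ) 5⟩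

lemma rowValue_splitCochain {p q r s : Fin 4 → ℤ} (h : D p q r s = 1) :
    rowValue (ell p) (ell q) (ell r) (ell s) (splitCochain hχ) =
      sym (ell r) (ell s) * χ p q (p + q) := by
  refine (onRows_tri (splitCochain hχ).2 h rfl rfl rfl rfl).trans ?_
  have hc : dat.Cell ([p, q, r, s, p + q].map sq) :=
    cell_arc h (l := [4, 7, 9, 3, 5]) (by decide) (by decide) (by decide +kernel)
  refine (lift_apply (liftable_split hχ) hc rfl).trans ?_
  rw [ofFive, split_tri hχ h]
  push_cast
  rfl

end

lemma rowValue_one {a b c d : ZMod 11} (h : a ≠ 0 ∨ b ≠ 0 ∨ c ≠ 0 ∨ d ≠ 0) :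
    rowValue a b c d (splitCochain tripleWeight_one) = sym c d := by
  obtain ⟨v, hv, rfl, rfl, rfl, rfl⟩ := exists_base h
  rw [rowValue_splitCochain _ hv, Int.cast_one, mul_one]

lemma rowValue_flat_of_zero {c d : ZMod 11} (h : c ≠ 0 ∨ d ≠ 0) :
    rowValue 0 0 c d (splitCochain tripleWeight_flat) = sym c d := by
  obtain ⟨v, hv, h0, h1, rfl, rfl⟩ := exists_base (a := 0) (b := 0) (.inr (.inr h))
  have := rowValue_splitCochain tripleWeight_flat hv
  rw [h0, h1] at this
  rw [this, flat, if_pos, Int.cast_one, mul_one]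
  refine ⟨fun x => ?_, h0, h1, by rw [ell_add, h0, h1, add_zero]⟩
  simp only [D_eq, Pi.add_apply]; ring1

lemma rowValue_flat_of_ne {a b c d : ZMod 11} (h : b ≠ 0) :
    rowValue a b c d (splitCochain tripleWeight_flat) = 0 := by
  obtain ⟨v, hv, rfl, rfl, rfl, rfl⟩ := exists_base (a := a) (c := c) (d := d) (.inr (.inl h))
  rw [rowValue_splitCochain _ hv, flat, if_neg fun hf => h hf.2.2.1, Int.cast_zero, mul_zero]

/-- Representatives of a basis of the cohomology. -/
noncomputable def basisCochain : Fin 2 → cochains 5 :=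
  ![splitCochain tripleWeight_flat,
    (4 : ℂ)⁻¹ • (splitCochain tripleWeight_one - splitCochain tripleWeight_flat)]

lemma d_basisCochain (i : Fin 2) : dat.d (basisCochain i).1 = 0 := by
  have h1 : dat.d (splitCochain tripleWeight_one).1 = 0 :=
    d_lift_split tripleWeight_one fun _ _ hP hv _ => splitSum_one hP hv
  have h2 : dat.d (splitCochain tripleWeight_flat).1 = 0 :=
    d_lift_split tripleWeight_flat fun _ _ hP hv hn => splitSum_flat hP hv hn
  fin_cases i
  · exact h2
  · change dat.d ((4 : ℂ)⁻¹ • ((splitCochain tripleWeight_one).1 -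
      (splitCochain tripleWeight_flat).1)) = 0
    rw [map_smul, map_sub, h1, h2, sub_zero, smul_zero]

lemma invariants_basisCochain (i : Fin 2) : invariants (basisCochain i) = Pi.single i 1 := by
  have s1 : sym 1 3 = 1 := by decide
  have s2 : sym 2 3 = -1 := by decide
  have h1 : invariants (splitCochain tripleWeight_one) = ![1, 4] := by
    funext k
    fin_cases k
    · refine (invariants_zero _).trans ?_
      rw [rowValue_one (by decide), s1]; simp
    · refine (invariants_one _).trans ?_
      rw [rowValue_one (by decide), rowValue_one (by decide), rowValue_one (by decide), s1, s2]
      norm_num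
  have h2 : invariants (splitCochain tripleWeight_flat) = ![1, 0] := by
    funext k
    fin_cases k
    · refine (invariants_zero _).trans ?_
      rw [rowValue_flat_of_zero (by decide), s1]; simp
    · refine (invariants_one _).trans ?_
      rw [rowValue_flat_of_ne (by decide), rowValue_flat_of_ne (by decide),
        rowValue_flat_of_ne (by decide)]
      norm_num
  fin_cases i
  · change invariants (splitCochain tripleWeight_flat) = _
    rw [h2]
    funext k
    fin_cases k <;> simp
  · change invariants ((4 : ℂ)⁻¹ • (splitCochain tripleWeight_one -
      splitCochain tripleWeight_flat)) = _
    rw [map_smul, map_sub, h1, h2]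
    funext k
    fin_cases k <;> simp

end SymForm

/-- `dim_ℂ H^5(Γ₀(11), ℂ) = 2`. -/
theorem finrank_H5_Gamma0_11 :
    Module.finrank ℂ (groupCohomology (Rep.trivial ℂ (Gamma0 11) ℂ) 5) = 2 :=
  (SymForm.exists_symmetry 11).choose_spec.finrank_groupCohomology SymForm.dat_laws 3 4 2 rfl
    SymForm.invariants SymForm.basisCochain SymForm.d_basisCochain SymForm.invariants_basisCochain
    (fun _ hy x hx => SymForm.invariants_d hy x hx) SymForm.exists_d_eq
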